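/- arXiv:1702.08854 — 2 statements merged into one kernel-verified Lean document; each statement's English description precedes it below -/
import Mathlib

section
/- For every ε > 0 there exists a constant C > 0 such that for every integer n ≥ 1 the following holds: if M is an n-variable positive definite integral quadratic form that is represented by I_r for some positive integer r, then M is represented by I_g for some positive integer g ≤ C·e^{(4+2√2+ε)√n}. (That is, g_ℤ(n) = O(e^{(k+ε)√n}) with k = (4+4√2)·√(1/2) = 4+2√2, where g_ℤ(n) is the smallest g such that every n-variable positive definite integral quadratic form that is a sum of squares of integral linear forms is a sum of g such squares.) -/
open scoped Matrix

/-- `M` (the Gram matrix of an `n`-variable integral quadratic form) is represented by `I_r`,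
i.e. the form is a sum of `r` squares of integral linear forms. -/
def RepBySquares (n r : ℕ) (M : Matrix (Fin n) (Fin n) ℤ) : Prop :=
  ∃ A : Matrix (Fin r) (Fin n) ℤ, M = Aᵀ * A

namespace RepBySquares

theorem of_fintype {ι : Type*} [Fintype ι] {n : ℕ} (A : Matrix ι (Fin n) ℤ) :
    RepBySquares n (Fintype.card ι) (Aᵀ * A) := by
  refine ⟨A.submatrix (Fintype.equivFin ι).symm id, ?_⟩
  rw [Matrix.transpose_submatrix, Matrix.submatrix_mul_equiv, Matrix.submatrix_id_id]

theorem add {n r s : ℕ} {M N : Matrix (Fin n) (Fin n) ℤ}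
    (hM : RepBySquares n r M) (hN : RepBySquares n s N) : RepBySquares n (r + s) (M + N) := by
  obtain ⟨A, rfl⟩ := hM
  obtain ⟨B, rfl⟩ := hN
  have h := of_fintype (Matrix.fromRows A B)
  rwa [Fintype.card_sum, Fintype.card_fin, Fintype.card_fin, Matrix.transpose_fromRows,
    Matrix.fromCols_mul_fromRows] at h

theorem zero (n r : ℕ) : RepBySquares n r 0 := ⟨0, by simp⟩

theorem mono {n r s : ℕ} {M : Matrix (Fin n) (Fin n) ℤ} (hM : RepBySquares n r M) (hrs : r ≤ s) :
    RepBySquares n s M := by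
  have h := hM.add (zero n (s - r))
  rwa [add_zero, Nat.add_sub_cancel' hrs] at h

theorem conj {n m r : ℕ} {M : Matrix (Fin n) (Fin n) ℤ} (hM : RepBySquares n r M)
    (Q : Matrix (Fin n) (Fin m) ℤ) : RepBySquares m r (Qᵀ * M * Q) := by
  obtain ⟨A, rfl⟩ := hM
  exact ⟨A * Q, by simp only [Matrix.transpose_mul, Matrix.mul_assoc]⟩

/-- By Lagrange's theorem, a nonnegative combination of squares of `k` integral linear forms is a
sum of `4 k` squares. -/
theorem sum_smul {ι : Type*} [Fintype ι] {n : ℕ} (w : ι → ℤ) (hw : ∀ p, 0 ≤ w p)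
    (v : ι → Fin n → ℤ) :
    RepBySquares n (4 * Fintype.card ι) (Matrix.of fun a b ↦ ∑ p, w p * (v p a * v p b)) := by
  choose c₀ c₁ c₂ c₃ hc using fun p ↦ Nat.sum_four_squares (w p).toNat
  have hc' (p) : w p = (c₀ p : ℤ) ^ 2 + (c₁ p : ℤ) ^ 2 + (c₂ p : ℤ) ^ 2 + (c₃ p : ℤ) ^ 2 := by
    rw [← Int.toNat_of_nonneg (hw p), ← hc p]
    push_cast
    ring
  let c (p : ι) : Fin 4 → ℤ := ![c₀ p, c₁ p, c₂ p, c₃ p]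
  have h := of_fintype (Matrix.of fun (t : Fin 4 × ι) a ↦ c t.2 t.1 * v t.2 a)
  rw [Fintype.card_prod, Fintype.card_fin] at h
  convert h using 1
  ext a b
  simp only [Matrix.of_apply, Matrix.mul_apply, Matrix.transpose_apply, Fintype.sum_prod_type,
    Fin.sum_univ_four, c, ← Finset.sum_add_distrib]
  refine Finset.sum_congr rfl fun p _ ↦ ?_
  rw [hc' p]
  simp
  ring

end RepBySquares

/-- The weights in the decomposition of a diagonally dominant symmetric matrix `N` as a nonnegative
combination of the squares of the forms `x_j` and `x_j ± x_k`. -/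
def dominantWeight {R : Type*} [CommRing R] [LinearOrder R] {n : ℕ} (N : Matrix (Fin n) (Fin n) R)
    (p : Fin n × Fin n) : R :=
  if p.1 < p.2 then |N p.1 p.2|
  else if p.1 = p.2 then N p.1 p.1 - ∑ k ∈ {p.1}ᶜ, |N p.1 k| else 0

/-- The forms `x_j` and `x_j ± x_k` in the decomposition of a diagonally dominant matrix. -/
def dominantVec {R : Type*} [CommRing R] [LinearOrder R] {n : ℕ} (N : Matrix (Fin n) (Fin n) R)
    (p : Fin n × Fin n) (a : Fin n) : ℤ :=
  if p.1 < p.2 then (if a = p.1 then 1 else 0) +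
      (SignType.sign (N p.1 p.2) : ℤ) * (if a = p.2 then 1 else 0)
  else if a = p.1 then 1 else 0

theorem dominantVec_eq_zero {R : Type*} [CommRing R] [LinearOrder R] {n : ℕ}
    (N : Matrix (Fin n) (Fin n) R) {p : Fin n × Fin n} {a : Fin n}
    (h : a < p.1) : dominantVec N p a = 0 := by
  unfold dominantVec
  split_ifs with h1 h2 h3 h4 <;> simp_all
  omega

section dominant

variable {R : Type*} [CommRing R] [LinearOrder R] [IsStrictOrderedRing R] {n : ℕ}

theorem sum_dominantWeight_mul (N : Matrix (Fin n) (Fin n) R) (hN : N.IsSymm) (a b : Fin n) :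
    ∑ p, dominantWeight N p * ((dominantVec N p a : R) * dominantVec N p b) = N a b := by
  let e (i j : Fin n) : R := if i = j then 1 else 0
  have key (j k : Fin n) : dominantWeight N (j, k) *
      ((dominantVec N (j, k) a : R) * dominantVec N (j, k) b)
      = e a j * (e b j * if j < k then |N j k| else 0)
      + e a k * (e b k * if j < k then |N j k| else 0)
      + e a j * (e b k * if j < k then N j k else 0)
      + e a k * (e b j * if j < k then N j k else 0)
      + e a j * (e b j * if j = k then N j j - ∑ l ∈ {j}ᶜ, |N j l| else 0) := by
    have hs : |N j k| * ((SignType.sign (N j k) : ℤ) : R) = N j k := by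
      rcases lt_trichotomy (N j k) 0 with h | h | h <;> simp [h, abs_of_neg, abs_of_pos]
    have hs2 : |N j k| * ((SignType.sign (N j k) : ℤ) : R) * ((SignType.sign (N j k) : ℤ) : R)
        = |N j k| := by
      rcases lt_trichotomy (N j k) 0 with h | h | h <;> simp [h]
    dsimp only [dominantWeight, dominantVec]
    rcases lt_trichotomy j k with h | h | h
    · simp only [h, h.ne, if_true, if_false]
      push_cast at hs hs2 ⊢
      change |N j k| * ((e a j + _ * e a k) * (e b j + _ * e b k)) = _
      linear_combination (e a j * e b k + e a k * e b j) * hs + e a k * e b k * hs2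
    · simp only [h, lt_irrefl, if_true, if_false]
      push_cast
      change _ * (e a k * e b k) = _
      ring
    · simp [h.not_gt, h.ne']
  have hsplit : ∑ k ∈ {a}ᶜ, |N a k|
      = (∑ k, if a < k then |N a k| else 0) + ∑ k, if k < a then |N k a| else 0 := by
    rw [← Finset.sum_add_distrib, ← Finset.sum_subset (Finset.subset_univ {a}ᶜ)]
    · refine Finset.sum_congr rfl fun k hk ↦ ?_
      rcases lt_or_gt_of_ne (Finset.mem_compl.1 hk ∘ Finset.mem_singleton.2) with h | h
      · simp [h, h.not_gt, hN.apply]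
      · simp [h, h.not_gt]
    · simp
  simp only [Fintype.sum_prod_type, key, Finset.sum_add_distrib]
  simp only [e, ite_mul, one_mul, zero_mul, Finset.sum_ite_eq, Finset.mem_univ, if_true,
    Finset.sum_ite_irrel, Finset.sum_const_zero]
  rcases lt_trichotomy a b with h | h | h
  · simp [h, h.ne', h.not_gt]
  · subst h
    simp [hsplit]
  · simp [h, h.not_gt, h.ne, hN.apply]

theorem dominantWeight_nonneg {N : Matrix (Fin n) (Fin n) R}
    (hN : ∀ j, ∑ k ∈ {j}ᶜ, |N j k| ≤ N j j) (p : Fin n × Fin n) : 0 ≤ dominantWeight N p := by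
  unfold dominantWeight
  split_ifs
  · exact abs_nonneg _
  · exact sub_nonneg.2 (hN _)
  · exact le_rfl

theorem dominantWeight_le {N : Matrix (Fin n) (Fin n) R} {j k : Fin n} {c : R}
    (hoff : ∀ k, j < k → |N j k| ≤ c) (hdiag : N j j ≤ c) (hc : 0 ≤ c) :
    dominantWeight N (j, k) ≤ c := by
  unfold dominantWeight
  split_ifs with h h'
  · exact hoff _ h
  · exact (sub_le_self _ (Finset.sum_nonneg fun _ _ ↦ abs_nonneg _)).trans hdiag
  · exact hc

theorem abs_sum_dominantVec_mul_le (N : Matrix (Fin n) (Fin n) R) (p : Fin n × Fin n)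
    {f : Fin n → R} {c : R} (hf : ∀ a, |f a| ≤ c) :
    |∑ a, (dominantVec N p a : R) * f a| ≤ 2 * c := by
  have hc : 0 ≤ c := (abs_nonneg _).trans (hf p.1)
  unfold dominantVec
  split_ifs
  · have : ∑ a, ((((if a = p.1 then 1 else 0) +
        (SignType.sign (N p.1 p.2) : ℤ) * (if a = p.2 then 1 else 0) : ℤ)) : R) * f a
        = f p.1 + ((SignType.sign (N p.1 p.2) : ℤ) : R) * f p.2 := by
      push_cast
      simp [add_mul, Finset.sum_add_distrib]
    rw [this, two_mul]
    refine (abs_add_le _ _).trans (add_le_add (hf _) ?_)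
    rcases lt_trichotomy (N p.1 p.2) 0 with h | h | h <;> simp [h, hf, hc]
  · simp
    linarith [hf p.1]

end dominant

/-- An error estimate for rounding the coefficients of a linear form. -/
theorem abs_mul_sub_round_mul_round_le {x y c : ℝ} (hx : |x| ≤ c) (hy : |y| ≤ c) (hc : 1 ≤ c) :
    |x * y - (round x : ℝ) * round y| ≤ 2 * c := by
  have h1 : |x - round x| ≤ 1 / 2 := abs_sub_round x
  have h2 : |y - round y| ≤ 1 / 2 := abs_sub_round y
  have h3 : x * y - (round x : ℝ) * round y
      = x * (y - round y) + (x - round x) * y - (x - round x) * (y - round y) := by ring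
  have h4 : |x * (y - round y)| ≤ c * (1 / 2) := by rw [abs_mul]; gcongr
  have h5 : |(x - round x) * y| ≤ 1 / 2 * c := by rw [abs_mul]; gcongr
  have h6 : |(x - round x) * (y - round y)| ≤ 1 / 2 * (1 / 2) := by rw [abs_mul]; gcongr
  rw [h3]
  rw [abs_le] at *
  constructor <;> linarith

theorem transpose_mul_diagonal_mul_apply {R : Type*} [CommSemiring R] {ι m : Type*}
    [Fintype ι] [DecidableEq ι]
    (A : Matrix ι m R) (d : ι → R) (i j : m) :
    (Aᵀ * Matrix.diagonal d * A) i j = ∑ k, d k * (A k i * A k j) := by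
  rw [Matrix.mul_apply]
  refine Finset.sum_congr rfl fun k _ ↦ ?_
  rw [Matrix.mul_diagonal, Matrix.transpose_apply]
  ring

theorem sum_sqrt_mul_congr {ι : Type*} [Fintype ι] {n : ℕ} {H : Matrix (Fin n) (Fin n) ℝ}
    {w : ι → ℝ} (hw : ∀ p, 0 ≤ w p) {v : ι → Fin n → ℤ}
    (hH : ∀ a b, ∑ p, w p * ((v p a : ℝ) * v p b) = H a b) (W : Matrix (Fin n) (Fin n) ℝ)
    (c d : Fin n) :
    ∑ p, (√(w p) * ∑ a, (v p a : ℝ) * W a c) * (√(w p) * ∑ a, (v p a : ℝ) * W a d)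
      = (Wᵀ * H * W) c d := by
  classical
  let v' : Matrix ι (Fin n) ℝ := Matrix.of fun p a ↦ (v p a : ℝ)
  have h1 : H = v'ᵀ * Matrix.diagonal w * v' := by
    ext a b
    rw [transpose_mul_diagonal_mul_apply, ← hH]
    rfl
  have h2 : Wᵀ * H * W = (v' * W)ᵀ * Matrix.diagonal w * (v' * W) := by
    rw [h1, Matrix.transpose_mul]
    simp only [Matrix.mul_assoc]
  rw [h2, transpose_mul_diagonal_mul_apply]
  refine Finset.sum_congr rfl fun p _ ↦ ?_
  rw [mul_mul_mul_comm, Real.mul_self_sqrt (hw p)]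
  rfl

set_option maxHeartbeats 1000000 in
/-- If a positive definite form has a triangular reduction which is well conditioned and whose
diagonal part is large, then it is a sum of at most `5 n ^ 2` squares. -/
theorem repBySquares_of_reduced {n : ℕ} {M : Matrix (Fin n) (Fin n) ℤ}
    {W V : Matrix (Fin n) (Fin n) ℝ} {h : Fin n → ℝ} {S q : ℝ} (hS : 1 ≤ S) (hq : 1 ≤ q)
    (hM : M.map (fun x ↦ (x : ℝ)) = Wᵀ * Matrix.diagonal h * W) (hWV : W * V = 1)
    (hWu : ∀ i j, j < i → W i j = 0) (hVu : ∀ i j, j < i → V i j = 0)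
    (hWS : ∀ i j, |W i j| ≤ S) (hVS : ∀ i j, |V i j| ≤ S)
    (hh : ∀ i j, i ≤ j → h i ≤ q * h j) (hlarge : ∀ i, 16 * n ^ 10 * S ^ 6 * q ^ 3 ≤ h i) :
    RepBySquares n (5 * n ^ 2) M := by
  rcases Nat.eq_zero_or_pos n with rfl | hn
  · exact ⟨0, Subsingleton.elim _ _⟩
  have hn1 : (1 : ℝ) ≤ n := by exact_mod_cast hn
  have hn0 : (0 : ℝ) < n := by linarith
  have hS0 : 0 < S := by linarith
  have hq0 : 0 < q := by linarith
  have hpos (i) : 0 < h i := lt_of_lt_of_le (by positivity) (hlarge i)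
  have hMs : M.IsSymm := by
    have : (M.map (fun x ↦ (x : ℝ))).IsSymm := by
      rw [Matrix.IsSymm, hM]
      simp [Matrix.transpose_mul, Matrix.mul_assoc]
    ext i j
    have := this.apply i j
    simpa using this
  set δ : ℝ := 1 / (n ^ 2 * S ^ 2 * q) with hδ
  have hδ0 : 0 < δ := by positivity
  set F : Matrix (Fin n) (Fin n) ℝ := δ • (Vᵀ * Matrix.diagonal h * V) with hF
  have hFapp (j k) : F j k = δ * ∑ i, V i j * h i * V i k := by
    rw [hF, Matrix.smul_apply, transpose_mul_diagonal_mul_apply, smul_eq_mul]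
    congr 1
    exact Finset.sum_congr rfl fun i _ ↦ by ring
  have hFle (j k) : |F j k| ≤ h j / n := by
    rw [hFapp, abs_mul, abs_of_pos hδ0]
    have : |∑ i, V i j * h i * V i k| ≤ ∑ _i : Fin n, S * (q * h j) * S := by
      refine (Finset.abs_sum_le_sum_abs _ _).trans (Finset.sum_le_sum fun i _ ↦ ?_)
      rcases lt_or_ge j i with hij | hij
      · rw [hVu i j hij]
        have := hpos j
        simp only [zero_mul, abs_zero]
        positivity
      · rw [abs_mul, abs_mul, abs_of_pos (hpos i)]
        have := hpos j
        have := hpos i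
        gcongr
        · exact hVS i j
        · exact hh i j hij
        · exact hVS i k
    calc δ * |∑ i, V i j * h i * V i k| ≤ δ * ∑ _i : Fin n, S * (q * h j) * S := by gcongr
      _ = h j / n := by
        rw [Finset.sum_const, Finset.card_univ, Fintype.card_fin, nsmul_eq_mul, hδ]
        field_simp
  set H : Matrix (Fin n) (Fin n) ℝ := Matrix.diagonal h - F with hH
  have hHs : H.IsSymm := by
    rw [Matrix.IsSymm, hH, hF]
    simp [Matrix.transpose_mul, Matrix.mul_assoc]
  have hHoff {j k} (hjk : j ≠ k) : |H j k| = |F j k| := by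
    simp [hH, Matrix.diagonal_apply_ne _ hjk]
  have hHdiag (j) : H j j = h j - F j j := by simp [hH]
  have hHdom (j) : ∑ k ∈ {j}ᶜ, |H j k| ≤ H j j := by
    have h1 : ∑ k, |F j k| ≤ ∑ _k : Fin n, h j / n := Finset.sum_le_sum fun k _ ↦ hFle j k
    rw [Finset.sum_const, Finset.card_univ, Fintype.card_fin, nsmul_eq_mul,
      mul_div_cancel₀ _ hn0.ne', ← Finset.sum_add_sum_compl {j}, Finset.sum_singleton] at h1
    rw [hHdiag, Finset.sum_congr rfl fun k hk ↦ hHoff (j := j) (k := k) (by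
      rintro rfl; simp at hk)]
    linarith [le_abs_self (F j j)]
  have hwle (p : Fin n × Fin n) : dominantWeight H p ≤ h p.1 := by
    have h1 : h p.1 / n ≤ h p.1 := div_le_self (hpos _).le hn1
    refine dominantWeight_le (fun k hk ↦ ?_) ?_ (hpos _).le
    · rw [hHoff hk.ne]
      exact (hFle _ _).trans h1
    · have : 0 ≤ F p.1 p.1 := by
        rw [hFapp]
        refine mul_nonneg hδ0.le (Finset.sum_nonneg fun i _ ↦ ?_)
        rw [mul_right_comm]
        exact mul_nonneg (mul_self_nonneg _) (hpos i).le
      linarith [hHdiag p.1]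
  have hw0 := dominantWeight_nonneg hHdom
  set r : Fin n × Fin n → Fin n → ℝ := fun p c ↦
    √(dominantWeight H p) * ∑ a, (dominantVec H p a : ℝ) * W a c with hr
  have hr0 {p c} (hc : c < p.1) : r p c = 0 := by
    rw [hr]
    refine mul_eq_zero_of_right _ (Finset.sum_eq_zero fun a _ ↦ ?_)
    rcases lt_or_ge a p.1 with ha | ha
    · simp [dominantVec_eq_zero H ha]
    · simp [hWu a c (hc.trans_le ha)]
  have hrle {p c d} (hc : p.1 ≤ d) : |r p c| ≤ 2 * S * √(q * h d) := by
    rw [hr]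
    dsimp only
    rw [abs_mul, abs_of_nonneg (Real.sqrt_nonneg _), mul_comm]
    gcongr
    · exact abs_sum_dominantVec_mul_le H p fun a ↦ hWS a c
    · exact (hwle p).trans (hh _ _ hc)
  have hrsum (c d) : ∑ p, r p c * r p d = M c d - if c = d then δ * h c else 0 := by
    have h1 : M.map (fun x ↦ (x : ℝ)) - δ • Matrix.diagonal h = Wᵀ * H * W := by
      have hVW : V * W = 1 := mul_eq_one_comm.1 hWV
      have hVW' : Wᵀ * Vᵀ = 1 := by rw [← Matrix.transpose_mul, hVW, Matrix.transpose_one]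
      have : Wᵀ * F * W = δ • ((Wᵀ * Vᵀ) * Matrix.diagonal h * (V * W)) := by
        simp only [hF, Matrix.mul_smul, Matrix.smul_mul, Matrix.mul_assoc]
      rw [hH, Matrix.mul_sub, Matrix.sub_mul, ← hM, this, hVW, hVW', one_mul, mul_one]
    have h2 := congrFun (congrFun h1 c) d
    have h3 : (M c d : ℝ) - (if c = d then δ * h c else 0) = (Wᵀ * H * W) c d := by
      rw [← h2]
      simp [Matrix.diagonal_apply]
    rw [h3]
    exact sum_sqrt_mul_congr hw0 (sum_dominantWeight_mul H hHs) W c d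
  set b : Fin n × Fin n → Fin n → ℤ := fun p c ↦ round (r p c) with hb
  set N : Matrix (Fin n) (Fin n) ℤ := Matrix.of fun c d ↦ M c d - ∑ p, b p c * b p d with hN
  have hNs : N.IsSymm := by
    ext c d
    change M d c - ∑ p, b p d * b p c = M c d - ∑ p, b p c * b p d
    rw [hMs.apply c d]
    exact congrArg _ (Finset.sum_congr rfl fun p _ ↦ mul_comm _ _)
  have hNerr (c d) : |(N c d : ℝ) - if c = d then δ * h c else 0|
      ≤ n ^ 2 * (4 * S * √(q * h c)) := by
    have h1 : (N c d : ℝ) - (if c = d then δ * h c else 0)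
        = ∑ p, (r p c * r p d - (b p c : ℝ) * b p d) := by
      rw [Finset.sum_sub_distrib, hrsum]
      simp only [hN, Matrix.of_apply]
      push_cast
      ring
    rw [h1]
    refine (Finset.abs_sum_le_sum_abs _ _).trans ((Finset.sum_le_sum
      (g := fun _ ↦ 4 * S * √(q * h c)) fun p _ ↦ ?_).trans_eq ?_)
    · rcases lt_or_ge c p.1 with hc | hc
      · simp only [hb, hr0 hc, round_zero, Int.cast_zero, zero_mul, sub_zero, abs_zero]
        positivity
      · refine (abs_mul_sub_round_mul_round_le (hrle hc) (hrle hc) ?_).trans_eq (by ring)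
        have : 1 ≤ √(q * h c) := by
          rw [Real.one_le_sqrt]
          refine one_le_mul_of_one_le_of_one_le hq (le_trans ?_ (hlarge c))
          have h1 := one_le_pow₀ (n := 10) hn1
          have h2 := one_le_pow₀ (n := 6) hS
          have h3 := one_le_pow₀ (n := 3) hq
          exact one_le_mul_of_one_le_of_one_le (one_le_mul_of_one_le_of_one_le
            (one_le_mul_of_one_le_of_one_le (by norm_num) h1) h2) h3
        nlinarith
    · simp [sq]
  have hNdom (c) : ∑ d ∈ {c}ᶜ, |N c d| ≤ N c c := by
    have h1 : ∑ d, |(N c d : ℝ) - if c = d then δ * h c else 0| ≤ δ * h c := by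
      refine (Finset.sum_le_sum fun d _ ↦ hNerr c d).trans ?_
      rw [Finset.sum_const, Finset.card_univ, Fintype.card_fin, nsmul_eq_mul]
      have h2 : 4 * n ^ 5 * S ^ 3 * q * √q ≤ √(h c) := by
        apply Real.le_sqrt_of_sq_le
        refine le_of_eq_of_le ?_ (hlarge c)
        rw [mul_pow, Real.sq_sqrt hq0.le]
        ring
      have h3 : δ * h c = δ * (√(h c) * √(h c)) := by rw [Real.mul_self_sqrt (hpos c).le]
      rw [h3, Real.sqrt_mul hq0.le]
      calc n * (n ^ 2 * (4 * S * (√q * √(h c))))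
          = δ * ((4 * n ^ 5 * S ^ 3 * q * √q) * √(h c)) := by rw [hδ]; field_simp
        _ ≤ δ * (√(h c) * √(h c)) := by gcongr
    rw [← Finset.sum_add_sum_compl {c}, Finset.sum_singleton, if_pos rfl,
      Finset.sum_congr rfl (g := fun d ↦ |(N c d : ℝ)|) fun d hd ↦ by
        rw [if_neg (by rintro rfl; simp at hd), sub_zero]] at h1
    have h2 := neg_abs_le ((N c c : ℝ) - δ * h c)
    have : ∑ d ∈ {c}ᶜ, |(N c d : ℝ)| ≤ N c c := by linarith
    exact_mod_cast this
  have h1 := RepBySquares.of_fintype (Matrix.of b)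
  have h2 := RepBySquares.sum_smul _ (dominantWeight_nonneg hNdom) (dominantVec N)
  have h3 := h1.add h2
  rw [Fintype.card_prod, Fintype.card_fin] at h3
  convert h3 using 1
  · ring
  · ext c d
    have := sum_dominantWeight_mul N hNs c d
    simp only [Int.cast_id] at this
    have hN' : N c d = M c d - ∑ p, b p c * b p d := rfl
    rw [Matrix.add_apply, Matrix.mul_apply, Matrix.of_apply, this, hN']
    simp

/-- Minkowski's theorem on linear forms, for a unitriangular system. -/
theorem exists_int_mulVec_lt {n : ℕ} {U : Matrix (Fin n) (Fin n) ℝ} (hU1 : ∀ i, U i i = 1)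
    (hU0 : ∀ i j, j < i → U i j = 0) {t : Fin n → ℝ} (ht : ∀ i, 0 < t i) (hp : 1 < ∏ i, t i) :
    ∃ x : Fin n → ℤ, x ≠ 0 ∧ ∀ i, |(U *ᵥ fun j ↦ (x j : ℝ)) i| < t i := by
  have hdet : LinearMap.det (Matrix.toLin' U) = 1 := by
    rw [LinearMap.det_toLin', Matrix.det_of_isUpperTriangular fun i j h ↦ hU0 i j h]
    simp [hU1]
  let b := Pi.basisFun ℝ (Fin n)
  let s : Set (Fin n → ℝ) := Set.univ.pi fun i ↦ Set.Ioo (-t i) (t i)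
  have hvol : MeasureTheory.volume (ZSpan.fundamentalDomain b) * 2 ^ Module.finrank ℝ (Fin n → ℝ)
      < MeasureTheory.volume (Matrix.toLin' U ⁻¹' s) := by
    rw [MeasureTheory.Measure.addHaar_preimage_linearMap _ (by rw [hdet]; exact one_ne_zero), hdet,
      Real.volume_pi_Ioo, ZSpan.fundamentalDomain_pi_basisFun, MeasureTheory.volume_pi_pi]
    simp only [Real.volume_Ico, sub_zero, ENNReal.ofReal_one, Finset.prod_const_one, one_mul,
      Module.finrank_fin_fun, inv_one, abs_one]
    rw [← ENNReal.ofReal_prod_of_nonneg fun i _ ↦ by linarith [ht i],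
      ← ENNReal.ofReal_ofNat, ← ENNReal.ofReal_pow (by norm_num)]
    have h2 : ∏ i, (t i - -t i) = 2 ^ n * ∏ i, t i := by
      simp only [sub_neg_eq_add, ← two_mul, Finset.prod_mul_distrib, Finset.prod_const,
        Finset.card_univ, Fintype.card_fin]
    rw [h2]
    apply (ENNReal.ofReal_lt_ofReal_iff (by positivity)).2
    nlinarith [pow_pos (two_pos : (0 : ℝ) < 2) n]
  have : Countable (Submodule.span ℤ (Set.range b)).toAddSubgroup :=
    inferInstanceAs (Countable (Submodule.span ℤ (Set.range b)))
  obtain ⟨y, hy0, hy⟩ := MeasureTheory.exists_ne_zero_mem_lattice_of_measure_mul_two_pow_lt_measure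
    (ZSpan.isAddFundamentalDomain' b MeasureTheory.volume) (s := Matrix.toLin' U ⁻¹' s)
    (fun x hx i _ ↦ by
      have := hx i trivial
      rw [map_neg, Pi.neg_apply]
      exact ⟨by linarith [this.2], by linarith [this.1]⟩)
    ((convex_pi fun i _ ↦ convex_Ioo _ _).linear_preimage _) hvol
  have hmem : (y : Fin n → ℝ) ∈ Submodule.span ℤ (Set.range b) := y.2
  rw [b.mem_span_iff_repr_mem ℤ] at hmem
  choose x hx using hmem
  have hxy : (fun j ↦ (x j : ℝ)) = (y : Fin n → ℝ) := funext fun j ↦ by simpa [b] using hx j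
  refine ⟨x, ?_, fun i ↦ ?_⟩
  · rintro rfl
    exact hy0 (Subtype.ext (by rw [← hxy]; ext; simp))
  · rw [hxy]
    exact abs_lt.2 (hy i trivial)

/-- A sequence which is nearly bounded by its averages grows at most logarithmically. -/
theorem le_of_forall_le_average {b : ℕ → ℝ} {c : ℝ} {N : ℕ} (hc : 0 ≤ c) (hb0 : b 0 = 0)
    (hb : ∀ m ≤ N, (m + 1) * (b m - c) ≤ ∑ k ∈ Finset.range (m + 1), b k) :
    b N ≤ c * (2 + Real.log (N + 1)) := by
  have key : ∀ m ≤ N, ∑ k ∈ Finset.range (m + 1), b k ≤ (m + 1) * (c * harmonic m) := by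
    intro m
    induction m with
    | zero => simp [hb0]
    | succ m ih =>
      intro hm
      have h1 := ih (by omega)
      have h2 := hb (m + 1) hm
      rw [Finset.sum_range_succ] at h2 ⊢
      rw [harmonic_succ]
      push_cast at h2 ⊢
      have hm0 : (0 : ℝ) < m + 1 := by positivity
      set s := ∑ k ∈ Finset.range (m + 1), b k
      have h3 : (m + 1) * (s + b (m + 1)) ≤ (m + 2) * (s + c) := by nlinarith
      have h4 : (m + 2) * (s + c) ≤ (m + 2) * ((m + 1) * (c * harmonic m) + c) := by gcongr
      have h5 : (m + 2) * ((m + 1) * (c * harmonic m) + c)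
          = (m + 1) * ((m + 1 + 1) * (c * (harmonic m + ((m : ℝ) + 1)⁻¹))) := by
        field_simp
        ring
      exact le_of_mul_le_mul_left (h3.trans (h4.trans_eq h5)) hm0
  have h1 := hb N le_rfl
  have h2 := key N le_rfl
  have h3 : (harmonic N : ℝ) ≤ 1 + Real.log (N + 1) := by
    refine (harmonic_le_one_add_log N).trans (add_le_add le_rfl ?_)
    rcases Nat.eq_zero_or_pos N with rfl | hN
    · simp
    · exact Real.log_le_log (by exact_mod_cast hN) (by linarith)
  have h4 : (N + 1 : ℝ) * (b N - c) ≤ (N + 1) * (c * (1 + Real.log (N + 1))) :=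
    h1.trans (h2.trans (by gcongr))
  have h5 := le_of_mul_le_mul_left h4 (by positivity)
  linarith

section reduced

variable {n : ℕ} {U : Matrix (Fin n) (Fin n) ℝ} {h : Fin n → ℝ}

theorem mulVec_eq_zero_of_forall_ge (hU0 : ∀ i j, j < i → U i j = 0) {x : Fin n → ℤ} {k : Fin n}
    (hx : ∀ l ≥ k, x l = 0) : (U *ᵥ fun j ↦ (x j : ℝ)) k = 0 := by
  rw [Matrix.mulVec, dotProduct]
  refine Finset.sum_eq_zero fun l _ ↦ ?_
  rcases lt_or_ge l k with hl | hl
  · simp [hU0 k l hl]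
  · simp [hx l hl]

theorem mulVec_eq_of_forall_gt (hU1 : ∀ i, U i i = 1) (hU0 : ∀ i j, j < i → U i j = 0)
    {x : Fin n → ℤ} {k : Fin n} (hx : ∀ l > k, x l = 0) :
    (U *ᵥ fun j ↦ (x j : ℝ)) k = x k := by
  rw [Matrix.mulVec, dotProduct, Finset.sum_eq_single k]
  · simp [hU1]
  · intro l _ hl
    rcases lt_or_gt_of_ne hl with hl | hl
    · simp [hU0 k l hl]
    · simp [hx l hl]
  · simp

theorem card_mul_log_le_of_isReduced (hU1 : ∀ i, U i i = 1) (hU0 : ∀ i j, j < i → U i j = 0)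
    (hpos : ∀ i, 0 < h i)
    (hmin : ∀ i (x : Fin n → ℤ), (∃ j ≥ i, x j ≠ 0) →
      h i ≤ ∑ j ∈ Finset.Ici i, h j * (U *ᵥ fun j ↦ (x j : ℝ)) j ^ 2) {i j : Fin n} (hij : i ≤ j) :
    (Finset.Icc i j).card * (Real.log (h i) - Real.log (4 * n))
      ≤ ∑ k ∈ Finset.Icc i j, Real.log (h k) := by
  set m := (Finset.Icc i j).card with hm
  have hm0 : 0 < m := Finset.card_pos.2 (Finset.nonempty_Icc.2 hij)
  have hmR : (0 : ℝ) < m := by exact_mod_cast hm0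
  have hmn : (m : ℝ) ≤ n := by
    exact_mod_cast (Finset.card_le_univ _).trans_eq (Fintype.card_fin n)
  set G : ℝ := (∑ k ∈ Finset.Icc i j, Real.log (h k)) / m with hG
  let t : Fin n → ℝ := fun k ↦
    if k ∈ Finset.Icc i j then 2 * Real.exp ((G - Real.log (h k)) / 2) else 1
  have ht (k) : 0 < t k := by
    dsimp only [t]
    split_ifs <;> positivity
  have hprod : 1 < ∏ k, t k := by
    have : ∏ k, t k = 2 ^ m := by
      simp only [t]
      rw [Finset.prod_ite_mem, Finset.univ_inter, Finset.prod_mul_distrib, Finset.prod_const,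
        ← Real.exp_sum, ← Finset.sum_div, Finset.sum_sub_distrib, Finset.sum_const, nsmul_eq_mul,
        ← hm, hG, mul_div_cancel₀ _ hmR.ne', sub_self, zero_div, Real.exp_zero, mul_one]
    rw [this]
    exact one_lt_pow₀ one_lt_two hm0.ne'
  obtain ⟨x, hx0, hx⟩ := exists_int_mulVec_lt hU1 hU0 ht hprod
  obtain ⟨k₀, hk₀, hmax⟩ : ∃ k, x k ≠ 0 ∧ ∀ l > k, x l = 0 := by
    have hne : (Finset.univ.filter fun k ↦ x k ≠ 0).Nonempty := by
      obtain ⟨k, hk⟩ := Function.ne_iff.1 hx0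
      exact ⟨k, by simpa using hk⟩
    refine ⟨_, (Finset.mem_filter.1 (Finset.max'_mem _ hne)).2, fun l hl ↦ ?_⟩
    by_contra hl0
    exact absurd (Finset.le_max' _ l (by simpa using hl0)) (not_le.2 hl)
  have hk₀mem : k₀ ∈ Finset.Icc i j := by
    by_contra hk
    have := hx k₀
    rw [mulVec_eq_of_forall_gt hU1 hU0 hmax] at this
    simp only [t, if_neg hk] at this
    have h1 : |x k₀| < 1 := by exact_mod_cast this
    exact hk₀ (Int.abs_lt_one_iff.1 h1)
  have h1 := hmin i x ⟨k₀, (Finset.mem_Icc.1 hk₀mem).1, hk₀⟩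
  have h2 : ∑ k ∈ Finset.Ici i, h k * (U *ᵥ fun j ↦ (x j : ℝ)) k ^ 2
      = ∑ k ∈ Finset.Icc i j, h k * (U *ᵥ fun j ↦ (x j : ℝ)) k ^ 2 := by
    refine (Finset.sum_subset (fun k hk ↦ Finset.mem_Ici.2 (Finset.mem_Icc.1 hk).1)
      fun k hk hk' ↦ ?_).symm
    have hjk : j < k := by
      by_contra hkj
      exact hk' (Finset.mem_Icc.2 ⟨Finset.mem_Ici.1 hk, not_lt.1 hkj⟩)
    rw [mulVec_eq_zero_of_forall_ge hU0 fun l hl ↦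
      hmax l (((Finset.mem_Icc.1 hk₀mem).2.trans_lt hjk).trans_le hl)]
    simp
  have h3 : ∑ k ∈ Finset.Icc i j, h k * (U *ᵥ fun j ↦ (x j : ℝ)) k ^ 2
      ≤ ∑ _k ∈ Finset.Icc i j, 4 * Real.exp G := by
    refine Finset.sum_le_sum fun k hk ↦ ?_
    have h4 : (U *ᵥ fun j ↦ (x j : ℝ)) k ^ 2 ≤ t k ^ 2 := by
      rw [← sq_abs]
      exact pow_le_pow_left₀ (abs_nonneg _) (hx k).le 2
    have h5 : h k * t k ^ 2 = 4 * Real.exp G := by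
      simp only [t, if_pos hk]
      rw [mul_pow, ← Real.exp_nat_mul]
      push_cast
      rw [mul_div_cancel₀ _ two_ne_zero, Real.exp_sub, Real.exp_log (hpos k)]
      have := (hpos k).ne'
      field_simp
      norm_num
    rw [← h5]
    exact mul_le_mul_of_nonneg_left h4 (hpos k).le
  rw [Finset.sum_const, nsmul_eq_mul, ← hm] at h3
  have h6 : h i ≤ 4 * n * Real.exp G := by
    refine (h1.trans_eq h2).trans (h3.trans ?_)
    nlinarith [Real.exp_pos G]
  have h7 := Real.log_le_log (hpos i) h6
  rw [Real.log_mul (by linarith) (Real.exp_pos G).ne', Real.log_exp] at h7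
  have h8 : ∑ k ∈ Finset.Icc i j, Real.log (h k) = m * G := by
    rw [hG, mul_div_cancel₀ _ hmR.ne']
  rw [h8]
  exact mul_le_mul_of_nonneg_left (by linarith) hmR.le

/-- In a Hermite–Korkine–Zolotarev reduced basis the squared lengths of the orthogonalized vectors
decrease at most quasi-polynomially. -/
theorem le_mul_of_isReduced (hU1 : ∀ i, U i i = 1) (hU0 : ∀ i j, j < i → U i j = 0)
    (hpos : ∀ i, 0 < h i)
    (hmin : ∀ i (x : Fin n → ℤ), (∃ j ≥ i, x j ≠ 0) →
      h i ≤ ∑ j ∈ Finset.Ici i, h j * (U *ᵥ fun j ↦ (x j : ℝ)) j ^ 2) {i j : Fin n} (hij : i ≤ j) :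
    h i ≤ Real.exp (Real.log (4 * n) * (2 + Real.log n)) * h j := by
  let b : ℕ → ℝ := fun m ↦ Real.log (h ⟨j - m, by omega⟩) - Real.log (h j)
  have hn1 : (1 : ℝ) ≤ n := by exact_mod_cast (show 1 ≤ n by have := i.2; omega)
  have hc : 0 ≤ Real.log (4 * n) := Real.log_nonneg (by linarith)
  have key := le_of_forall_le_average (b := b) (N := j - i) hc (by simp [b]) fun m hm ↦ by
    have hm' : m ≤ (j : ℕ) := hm.trans (Nat.sub_le _ _)
    have h1 := card_mul_log_le_of_isReduced hU1 hU0 hpos hmin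
      (i := ⟨j - m, by omega⟩) (j := j) (Fin.le_def.2 (Nat.sub_le _ _))
    have h2 : ∑ k ∈ Finset.range (m + 1), b k
        = ∑ k ∈ Finset.Icc (⟨j - m, by omega⟩ : Fin n) j, (Real.log (h k) - Real.log (h j)) := by
      refine Finset.sum_bij' (fun k _ ↦ ⟨j - k, by omega⟩) (fun k _ ↦ j - k) ?_ ?_ ?_ ?_ ?_
      · intro k hk
        rw [Finset.mem_range] at hk
        rw [Finset.mem_Icc, Fin.le_def, Fin.le_def]
        dsimp only
        omega
      · intro k hk
        rw [Finset.mem_Icc, Fin.le_def, Fin.le_def] at hk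
        rw [Finset.mem_range]
        dsimp only at hk
        omega
      · intro k hk
        rw [Finset.mem_range] at hk
        dsimp only
        omega
      · intro k hk
        rw [Finset.mem_Icc, Fin.le_def, Fin.le_def] at hk
        ext
        dsimp only
        omega
      · intro k hk
        rfl
    have h3 : (Finset.Icc (⟨j - m, by omega⟩ : Fin n) j).card = m + 1 := by
      rw [Fin.card_Icc]
      dsimp only
      omega
    rw [h2, Finset.sum_sub_distrib, Finset.sum_const, nsmul_eq_mul, h3]
    rw [h3] at h1
    push_cast at h1 ⊢
    linarith
  have h4 : b (j - i) = Real.log (h i) - Real.log (h j) := by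
    have : (⟨j - (j - i), by omega⟩ : Fin n) = i := by
      ext
      dsimp only
      have := Fin.le_def.1 hij
      omega
    simp only [b, this]
  have h5 : Real.log ((j - i : ℕ) + 1) ≤ Real.log n := by
    refine Real.log_le_log (by positivity) ?_
    have := j.2
    exact_mod_cast (show (j : ℕ) - i + 1 ≤ n by omega)
  have h6 : Real.log (h i) ≤ Real.log (4 * n) * (2 + Real.log n) + Real.log (h j) := by
    have := mul_le_mul_of_nonneg_left (add_le_add_right h5 2) hc
    linarith
  calc h i = Real.exp (Real.log (h i)) := (Real.exp_log (hpos i)).symm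
    _ ≤ Real.exp (Real.log (4 * n) * (2 + Real.log n) + Real.log (h j)) := Real.exp_le_exp.2 h6
    _ = _ := by rw [Real.exp_add, Real.exp_log (hpos j)]

end reduced

/-- Every nonzero integral vector is a multiple of the first vector of some basis of the lattice. -/
theorem exists_linearEquiv_smul_single {n : ℕ} {v : Fin (n + 1) → ℤ} (hv : v ≠ 0) :
    ∃ (e : (Fin (n + 1) → ℤ) ≃ₗ[ℤ] (Fin (n + 1) → ℤ)) (k : ℤ), v = k • e (Pi.single 0 1) := by
  obtain ⟨m, bM, bN, f, a, snf⟩ :=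
    Submodule.smithNormalForm (Pi.basisFun ℤ (Fin (n + 1))) (Submodule.span ℤ {v})
  have hvN : v ∈ Submodule.span ℤ {v} := Submodule.mem_span_singleton_self v
  obtain ⟨i⟩ : Nonempty (Fin m) := by
    by_contra hm
    rw [not_nonempty_iff] at hm
    have : (⟨v, hvN⟩ : Submodule.span ℤ {v}) = 0 := by
      rw [← bN.sum_repr ⟨v, hvN⟩, Finset.univ_eq_empty, Finset.sum_empty]
    exact hv (congrArg Subtype.val this)
  obtain ⟨c, hc⟩ := Submodule.mem_span_singleton.1 (bN i).2
  have hc0 : c ≠ 0 := by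
    rintro rfl
    rw [zero_smul] at hc
    exact bN.ne_zero i (Subtype.ext hc.symm)
  rw [snf] at hc
  have hrepr (j) (hj : j ≠ f i) : bM.repr v j = 0 := by
    have := congrArg (fun y ↦ bM.repr y j) hc
    simp only [map_smul, Finsupp.smul_apply, Module.Basis.repr_self, Finsupp.single_apply,
      if_neg hj.symm, smul_eq_mul, mul_zero] at this
    exact (mul_eq_zero.1 this).resolve_left hc0
  let b := bM.reindex (Equiv.swap (f i) 0)
  refine ⟨b.equivFun.symm, bM.repr v (f i), ?_⟩
  have h1 : b.equivFun.symm (Pi.single 0 1) = bM (f i) := by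
    simp [b, Module.Basis.equivFun_symm_apply, Pi.single_apply]
  rw [h1]
  conv_lhs => rw [← bM.sum_repr v]
  exact Finset.sum_eq_single _ (fun j _ hj ↦ by rw [hrepr j hj, zero_smul]) (by simp)

/-- A positive bilinear form with bounded denominators on a nonzero lattice has a minimal vector. -/
theorem exists_minimal_vector {L : Type*} [AddCommGroup L] [Nontrivial L]
    (B : L →ₗ[ℤ] L →ₗ[ℤ] ℝ) (hpos : ∀ x ≠ 0, 0 < B x x) {d : ℕ} (hd : 0 < d)
    (hB : ∀ x y, ∃ k : ℤ, d * B x y = k) : ∃ v ≠ 0, ∀ x ≠ 0, B v v ≤ B x x := by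
  have hdR : (0 : ℝ) < d := by exact_mod_cast hd
  choose k hk using fun x ↦ hB x x
  obtain ⟨x₀, hx₀⟩ := exists_ne (0 : L)
  obtain ⟨v, hv, hmin⟩ := WellFounded.has_min (measure fun x : L ↦ (k x).toNat).wf {x | x ≠ 0}
    ⟨x₀, hx₀⟩
  refine ⟨v, hv, fun x hx ↦ ?_⟩
  have h1 : (k v).toNat ≤ (k x).toNat := not_lt.1 (hmin x hx)
  have h2 : 0 < k x := by
    have := mul_pos hdR (hpos x hx)
    rw [hk] at this
    exact_mod_cast this
  have h3 : k v ≤ k x := by omega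
  have h4 : (k v : ℝ) ≤ k x := by exact_mod_cast h3
  rw [← hk, ← hk] at h4
  exact le_of_mul_le_mul_left h4 hdR

/-- Existence of Hermite–Korkine–Zolotarev reduced bases. -/
theorem exists_isReduced {n : ℕ} (B : (Fin n → ℤ) →ₗ[ℤ] (Fin n → ℤ) →ₗ[ℤ] ℝ)
    (hsymm : ∀ x y, B x y = B y x) (hpos : ∀ x ≠ 0, 0 < B x x) {d : ℕ} (hd : 0 < d)
    (hB : ∀ x y, ∃ k : ℤ, d * B x y = k) :
    ∃ (e : (Fin n → ℤ) ≃ₗ[ℤ] (Fin n → ℤ)) (U : Matrix (Fin n) (Fin n) ℝ) (h : Fin n → ℝ),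
      (∀ i, U i i = 1) ∧ (∀ i j, j < i → U i j = 0) ∧ (∀ i, 0 < h i) ∧
      (∀ x, B (e x) (e x) = ∑ j, h j * (U *ᵥ fun j ↦ (x j : ℝ)) j ^ 2) ∧
      ∀ i (x : Fin n → ℤ), (∃ j ≥ i, x j ≠ 0) →
        h i ≤ ∑ j ∈ Finset.Ici i, h j * (U *ᵥ fun j ↦ (x j : ℝ)) j ^ 2 := by
  induction n generalizing d with
  | zero =>
    refine ⟨LinearEquiv.refl _ _, 0, 0, fun i ↦ i.elim0, fun i ↦ i.elim0, fun i ↦ i.elim0,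
      fun x ↦ ?_, fun i ↦ i.elim0⟩
    rw [Subsingleton.elim (LinearEquiv.refl ℤ _ x) 0, map_zero]
    simp
  | succ n ih =>
    have hdR : (0 : ℝ) < d := by exact_mod_cast hd
    have hz (c : ℤ) (a : ℝ) : c • a = c * a := zsmul_eq_mul a c
    obtain ⟨v, hv, hmin⟩ := exists_minimal_vector B hpos hd hB
    obtain ⟨e₀, k, hk⟩ := exists_linearEquiv_smul_single hv
    set w := e₀ (Pi.single 0 1) with hw
    have hw0 : w ≠ 0 := by
      rintro h
      exact hv (by rw [hk, h, smul_zero])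
    have hk0 : k ≠ 0 := by
      rintro rfl
      exact hv (by rw [hk, zero_smul])
    have hwmin : ∀ x ≠ 0, B w w ≤ B x x := fun x hx ↦ by
      refine le_trans ?_ (hmin x hx)
      rw [hk, map_smul, map_smul, LinearMap.smul_apply, smul_smul, zsmul_eq_mul]
      have h1 : (1 : ℝ) ≤ ((k * k : ℤ) : ℝ) := by
        exact_mod_cast Int.add_one_le_of_lt (mul_self_pos.2 hk0)
      exact le_mul_of_one_le_left (hpos w hw0).le h1
    set h₀ := B w w with hh₀
    have hh₀pos : 0 < h₀ := hpos w hw0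
    let ι : (Fin n → ℤ) →ₗ[ℤ] (Fin (n + 1) → ℤ) :=
      e₀.toLinearMap ∘ₗ (Fin.consLinearEquiv ℤ fun _ ↦ ℤ).toLinearMap ∘ₗ LinearMap.inr ℤ ℤ _
    have hι (x) : ι x = e₀ (Fin.cons 0 x) := rfl
    have hcons (a : ℤ) (x : Fin n → ℤ) : e₀ (Fin.cons a x) = a • w + ι x := by
      rw [hι, hw, ← map_smul, ← map_add]
      congr 1
      ext i
      refine Fin.cases ?_ (fun i ↦ ?_) i <;> simp
    let B' : (Fin n → ℤ) →ₗ[ℤ] (Fin n → ℤ) →ₗ[ℤ] ℝ :=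
      LinearMap.mk₂ ℤ (fun x y ↦ B (ι x) (ι y) - B w (ι x) * B w (ι y) / h₀)
        (fun x y z ↦ by simp only [map_add, LinearMap.add_apply]; ring)
        (fun c x y ↦ by simp only [map_smul, LinearMap.smul_apply, hz]; ring)
        (fun x y z ↦ by simp only [map_add]; ring)
        (fun c x y ↦ by simp only [map_smul, hz]; ring)
    have hB' (x y) : B' x y = B (ι x) (ι y) - B w (ι x) * B w (ι y) / h₀ := rfl
    obtain ⟨k₀, hk₀⟩ := hB w w
    rw [← hh₀] at hk₀
    have hk₀pos : 0 < k₀ := by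
      have := mul_pos hdR hh₀pos
      rw [hk₀] at this
      exact_mod_cast this
    have hpos' : ∀ x ≠ 0, 0 < B' x x := fun x hx ↦ by
      obtain ⟨k₁, hk₁⟩ := hB w (ι x)
      have h1 : e₀ (Fin.cons (-k₁) (k₀ • x)) ≠ 0 := by
        rw [Ne, LinearEquiv.map_eq_zero_iff]
        intro h
        obtain ⟨i, hi⟩ := Function.ne_iff.1 hx
        have := congrFun h i.succ
        simp [hk₀pos.ne'] at this
        exact hi this
      have h2 := hpos _ h1
      have h3 : B (e₀ (Fin.cons (-k₁) (k₀ • x))) (e₀ (Fin.cons (-k₁) (k₀ • x)))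
          = d ^ 2 * h₀ ^ 2 * B' x x := by
        rw [hcons, hB']
        simp only [map_add, map_smul, LinearMap.add_apply, LinearMap.smul_apply, hz,
          hsymm (ι x) w, ← hh₀]
        push_cast
        rw [← hk₀, ← hk₁]
        field_simp
        ring
      rw [h3] at h2
      exact pos_of_mul_pos_right h2 (by positivity)
    obtain ⟨e', U', h', hU1, hU0, hh', hrep, hmin'⟩ := ih B'
      (fun x y ↦ by rw [hB', hB', hsymm, mul_comm (B w (ι x))]) hpos'
      (d := d * k₀.toNat) (Nat.mul_pos hd (by omega)) fun x y ↦ by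
        obtain ⟨k₁, hk₁⟩ := hB (ι x) (ι y)
        obtain ⟨k₂, hk₂⟩ := hB w (ι x)
        obtain ⟨k₃, hk₃⟩ := hB w (ι y)
        refine ⟨k₀ * k₁ - k₂ * k₃, ?_⟩
        have : ((k₀.toNat : ℕ) : ℝ) = k₀ := by exact_mod_cast Int.toNat_of_nonneg hk₀pos.le
        push_cast
        rw [this, hB', ← hk₀, ← hk₁, ← hk₂, ← hk₃]
        field_simp
    let φ : (Fin n → ℤ) →ₗ[ℤ] ℝ := (B w) ∘ₗ ι ∘ₗ e'.toLinearMap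
    let u : Fin n → ℝ := fun j ↦ φ (Pi.single j 1) / h₀
    have hu (x : Fin n → ℤ) : φ x = h₀ * ∑ j, u j * x j := by
      have h1 (i : Fin n) : (fun j ↦ if i = j then (1 : ℤ) else 0) = Pi.single i 1 := by
        ext j
        simp [Pi.single_apply, eq_comm]
      rw [LinearMap.pi_apply_eq_sum_univ φ x, Finset.mul_sum]
      refine Finset.sum_congr rfl fun i _ ↦ ?_
      rw [h1, hz]
      simp only [u]
      field_simp
    let e := ((Fin.consLinearEquiv ℤ fun _ ↦ ℤ).symm.trans
      (LinearEquiv.prodCongr (LinearEquiv.refl ℤ ℤ) e')).trans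
      ((Fin.consLinearEquiv ℤ fun _ ↦ ℤ).trans e₀)
    have he (x) : e x = x 0 • w + ι (e' (Fin.tail x)) := hcons _ _
    let U : Matrix (Fin (n + 1)) (Fin (n + 1)) ℝ :=
      Fin.cons (Fin.cons 1 u) fun i ↦ Fin.cons 0 (U' i)
    have hUzero (x : Fin (n + 1) → ℤ) : (U *ᵥ fun j ↦ (x j : ℝ)) 0
        = x 0 + ∑ j, u j * (Fin.tail x j : ℤ) := by
      rw [Matrix.mulVec, dotProduct, Fin.sum_univ_succ]
      simp [U, Fin.tail]
    have hUsucc (x : Fin (n + 1) → ℤ) (i : Fin n) : (U *ᵥ fun j ↦ (x j : ℝ)) i.succ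
        = (U' *ᵥ fun j ↦ ((Fin.tail x j : ℤ) : ℝ)) i := by
      rw [Matrix.mulVec, dotProduct, Fin.sum_univ_succ]
      simp [U, Fin.tail, Matrix.mulVec, dotProduct]
    have hrep' (x) : B (e x) (e x)
        = ∑ j, (Fin.cons h₀ h' : Fin (n + 1) → ℝ) j * (U *ᵥ fun j ↦ (x j : ℝ)) j ^ 2 := by
      rw [Fin.sum_univ_succ]
      simp only [Fin.cons_zero, Fin.cons_succ, hUzero, hUsucc]
      rw [← hrep, hB', he]
      have h1 : B w (ι (e' (Fin.tail x))) = h₀ * ∑ j, u j * (Fin.tail x j : ℤ) := hu _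
      simp only [map_add, map_smul, LinearMap.add_apply, LinearMap.smul_apply, hz,
          hsymm (ι _) w, ← hh₀, h1]
      field_simp
      ring
    refine ⟨e, U, Fin.cons h₀ h', ?_, ?_, ?_, hrep', ?_⟩
    · intro i
      refine Fin.cases ?_ (fun i ↦ ?_) i <;> simp [U, hU1]
    · intro i j
      refine Fin.cases ?_ (fun i ↦ ?_) i
      · intro h
        exact absurd h (Fin.not_lt_zero _)
      · refine Fin.cases ?_ (fun j ↦ ?_) j
        · simp [U]
        · intro h
          simpa [U] using hU0 i j (Fin.succ_lt_succ_iff.1 h)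
    · intro i
      refine Fin.cases ?_ (fun i ↦ ?_) i <;> simp [hh₀pos, hh']
    · intro i
      refine Fin.cases ?_ (fun i ↦ ?_) i
      · rintro x ⟨j, -, hj⟩
        have h1 : e x ≠ 0 := by
          rw [Ne, LinearEquiv.map_eq_zero_iff]
          rintro rfl
          exact hj rfl
        have h2 := hwmin _ h1
        rw [hrep'] at h2
        have h3 : Finset.Ici (0 : Fin (n + 1)) = Finset.univ := by ext; simp
        rw [h3]
        exact h2
      · rintro x ⟨j, hij, hj⟩
        rw [← Fin.map_succEmb_Ici, Finset.sum_map]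
        simp only [Fin.coe_succEmb, Fin.cons_succ, hUsucc]
        refine hmin' i (Fin.tail x) ?_
        obtain ⟨j, rfl⟩ :=
          Fin.exists_succ_eq.2 (Fin.pos_iff_ne_zero.1 ((Fin.succ_pos i).trans_le hij))
        exact ⟨j, Fin.succ_le_succ_iff.1 hij, hj⟩

theorem abs_mul_apply_le {l m n : Type*} [Fintype m] {A : Matrix l m ℝ} {B : Matrix m n ℝ}
    {a b : ℝ} (ha : 0 ≤ a) (hA : ∀ i j, |A i j| ≤ a) (hB : ∀ i j, |B i j| ≤ b) (i : l) (j : n) :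
    |(A * B) i j| ≤ Fintype.card m * (a * b) := by
  rw [Matrix.mul_apply]
  refine (Finset.abs_sum_le_sum_abs _ _).trans ((Finset.sum_le_card_nsmul _ _ (a * b)
    fun k _ ↦ ?_).trans_eq (by simp))
  rw [abs_mul]
  exact mul_le_mul (hA i k) (hB k j) (abs_nonneg _) ha

/-- Seysen's reduction: a unitriangular matrix has an integral multiple which has, together with
its inverse, only small entries. -/
theorem exists_seysen {N : ℕ} (hN : 1 ≤ N) (k : ℕ) {n : ℕ} (hnk : n ≤ 2 ^ k) (hnN : n ≤ N)
    (U : Matrix (Fin n) (Fin n) ℝ) (hU1 : ∀ i, U i i = 1) (hU0 : ∀ i j, j < i → U i j = 0) :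
    ∃ (Z Z' : Matrix (Fin n) (Fin n) ℤ) (V : Matrix (Fin n) (Fin n) ℝ),
      Z * Z' = 1 ∧ (∀ i j, j < i → Z i j = 0) ∧ U * Z.map (fun z ↦ (z : ℝ)) * V = 1 ∧
      (∀ i j, |(U * Z.map (fun z ↦ (z : ℝ))) i j| ≤ N ^ k) ∧ ∀ i j, |V i j| ≤ N ^ k := by
  induction k generalizing n with
  | zero =>
    have : Subsingleton (Fin n) := Fin.subsingleton_iff_le_one.2 (by simpa using hnk)
    have hU : U = 1 := by
      ext i j
      rw [Subsingleton.elim j i, hU1, Matrix.one_apply_eq]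
    have h1 (i j) : |(1 : Matrix (Fin n) (Fin n) ℝ) i j| ≤ (N : ℝ) ^ 0 := by
      rw [Subsingleton.elim j i, Matrix.one_apply_eq]
      simp
    have h2 : (1 : Matrix (Fin n) (Fin n) ℤ).map (fun z ↦ (z : ℝ)) = 1 :=
      Matrix.map_one _ (by simp) (by simp)
    refine ⟨1, 1, 1, one_mul 1, fun i j h ↦ absurd h (Subsingleton.elim i j).not_gt, ?_, ?_, h1⟩
    · rw [hU, h2, one_mul, one_mul]
    · rw [hU, h2, one_mul]
      exact h1
  | succ k ih =>
    obtain ⟨a, b, rfl, ha, hb⟩ : ∃ a b, n = a + b ∧ a ≤ 2 ^ k ∧ b ≤ 2 ^ k :=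
      ⟨n / 2, n - n / 2, by omega, by rw [pow_succ] at hnk; omega, by rw [pow_succ] at hnk; omega⟩
    let e : Fin a ⊕ Fin b ≃ Fin (a + b) := finSumFinEquiv
    let X : Matrix (Fin a) (Fin b) ℝ := fun i j ↦ U (e (.inl i)) (e (.inr j))
    let U₁ : Matrix (Fin a) (Fin a) ℝ := fun i j ↦ U (e (.inl i)) (e (.inl j))
    let U₂ : Matrix (Fin b) (Fin b) ℝ := fun i j ↦ U (e (.inr i)) (e (.inr j))
    have hU : U = (Matrix.fromBlocks U₁ X 0 U₂).submatrix e.symm e.symm := by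
      ext i j
      obtain ⟨i, rfl⟩ := e.surjective i
      obtain ⟨j, rfl⟩ := e.surjective j
      rcases i with i | i <;> rcases j with j | j <;>
        rw [Matrix.submatrix_apply, Equiv.symm_apply_apply, Equiv.symm_apply_apply] <;> try rfl
      refine hU0 _ _ ?_
      simp only [e, finSumFinEquiv_apply_left, finSumFinEquiv_apply_right, Fin.lt_def,
        Fin.val_castAdd, Fin.val_natAdd]
      omega
    obtain ⟨Z₁, Z₁', V₁, hZ₁, hZ₁u, hV₁, hW₁b, hV₁b⟩ := ih ha (by omega) U₁ (fun i ↦ hU1 _)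
      fun i j h ↦ hU0 _ _ (Fin.lt_def.1 h)
    obtain ⟨Z₂, Z₂', V₂, hZ₂, hZ₂u, hV₂, hW₂b, hV₂b⟩ := ih hb (by omega) U₂ (fun i ↦ hU1 _)
      fun i j h ↦ hU0 _ _ (by simpa [e] using h)
    set W₁ := U₁ * Z₁.map (fun z ↦ (z : ℝ)) with hW₁
    set W₂ := U₂ * Z₂.map (fun z ↦ (z : ℝ)) with hW₂
    let Y₀ : Matrix (Fin a) (Fin b) ℝ := V₁ * X * Z₂.map (fun z ↦ (z : ℝ))
    let R : Matrix (Fin a) (Fin b) ℤ := fun i j ↦ -round (Y₀ i j)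
    let Y : Matrix (Fin a) (Fin b) ℝ := Y₀ + R.map (fun z ↦ (z : ℝ))
    have hY (i j) : |Y i j| ≤ 1 := by
      have := abs_sub_round (Y₀ i j)
      have h1 : Y i j = Y₀ i j - round (Y₀ i j) := by
        change Y₀ i j + ((-round (Y₀ i j) : ℤ) : ℝ) = _
        rw [Int.cast_neg, sub_eq_add_neg]
      rw [h1]
      linarith
    have hNk : (1 : ℝ) ≤ (N : ℝ) ^ k := one_le_pow₀ (by exact_mod_cast hN)
    have hNR : (1 : ℝ) ≤ N := by exact_mod_cast hN
    have hmono {x : ℝ} (hx : x ≤ (N : ℝ) ^ k) : x ≤ (N : ℝ) ^ (k + 1) :=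
      hx.trans (pow_le_pow_right₀ hNR k.le_succ)
    have hW : U * ((Matrix.fromBlocks Z₁ (Z₁ * R) 0 Z₂).submatrix e.symm e.symm).map
        (fun z ↦ (z : ℝ)) = (Matrix.fromBlocks W₁ (W₁ * Y) 0 W₂).submatrix e.symm e.symm := by
      have h1 : (Z₁ * R).map (fun z ↦ (z : ℝ)) =
          Z₁.map (fun z ↦ (z : ℝ)) * R.map (fun z ↦ (z : ℝ)) :=
        Matrix.map_mul (f := Int.castRingHom ℝ)
      have h2 : W₁ * Y = X * Z₂.map (fun z ↦ (z : ℝ)) + W₁ * R.map (fun z ↦ (z : ℝ)) := by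
        simp only [Y, Y₀, Matrix.mul_add, ← Matrix.mul_assoc, hV₁, Matrix.one_mul]
      rw [hU, ← Matrix.submatrix_map, Matrix.submatrix_mul_equiv, Matrix.fromBlocks_map,
        Matrix.fromBlocks_multiply, h1, h2, ← Matrix.mul_assoc, ← hW₁, ← hW₂]
      congr 2 <;> simp [add_comm, Matrix.map_zero]
    refine ⟨(Matrix.fromBlocks Z₁ (Z₁ * R) 0 Z₂).submatrix e.symm e.symm,
      (Matrix.fromBlocks Z₁' (-(R * Z₂')) 0 Z₂').submatrix e.symm e.symm,
      (Matrix.fromBlocks V₁ (-(Y * V₂)) 0 V₂).submatrix e.symm e.symm, ?_, ?_, ?_, ?_, ?_⟩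
    · rw [Matrix.submatrix_mul_equiv, Matrix.fromBlocks_multiply]
      simp [hZ₁, hZ₂, Matrix.mul_assoc]
    · intro i j
      obtain ⟨i, rfl⟩ := e.surjective i
      obtain ⟨j, rfl⟩ := e.surjective j
      rcases i with i | i <;> rcases j with j | j <;> intro h
      · simpa using hZ₁u i j (Fin.lt_def.1 h)
      · simp only [e, finSumFinEquiv_apply_left, finSumFinEquiv_apply_right, Fin.lt_def,
          Fin.val_castAdd, Fin.val_natAdd] at h
        omega
      · simp
      · simpa using hZ₂u i j (by simpa [e] using h)
    · rw [hW, Matrix.submatrix_mul_equiv, Matrix.fromBlocks_multiply]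
      simp [hV₁, hV₂, Matrix.mul_assoc]
    · rw [hW]
      intro i j
      obtain ⟨i, rfl⟩ := e.surjective i
      obtain ⟨j, rfl⟩ := e.surjective j
      rcases i with i | i <;> rcases j with j | j <;>
        simp only [Matrix.submatrix_apply, Equiv.symm_apply_apply, Matrix.fromBlocks_apply₁₁,
          Matrix.fromBlocks_apply₁₂, Matrix.fromBlocks_apply₂₁, Matrix.fromBlocks_apply₂₂]
      · exact hmono (hW₁b i j)
      · refine (abs_mul_apply_le (by positivity) hW₁b hY i j).trans ?_
        rw [mul_one, pow_succ', Fintype.card_fin]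
        gcongr
        omega
      · rw [Matrix.zero_apply, abs_zero]
        positivity
      · exact hmono (hW₂b i j)
    · intro i j
      obtain ⟨i, rfl⟩ := e.surjective i
      obtain ⟨j, rfl⟩ := e.surjective j
      rcases i with i | i <;> rcases j with j | j <;>
        simp only [Matrix.submatrix_apply, Equiv.symm_apply_apply, Matrix.fromBlocks_apply₁₁,
          Matrix.fromBlocks_apply₁₂, Matrix.fromBlocks_apply₂₁, Matrix.fromBlocks_apply₂₂]
      · exact hmono (hV₁b i j)
      · rw [Matrix.neg_apply, abs_neg]
        refine (abs_mul_apply_le zero_le_one hY hV₂b i j).trans ?_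
        rw [one_mul, pow_succ', Fintype.card_fin]
        gcongr
        omega
      · rw [Matrix.zero_apply, abs_zero]
        positivity
      · exact hmono (hV₂b i j)

theorem eq_zero_of_mul_eq_one_of_lt {n : ℕ} {W V : Matrix (Fin n) (Fin n) ℝ} (hWV : W * V = 1)
    (hW : ∀ i j, j < i → W i j = 0) (i j : Fin n) (hij : j < i) : V i j = 0 := by
  have := Matrix.invertibleOfIsUnitDet W (Matrix.isUnit_det_of_right_inverse hWV)
  rw [← Matrix.inv_eq_right_inv hWV]
  exact Matrix.blockTriangular_inv_of_blockTriangular (b := id) (fun i j h ↦ hW i j h) hij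

/-- A sum of squares of integral linear forms with large minimum is a sum of few such squares. -/
theorem repBySquares_of_large {n r k N : ℕ} {q : ℝ} (hN : 1 ≤ N) (hnk : n ≤ 2 ^ k) (hnN : n ≤ N)
    (hq : q = Real.exp (Real.log (4 * N) * (2 + Real.log N))) (A : Matrix (Fin r) (Fin n) ℤ)
    (hA : ∀ x ≠ 0, 16 * (N : ℝ) ^ 10 * ((N : ℝ) ^ k) ^ 6 * q ^ 4 ≤ (A *ᵥ x ⬝ᵥ A *ᵥ x : ℤ)) :
    RepBySquares n (5 * n ^ 2) (Aᵀ * A) := by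
  have hNR : (1 : ℝ) ≤ N := by exact_mod_cast hN
  have hq1 : 1 ≤ q := by
    rw [hq]
    refine Real.one_le_exp (mul_nonneg (Real.log_nonneg (by linarith)) ?_)
    linarith [Real.log_nonneg hNR]
  set T := 16 * (N : ℝ) ^ 10 * ((N : ℝ) ^ k) ^ 6 * q ^ 4 with hT
  have hTpos : 0 < T := by positivity
  have hz (c : ℤ) (a : ℝ) : c • a = c * a := zsmul_eq_mul a c
  let B : (Fin n → ℤ) →ₗ[ℤ] (Fin n → ℤ) →ₗ[ℤ] ℝ :=
    LinearMap.mk₂ ℤ (fun x y ↦ ((A *ᵥ x ⬝ᵥ A *ᵥ y : ℤ) : ℝ))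
      (fun x y z ↦ by rw [Matrix.mulVec_add, add_dotProduct, Int.cast_add])
      (fun c x y ↦ by rw [Matrix.mulVec_smul, smul_dotProduct, smul_eq_mul, Int.cast_mul, hz])
      (fun x y z ↦ by rw [Matrix.mulVec_add, dotProduct_add, Int.cast_add])
      (fun c x y ↦ by rw [Matrix.mulVec_smul, dotProduct_smul, smul_eq_mul, Int.cast_mul, hz])
  have hB (x y) : B x y = ((A *ᵥ x ⬝ᵥ A *ᵥ y : ℤ) : ℝ) := rfl
  have hBsymm (x y) : B x y = B y x := by rw [hB, hB, dotProduct_comm]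
  obtain ⟨e, U, h, hU1, hU0, hpos, hrep, hmin⟩ := exists_isReduced B hBsymm
    (fun x hx ↦ hTpos.trans_le (hA x hx)) one_pos
    (fun x y ↦ ⟨A *ᵥ x ⬝ᵥ A *ᵥ y, by rw [Nat.cast_one, one_mul, hB]⟩)
  obtain ⟨Z, Z', V, hZ, hZ0, hWV, hW, hV⟩ := exists_seysen hN k hnk hnN U hU1 hU0
  set P := LinearMap.toMatrix' (e : (Fin n → ℤ) →ₗ[ℤ] (Fin n → ℤ)) with hP
  set Pinv := LinearMap.toMatrix' (e.symm : (Fin n → ℤ) →ₗ[ℤ] (Fin n → ℤ)) with hPinv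
  have hPP' : P * Pinv = 1 := by
    rw [hP, hPinv, ← LinearMap.toMatrix'_comp, LinearEquiv.comp_coe, LinearEquiv.symm_trans_self]
    exact LinearMap.toMatrix'_id
  have hsingle (i j : Fin n) :
      (U *ᵥ fun l ↦ (((Pi.single i 1 : Fin n → ℤ) l : ℤ) : ℝ)) j = U j i := by
    simp [Matrix.mulVec, dotProduct, Pi.single_apply]
  have hgram : ((A * P)ᵀ * (A * P)).map (fun x ↦ (x : ℝ)) = Uᵀ * Matrix.diagonal h * U := by
    ext i j
    have h1 : ((A * P)ᵀ * (A * P)) i j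
        = A *ᵥ e (Pi.single i 1) ⬝ᵥ A *ᵥ e (Pi.single j 1) := by
      have h2 (x) : e x = P *ᵥ x := (LinearMap.toMatrix'_mulVec _ x).symm
      rw [h2, h2, Matrix.mulVec_mulVec, Matrix.mulVec_mulVec, Matrix.mulVec_single_one,
        Matrix.mulVec_single_one]
      rfl
    have h3 := hrep (Pi.single i 1 + Pi.single j 1)
    have h4 (l) : (U *ᵥ fun m ↦ (((Pi.single i 1 + Pi.single j 1 : Fin n → ℤ) m : ℤ) : ℝ)) l
        = U l i + U l j := by
      rw [← hsingle i l, ← hsingle j l]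
      simp only [Matrix.mulVec, dotProduct, Pi.add_apply, Int.cast_add, mul_add,
        Finset.sum_add_distrib]
    have h5 := hrep (Pi.single i 1)
    have h6 := hrep (Pi.single j 1)
    simp only [h4, hsingle, map_add, LinearMap.add_apply, hBsymm (e (Pi.single j 1))
      (e (Pi.single i 1))] at h3 h5 h6
    rw [Matrix.map_apply, h1, ← hB, transpose_mul_diagonal_mul_apply]
    have h7 : ∑ l, h l * (U l i + U l j) ^ 2
        = ∑ l, h l * U l i ^ 2 + ∑ l, h l * U l j ^ 2 + 2 * ∑ l, h l * (U l i * U l j) := by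
      rw [Finset.mul_sum, ← Finset.sum_add_distrib, ← Finset.sum_add_distrib]
      exact Finset.sum_congr rfl fun l _ ↦ by ring
    linarith
  set W := U * Z.map (fun z ↦ (z : ℝ)) with hWdef
  have hgram' : ((A * P * Z)ᵀ * (A * P * Z)).map (fun x ↦ (x : ℝ))
      = Wᵀ * Matrix.diagonal h * W := by
    have h1 : (A * P * Z)ᵀ * (A * P * Z) = Zᵀ * ((A * P)ᵀ * (A * P)) * Z := by
      simp only [Matrix.transpose_mul, Matrix.mul_assoc]
    have h2 : (Zᵀ * ((A * P)ᵀ * (A * P)) * Z).map (fun x ↦ (x : ℝ))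
        = Zᵀ.map (fun x ↦ (x : ℝ)) * ((A * P)ᵀ * (A * P)).map (fun x ↦ (x : ℝ))
          * Z.map (fun x ↦ (x : ℝ)) := by
      have h3 {l m o : ℕ} (C : Matrix (Fin l) (Fin m) ℤ) (D : Matrix (Fin m) (Fin o) ℤ) :
          (C * D).map (fun x ↦ (x : ℝ)) = C.map (fun x ↦ (x : ℝ)) * D.map (fun x ↦ (x : ℝ)) :=
        Matrix.map_mul (f := Int.castRingHom ℝ)
      rw [h3, h3]
    rw [h1, h2, hgram, hWdef]
    simp only [Matrix.transpose_mul, Matrix.mul_assoc, Matrix.transpose_map]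
  have hWu (i j) (hij : j < i) : W i j = 0 := by
    refine Matrix.BlockTriangular.mul (b := id) (M := U) (N := Z.map fun z ↦ (z : ℝ))
      (fun i j h ↦ hU0 i j h) (fun i j h ↦ ?_) hij
    rw [Matrix.map_apply, hZ0 i j h, Int.cast_zero]
  have hqn (i j) (hij : i ≤ j) : h i ≤ q * h j := by
    refine (le_mul_of_isReduced hU1 hU0 hpos hmin hij).trans ?_
    have hn : (1 : ℝ) ≤ n := by exact_mod_cast i.pos
    have hnN' : (n : ℝ) ≤ N := by exact_mod_cast hnN
    have h1 := Real.log_nonneg hn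
    have h2 : 0 ≤ Real.log (4 * N) := Real.log_nonneg (by linarith)
    rw [hq]
    have := (hpos j).le
    gcongr
  have hlarge (i) : 16 * (n : ℝ) ^ 10 * ((N : ℝ) ^ k) ^ 6 * q ^ 3 ≤ h i := by
    let z : Fin n := ⟨0, i.pos⟩
    have h1 := hrep (Pi.single z 1)
    simp only [hsingle] at h1
    rw [Finset.sum_eq_single z (fun j _ hj ↦ by
      rw [hU0 j z (lt_of_le_of_ne (Nat.zero_le _) hj.symm)]; ring) (by simp), hU1] at h1
    have h2 : T ≤ h z := by
      have h3 : e (Pi.single z 1) ≠ 0 := by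
        rw [Ne, LinearEquiv.map_eq_zero_iff]
        simp
      have := hA _ h3
      rw [← hB, h1] at this
      simpa using this
    have h3 := h2.trans (hqn z i (Nat.zero_le _))
    have h4 : 16 * (N : ℝ) ^ 10 * ((N : ℝ) ^ k) ^ 6 * q ^ 3 ≤ h i := by
      refine le_of_mul_le_mul_left (le_trans (le_of_eq ?_) h3) (zero_lt_one.trans_le hq1)
      rw [hT]
      ring
    refine le_trans ?_ h4
    gcongr
  have key := repBySquares_of_reduced (one_le_pow₀ hNR) hq1 hgram' hWV hWu
    (eq_zero_of_mul_eq_one_of_lt hWV hWu) hW hV hqn hlarge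
  have hA' : A * P * Z * (Z' * Pinv) = A := by
    rw [Matrix.mul_assoc, ← Matrix.mul_assoc Z, hZ, Matrix.one_mul, Matrix.mul_assoc, hPP',
      Matrix.mul_one]
  have hgramA : (Z' * Pinv)ᵀ * ((A * P * Z)ᵀ * (A * P * Z)) * (Z' * Pinv) = Aᵀ * A := by
    conv_rhs => rw [← hA']
    simp only [Matrix.transpose_mul, Matrix.mul_assoc]
  rw [← hgramA]
  exact key.conj _

/-- A vector of small norm allows to split off few squares and to drop one variable. -/
theorem exists_gram_eq_add {n r : ℕ} (A : Matrix (Fin r) (Fin (n + 1)) ℤ) {x : Fin (n + 1) → ℤ}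
    (hx : x ≠ 0) : ∃ (s : ℕ) (A' : Matrix (Fin r) (Fin n) ℤ),
      (s : ℤ) ≤ A *ᵥ x ⬝ᵥ A *ᵥ x ∧
        ∀ g, RepBySquares n g (A'ᵀ * A') → RepBySquares (n + 1) (s + g) (Aᵀ * A) := by
  obtain ⟨e, k, hk⟩ := exists_linearEquiv_smul_single hx
  have hk0 : k ≠ 0 := by
    rintro rfl
    exact hx (by rw [hk, zero_smul])
  set P := LinearMap.toMatrix' (e : (Fin (n + 1) → ℤ) →ₗ[ℤ] (Fin (n + 1) → ℤ)) with hP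
  set Pinv := LinearMap.toMatrix' (e.symm : (Fin (n + 1) → ℤ) →ₗ[ℤ] (Fin (n + 1) → ℤ)) with hPinv
  have hPP' : P * Pinv = 1 := by
    rw [hP, hPinv, ← LinearMap.toMatrix'_comp, LinearEquiv.comp_coe, LinearEquiv.symm_trans_self]
    exact LinearMap.toMatrix'_id
  set c : Fin r → ℤ := fun i ↦ (A * P) i 0 with hc
  have hAx : A *ᵥ x = k • c := by
    have h1 : e (Pi.single 0 1) = P *ᵥ Pi.single 0 1 := (LinearMap.toMatrix'_mulVec _ _).symm
    rw [hk, Matrix.mulVec_smul, h1, Matrix.mulVec_mulVec, Matrix.mulVec_single_one]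
    rfl
  let A' : Matrix (Fin r) (Fin n) ℤ := fun i j ↦ if c i = 0 then (A * P) i j.succ else 0
  let J : Matrix (Fin n) (Fin (n + 1)) ℤ := (1 : Matrix _ _ ℤ).submatrix Fin.succ id
  let A₁ : Matrix {i // c i ≠ 0} (Fin (n + 1)) ℤ := (A * P).submatrix Subtype.val id
  refine ⟨Fintype.card {i // c i ≠ 0}, A', ?_, fun g hg ↦ ?_⟩
  · rw [hAx, Fintype.card_subtype, Finset.card_eq_sum_ones, Nat.cast_sum, Finset.sum_filter,
      dotProduct]
    refine Finset.sum_le_sum fun i _ ↦ ?_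
    split_ifs with hi
    · have := mul_self_pos.2 (mul_ne_zero hk0 hi)
      rw [Pi.smul_apply, smul_eq_mul]
      push_cast
      omega
    · exact mul_self_nonneg _
  · have hJ (i j) : (A' * J) i j = if c i = 0 then (A * P) i j else 0 := by
      rw [Matrix.mul_apply]
      refine Fin.cases ?_ (fun j ↦ ?_) j
      · rw [Finset.sum_eq_zero fun l _ ↦ ?_]
        · split_ifs with hi
          · exact hi.symm
          · rfl
        · simp [J]
      · simp [J, A', Matrix.one_apply]
    have hsum : (A * P)ᵀ * (A * P) = A₁ᵀ * A₁ + Jᵀ * (A'ᵀ * A') * J := by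
      have h1 : Jᵀ * (A'ᵀ * A') * J = (A' * J)ᵀ * (A' * J) := by
        simp only [Matrix.transpose_mul, Matrix.mul_assoc]
      rw [h1]
      ext a b
      simp only [Matrix.add_apply, Matrix.mul_apply (N := A * P), Matrix.mul_apply (N := A' * J),
        Matrix.mul_apply (N := A₁), Matrix.transpose_apply, hJ]
      have h2 (f : Fin r → ℤ) : ∑ i : {i // c i ≠ 0}, f i = ∑ i, if c i ≠ 0 then f i else 0 := by
        rw [← Finset.sum_filter]
        exact (Finset.sum_subtype _ (by simp) f).symm
      refine Eq.trans ?_ (congrArg (· + _) (h2 fun i ↦ (A * P) i a * (A * P) i b).symm)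
      rw [← Finset.sum_add_distrib]
      refine Finset.sum_congr rfl fun i _ ↦ ?_
      by_cases hi : c i = 0 <;> simp only [hi, ne_eq, not_true, not_false_iff, if_true, if_false,
        zero_add, mul_zero, add_zero]
    have hgramA : Pinvᵀ * ((A * P)ᵀ * (A * P)) * Pinv = Aᵀ * A := by
      have hA' : A * P * Pinv = A := by rw [Matrix.mul_assoc, hPP', Matrix.mul_one]
      conv_rhs => rw [← hA']
      simp only [Matrix.transpose_mul, Matrix.mul_assoc]
    rw [← hgramA, hsum]
    exact ((RepBySquares.of_fintype A₁).add (hg.conj J)).conj Pinv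

/-- A quasi-polynomial bound for the number of squares needed in at most `N` variables. -/
theorem exists_repBySquares_le {k N : ℕ} {T : ℝ} (hN : 1 ≤ N) (hNk : N ≤ 2 ^ k)
    (hT : T = 16 * (N : ℝ) ^ 10 * ((N : ℝ) ^ k) ^ 6
      * Real.exp (Real.log (4 * N) * (2 + Real.log N)) ^ 4)
    {n r : ℕ} (hn : n ≤ N) (A : Matrix (Fin r) (Fin n) ℤ) :
    ∃ g : ℕ, (g : ℝ) ≤ n * T + 5 * N ^ 2 ∧ RepBySquares n g (Aᵀ * A) := by
  have hT0 : 0 ≤ T := by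
    rw [hT]
    positivity
  induction n generalizing r with
  | zero => exact ⟨0, by simp, Subsingleton.elim 0 (Aᵀ * A) ▸ RepBySquares.zero 0 0⟩
  | succ n ih =>
    by_cases hA : ∀ x ≠ 0, T ≤ (A *ᵥ x ⬝ᵥ A *ᵥ x : ℤ)
    · refine ⟨5 * (n + 1) ^ 2, ?_, repBySquares_of_large hN (hn.trans hNk) hn rfl A (hT ▸ hA)⟩
      have h1 : ((n + 1 : ℕ) : ℝ) ^ 2 ≤ (N : ℝ) ^ 2 := by gcongr
      push_cast at h1 ⊢
      have h2 : 0 ≤ ((n : ℝ) + 1) * T := by positivity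
      linarith
    · push Not at hA
      obtain ⟨x, hx, hxT⟩ := hA
      obtain ⟨s, A', hs, hA'⟩ := exists_gram_eq_add A hx
      obtain ⟨g, hg, hg'⟩ := ih (by omega) A'
      refine ⟨s + g, ?_, hA' g hg'⟩
      have hs' : (s : ℝ) ≤ (A *ᵥ x ⬝ᵥ A *ᵥ x : ℤ) := by exact_mod_cast hs
      push_cast at hs' ⊢
      linarith

theorem clog_le_two_mul_log_add_one (N : ℕ) :
    (Nat.clog 2 N : ℝ) ≤ 2 * Real.log N + 1 := by
  rcases Nat.eq_zero_or_pos (Nat.clog 2 N) with h | h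
  · rw [h, Nat.cast_zero]
    linarith [Real.log_natCast_nonneg N]
  · have h1 : 2 ^ (Nat.clog 2 N - 1) < N := (Nat.lt_clog_iff_pow_lt one_lt_two).1 (by omega)
    have h2 : ((2 : ℝ) ^ (Nat.clog 2 N - 1)) ≤ N := by exact_mod_cast h1.le
    have h3 := Real.log_le_log (by positivity) h2
    rw [Real.log_pow, Nat.cast_sub h, Nat.cast_one] at h3
    have h4 : (1 : ℝ) ≤ Nat.clog 2 N := by exact_mod_cast h
    nlinarith [Real.log_two_gt_d9]

/-- The quasi-polynomial bound is dominated by the exponential of the square root. -/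
theorem exists_mul_add_le_mul_exp_sqrt : ∃ C : ℝ, 0 < C ∧ ∀ N : ℕ, 1 ≤ N →
    N * (16 * (N : ℝ) ^ 10 * ((N : ℝ) ^ Nat.clog 2 N) ^ 6
      * Real.exp (Real.log (4 * N) * (2 + Real.log N)) ^ 4) + 5 * N ^ 2 + 1
      ≤ C * Real.exp (Real.sqrt N) := by
  refine ⟨2 * Real.exp (20 + 132 + 578 ^ 2), by positivity, fun N hN ↦ ?_⟩
  have hNR : (1 : ℝ) ≤ N := by exact_mod_cast hN
  set L := Real.log N with hL
  have hL0 : 0 ≤ L := Real.log_nonneg hNR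
  have hexp : (N : ℝ) = Real.exp L := (Real.exp_log (by linarith)).symm
  have hk := clog_le_two_mul_log_add_one N
  rw [← hL] at hk
  set k := Nat.clog 2 N
  have h4 : Real.log (4 * N) ≤ 2 + L := by
    rw [Real.log_mul (by norm_num) (by linarith), ← hL, show (4 : ℝ) = 2 ^ 2 by norm_num,
      Real.log_pow]
    push_cast
    linarith [Real.log_two_lt_d9]
  have h2exp : (2 : ℝ) ≤ Real.exp 1 := by linarith [Real.exp_one_gt_d9]
  have h16 : (16 : ℝ) ≤ Real.exp 4 := by
    calc (16 : ℝ) = 2 ^ 4 := by norm_num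
      _ ≤ Real.exp 1 ^ 4 := by gcongr
      _ = Real.exp 4 := by rw [← Real.exp_nat_mul]; norm_num
  have hmain : N * (16 * (N : ℝ) ^ 10 * ((N : ℝ) ^ k) ^ 6
      * Real.exp (Real.log (4 * N) * (2 + L)) ^ 4) ≤ Real.exp (20 + 33 * L + 16 * L ^ 2) := by
    generalize Real.log (4 * N) = l at h4 ⊢
    rw [hexp]
    simp only [← Real.exp_nat_mul]
    calc Real.exp L * (16 * Real.exp ((10 : ℕ) * L) * Real.exp ((6 : ℕ) * (k * L))
          * Real.exp ((4 : ℕ) * (l * (2 + L))))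
        ≤ Real.exp L * (Real.exp 4 * Real.exp ((10 : ℕ) * L) * Real.exp ((6 : ℕ) * (k * L))
          * Real.exp ((4 : ℕ) * (l * (2 + L)))) := by gcongr
      _ = Real.exp (L + (4 + 10 * L + 6 * (k * L) + 4 * (l * (2 + L)))) := by
        simp only [← Real.exp_add]
        norm_num
      _ ≤ Real.exp (20 + 33 * L + 16 * L ^ 2) := by
        refine Real.exp_le_exp.2 ?_
        have h5 : k * L ≤ (2 * L + 1) * L := by gcongr
        have h6 : l * (2 + L) ≤ (2 + L) * (2 + L) := by gcongr
        nlinarith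
  have hrest : 5 * (N : ℝ) ^ 2 + 1 ≤ Real.exp (20 + 33 * L + 16 * L ^ 2) := by
    calc 5 * (N : ℝ) ^ 2 + 1 ≤ 16 * (N : ℝ) ^ 2 := by nlinarith
      _ ≤ Real.exp 4 * Real.exp ((2 : ℕ) * L) := by
        rw [Real.exp_nat_mul, ← hexp]
        gcongr
      _ ≤ Real.exp (20 + 33 * L + 16 * L ^ 2) := by
        rw [← Real.exp_add]
        refine Real.exp_le_exp.2 ?_
        push_cast
        nlinarith
  have hexponent : 20 + 33 * L + 16 * L ^ 2 ≤ 20 + 132 + 578 ^ 2 + Real.sqrt N := by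
    set y := Real.sqrt (Real.sqrt (Real.sqrt N)) with hy
    have hy0 : 0 ≤ y := Real.sqrt_nonneg _
    have hy4 : Real.sqrt N = y ^ 4 := by
      rw [show y ^ 4 = (y ^ 2) ^ 2 by ring, hy, Real.sq_sqrt (Real.sqrt_nonneg _),
        Real.sq_sqrt (Real.sqrt_nonneg _)]
    have hy8 : (N : ℝ) = y ^ 8 := by
      rw [show y ^ 8 = (y ^ 4) ^ 2 by ring, ← hy4, Real.sq_sqrt (by linarith)]
    have hLy : L ≤ 8 * y := by
      rw [hL, hy8, Real.log_pow]
      push_cast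
      linarith [Real.log_le_self hy0]
    rw [hy4]
    have hL2 : L ^ 2 ≤ (8 * y) ^ 2 := by gcongr
    nlinarith [sq_nonneg (y - 1), sq_nonneg (y ^ 2 - 578)]
  rw [add_assoc]
  calc _ ≤ 2 * Real.exp (20 + 33 * L + 16 * L ^ 2) := by linarith
    _ ≤ 2 * Real.exp (20 + 132 + 578 ^ 2 + Real.sqrt N) := by gcongr
    _ = _ := by rw [Real.exp_add, mul_assoc]

/-- For every `ε > 0` there is a constant `C > 0` such that for every `n ≥ 1`, every
`n`-variable positive definite integral quadratic form that is represented by some `I_r`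
(`r` a positive integer) is represented by `I_g` for some positive integer
`g ≤ C·e^{(4+2√2+ε)√n}`. -/
theorem gZ_growth_sqrt_n :
    ∀ ε : ℝ, 0 < ε → ∃ C : ℝ, 0 < C ∧ ∀ n : ℕ, 1 ≤ n →
      ∀ M : Matrix (Fin n) (Fin n) ℤ, M.IsSymm →
        (M.map (fun x => (x : ℝ))).PosDef →
        (∃ r : ℕ, 0 < r ∧ RepBySquares n r M) →
        ∃ g : ℕ, 0 < g ∧
          (g : ℝ) ≤ C * Real.exp ((4 + 2 * Real.sqrt 2 + ε) * Real.sqrt n) ∧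
          RepBySquares n g M := by
  intro ε hε
  obtain ⟨C, hC, hbound⟩ := exists_mul_add_le_mul_exp_sqrt
  refine ⟨C, hC, fun n hn M _ _ ⟨r, _, A, hA⟩ ↦ ?_⟩
  obtain ⟨g, hg, hrep⟩ := exists_repBySquares_le hn (Nat.le_pow_clog one_lt_two n) rfl le_rfl A
  refine ⟨g + 1, g.succ_pos, ?_, hA ▸ hrep.mono g.le_succ⟩
  have h1 : Real.sqrt n ≤ (4 + 2 * Real.sqrt 2 + ε) * Real.sqrt n :=
    le_mul_of_one_le_left (Real.sqrt_nonneg _) (by linarith [Real.sqrt_nonneg 2])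
  calc ((g + 1 : ℕ) : ℝ) ≤ C * Real.exp (Real.sqrt n) := by
        push_cast
        linarith [hbound n hn]
    _ ≤ _ := by gcongr
end

section
/- Suppose 𝓞 is a principal ideal domain (equivalently, E has class number 1). For every ε > 0 there exists a constant C > 0 such that for every integer n ≥ 1 the following holds: if M is an n-variable positive definite integral hermitian form over 𝓞 that is represented by I_r for some positive integer r, then M is represented by I_g for some positive integer g ≤ C·e^{(k_E+ε)√n}, where k_E = (4+4√2)√β_E. -/
open scoped Matrix ComplexOrder

/-- `ω = √−ℓ` if `ℓ ≡ 1, 2 (mod 4)` and `ω = (1+√−ℓ)/2` if `ℓ ≡ 3 (mod 4)`,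
realized inside `ℂ` (with `√−ℓ = √ℓ·i`). -/
noncomputable def omegaC (ℓ : ℕ) : ℂ :=
  if ℓ % 4 = 3 then (1 + Real.sqrt ℓ * Complex.I) / 2 else Real.sqrt ℓ * Complex.I

/-- The ring of integers `𝓞 = ℤ[ω] = ℤ + ℤω` of `ℚ(√−ℓ)`, as a subring of `ℂ`. -/
noncomputable def intO (ℓ : ℕ) : Subring ℂ := Subring.closure {omegaC ℓ}

/-- `β_E = √((ℓ+1)/4)` if `ℓ ≡ 1, 2 (mod 4)` and `β_E = (ℓ+1)/(4√ℓ)` if `ℓ ≡ 3 (mod 4)`. -/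
noncomputable def betaE (ℓ : ℕ) : ℝ :=
  if ℓ % 4 = 3 then ((ℓ : ℝ) + 1) / (4 * Real.sqrt ℓ) else Real.sqrt (((ℓ : ℝ) + 1) / 4)

/-- `M` (the Gram matrix of an `n`-variable hermitian form over `𝓞`) is represented by `I_r`,
i.e. the form is a sum of `r` norms of linear forms over `𝓞`. -/
def RepByNorms (ℓ n r : ℕ) (M : Matrix (Fin n) (Fin n) ℂ) : Prop :=
  ∃ B : Matrix (Fin r) (Fin n) ℂ, (∀ i j, B i j ∈ intO ℓ) ∧ M = Bᴴ * B

section QuadraticOrder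

lemma omegaC_im_pos {ℓ : ℕ} (hpos : 0 < ℓ) : 0 < (omegaC ℓ).im := by
  have : 0 < Real.sqrt ℓ := Real.sqrt_pos.2 (by exact_mod_cast hpos)
  unfold omegaC
  split_ifs <;> simp <;> positivity

lemma omegaC_quadratic (ℓ : ℕ) : ∃ t N : ℤ, omegaC ℓ ^ 2 = t * omegaC ℓ - N ∧
    star (omegaC ℓ) = t - omegaC ℓ := by
  have hs : ((Real.sqrt ℓ : ℝ) : ℂ) ^ 2 = ℓ := by
    rw [← Complex.ofReal_pow, Real.sq_sqrt (Nat.cast_nonneg ℓ)]; simp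
  unfold omegaC
  split_ifs with h
  · obtain ⟨k, hk⟩ : ∃ k, ℓ = 4 * k + 3 := ⟨ℓ / 4, by omega⟩
    refine ⟨1, k + 1, ?_, ?_⟩
    · have h4 : (ℓ : ℂ) = 4 * k + 3 := by exact_mod_cast hk
      push_cast
      linear_combination (Complex.I ^ 2 / 4) * hs + ((ℓ : ℂ) / 4) * Complex.I_sq - (1 / 4 : ℂ) * h4
    · apply Complex.ext <;> simp <;> ring
  · refine ⟨0, ℓ, ?_, ?_⟩
    · push_cast
      linear_combination (Complex.I ^ 2) * hs + (ℓ : ℂ) * Complex.I_sq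
    · apply Complex.ext <;> simp

lemma omegaC_mem_intO (ℓ : ℕ) : omegaC ℓ ∈ intO ℓ := Subring.subset_closure rfl

lemma intCast_add_mul_omegaC_mem (ℓ : ℕ) (a b : ℤ) : (a + b * omegaC ℓ : ℂ) ∈ intO ℓ :=
  add_mem (intCast_mem _ a) (mul_mem (intCast_mem _ b) (omegaC_mem_intO ℓ))

lemma exists_coords_of_mem_intO {ℓ : ℕ} {z : ℂ} (hz : z ∈ intO ℓ) :
    ∃ a b : ℤ, z = a + b * omegaC ℓ := by
  obtain ⟨t, N, hq, -⟩ := omegaC_quadratic ℓ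
  induction hz using Subring.closure_induction with
  | mem x hx => exact ⟨0, 1, by simpa using hx⟩
  | zero => exact ⟨0, 0, by simp⟩
  | one => exact ⟨1, 0, by simp⟩
  | add x y _ _ hx hy =>
    obtain ⟨a, b, rfl⟩ := hx
    obtain ⟨c, d, rfl⟩ := hy
    exact ⟨a + c, b + d, by push_cast; ring⟩
  | neg x _ hx =>
    obtain ⟨a, b, rfl⟩ := hx
    exact ⟨-a, -b, by push_cast; ring⟩
  | mul x y _ _ hx hy =>
    obtain ⟨a, b, rfl⟩ := hx
    obtain ⟨c, d, rfl⟩ := hy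
    exact ⟨a * c - b * d * N, a * d + b * c + b * d * t, by
      push_cast; linear_combination (b * d : ℂ) * hq⟩

lemma star_mem_intO {ℓ : ℕ} {z : ℂ} (hz : z ∈ intO ℓ) : star z ∈ intO ℓ := by
  obtain ⟨a, b, rfl⟩ := exists_coords_of_mem_intO hz
  obtain ⟨t, -, -, hc⟩ := omegaC_quadratic ℓ
  have : star (a + b * omegaC ℓ : ℂ) = ((a + b * t : ℤ) : ℂ) + ((-b : ℤ) : ℂ) * omegaC ℓ := by
    rw [star_add, star_mul', hc]
    simp
    ring
  rw [this]
  exact intCast_add_mul_omegaC_mem ℓ _ _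

lemma exists_int_of_mem_intO_of_im_eq_zero {ℓ : ℕ} (hpos : 0 < ℓ) {z : ℂ} (hz : z ∈ intO ℓ)
    (him : z.im = 0) : ∃ k : ℤ, z = k := by
  obtain ⟨a, b, rfl⟩ := exists_coords_of_mem_intO hz
  have h0 : (b : ℝ) * (omegaC ℓ).im = 0 := by simpa using him
  have hb : b = 0 := by
    rcases mul_eq_zero.1 h0 with h | h
    · exact_mod_cast h
    · exact absurd h (omegaC_im_pos hpos).ne'
  exact ⟨a, by simp [hb]⟩

lemma one_le_norm_sq_of_mem_intO {ℓ : ℕ} (hpos : 0 < ℓ) {z : ℂ} (hz : z ∈ intO ℓ) (h0 : z ≠ 0) :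
    1 ≤ ‖z‖ ^ 2 := by
  have hm : ((‖z‖ ^ 2 : ℝ) : ℂ) ∈ intO ℓ := by
    have := mul_mem (star_mem_intO hz) hz
    rwa [Complex.star_def, mul_comm, Complex.mul_conj, Complex.normSq_eq_norm_sq] at this
  obtain ⟨k, hk⟩ := exists_int_of_mem_intO_of_im_eq_zero hpos hm (Complex.ofReal_im _)
  have hk' : ‖z‖ ^ 2 = (k : ℝ) := by exact_mod_cast hk
  have : 0 < ‖z‖ ^ 2 := by positivity
  rw [hk'] at this ⊢
  exact_mod_cast this

/-- A bound for the covering radius of `intO ℓ` in `ℂ`. -/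
noncomputable def coverO (ℓ : ℕ) : ℝ := 1 + ‖omegaC ℓ‖

lemma one_le_coverO (ℓ : ℕ) : 1 ≤ coverO ℓ := by
  unfold coverO; linarith [norm_nonneg (omegaC ℓ)]

lemma exists_mem_intO_norm_add_le {ℓ : ℕ} (hpos : 0 < ℓ) (z : ℂ) :
    ∃ w ∈ intO ℓ, ‖z + w‖ ≤ coverO ℓ := by
  have hω := omegaC_im_pos hpos
  set b := round (z.im / (omegaC ℓ).im)
  set a := round ((z - b * omegaC ℓ).re)
  refine ⟨-(a + b * omegaC ℓ), neg_mem (intCast_add_mul_omegaC_mem ℓ a b), ?_⟩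
  have h1 : |(z - b * omegaC ℓ).re - a| ≤ 1 / 2 := abs_sub_round _
  have h2 : |z.im / (omegaC ℓ).im - b| ≤ 1 / 2 := abs_sub_round _
  have h3 : |z.im - b * (omegaC ℓ).im| ≤ 1 / 2 * ‖omegaC ℓ‖ := by
    have : z.im - b * (omegaC ℓ).im = (z.im / (omegaC ℓ).im - b) * (omegaC ℓ).im := by
      field_simp
    rw [this, abs_mul]
    exact mul_le_mul h2 (Complex.abs_im_le_norm _) (abs_nonneg _) (by norm_num)
  refine (Complex.norm_le_abs_re_add_abs_im _).trans ?_
  have e1 : (z + -(a + b * omegaC ℓ)).re = (z - b * omegaC ℓ).re - a := by simp; ring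
  have e2 : (z + -(a + b * omegaC ℓ)).im = z.im - b * (omegaC ℓ).im := by simp; ring
  rw [e1, e2]
  unfold coverO
  linarith [norm_nonneg (omegaC ℓ)]

/-- The `ℝ`-basis `1, ω` of `ℂ`. -/
lemma exists_basis_one_omegaC {ℓ : ℕ} (hpos : 0 < ℓ) :
    ∃ b : Module.Basis (Fin 2) ℝ ℂ, b 0 = 1 ∧ b 1 = omegaC ℓ := by
  have hli : LinearIndependent ℝ ![(1 : ℂ), omegaC ℓ] := by
    rw [LinearIndependent.pair_iff]
    intro s t h
    have him := congrArg Complex.im h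
    have ht : t = 0 := by
      have : t = 0 ∨ (omegaC ℓ).im = 0 := by simpa using him
      exact this.resolve_right (omegaC_im_pos hpos).ne'
    subst ht
    have hre := congrArg Complex.re h
    exact ⟨by simpa using hre, rfl⟩
  refine ⟨basisOfLinearIndependentOfCardEqFinrank hli (by simp), ?_, ?_⟩ <;> simp

end QuadraticOrder

section GeometryOfNumbers

open MeasureTheory

lemma mem_intO_of_mem_span {ℓ : ℕ} {ι : Type} [Fintype ι] {b₀ : Module.Basis (Fin 2) ℝ ℂ}
    (hb0 : b₀ 0 = 1) (hb1 : b₀ 1 = omegaC ℓ) {y : ι → ℂ}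
    (hy : y ∈ Submodule.span ℤ (Set.range (Pi.basis fun _ : ι => b₀))) (i : ι) :
    y i ∈ intO ℓ := by
  classical
  induction hy using Submodule.span_induction with
  | mem y hy =>
    obtain ⟨⟨j, k⟩, rfl⟩ := hy
    rw [Pi.basis_apply]
    by_cases hij : i = j
    · subst hij
      rw [Pi.single_eq_same]
      fin_cases k
      · simp [hb0]
      · simpa [hb1] using omegaC_mem_intO ℓ
    · rw [Pi.single_eq_of_ne hij]
      exact (intO ℓ).zero_mem
  | zero => exact (intO ℓ).zero_mem
  | add y z _ _ hy hz => exact (intO ℓ).add_mem hy hz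
  | smul a y _ hy => exact (intO ℓ).zsmul_mem hy a

/-- Minkowski's convex body theorem for polydiscs and the lattice `𝓞^ι`. -/
lemma exists_intO_mulVec_norm_lt {ℓ : ℕ} (hpos : 0 < ℓ) {ι : Type} [Fintype ι] [DecidableEq ι]
    [Nonempty ι] (A : Matrix ι ι ℂ) (hA : A.det ≠ 0) (t : ℝ) (ht : 0 < t)
    (hdet : (2 * coverO ℓ) ^ (2 * Fintype.card ι) * ‖A.det‖ ^ 2 < t ^ (2 * Fintype.card ι)) :
    ∃ x : ι → ℂ, (∀ i, x i ∈ intO ℓ) ∧ x ≠ 0 ∧ ∀ i, ‖(A.mulVec x) i‖ < t := by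
  classical
  obtain ⟨b₀, hb0, hb1⟩ := exists_basis_one_omegaC hpos
  set b := Pi.basis (fun _ : ι => b₀) with hb
  have hρ : 0 < coverO ℓ := lt_of_lt_of_le one_pos (one_le_coverO ℓ)
  have hfr : Module.finrank ℝ (ι → ℂ) = 2 * Fintype.card ι := by
    rw [Module.finrank_pi_fintype]; simp [mul_comm]
  set f : (ι → ℂ) →ₗ[ℝ] (ι → ℂ) := (Matrix.toLin' A).restrictScalars ℝ with hf
  have hfdet : LinearMap.det f = ‖A.det‖ ^ 2 := by
    rw [hf, LinearMap.det_restrictScalars, LinearMap.det_toLin', Algebra.norm_complex_apply,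
      Complex.normSq_eq_norm_sq]
  have hnA : 0 < ‖A.det‖ ^ 2 := by positivity
  have hfund := ZSpan.isAddFundamentalDomain' b (volume : Measure (ι → ℂ))
  have hsub : ZSpan.fundamentalDomain b ⊆ Metric.ball (0 : ι → ℂ) (coverO ℓ) := by
    intro z hz
    rw [ZSpan.mem_fundamentalDomain] at hz
    rw [mem_ball_zero_iff, pi_norm_lt_iff hρ]
    intro i
    have h0 := hz ⟨i, 0⟩
    have h1 := hz ⟨i, 1⟩
    rw [hb, Pi.basis_repr, Set.mem_Ico] at h0 h1
    have hs := b₀.sum_repr (z i)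
    rw [Fin.sum_univ_two, hb0, hb1] at hs
    simp only at h0 h1
    rw [← hs]
    refine (norm_add_le _ _).trans_lt ?_
    rw [norm_smul, norm_smul, Real.norm_of_nonneg h0.1, Real.norm_of_nonneg h1.1, norm_one,
      mul_one]
    unfold coverO
    have := mul_le_mul_of_nonneg_right h1.2.le (norm_nonneg (omegaC ℓ))
    linarith [h0.2]
  have hlt : volume (ZSpan.fundamentalDomain b) * 2 ^ Module.finrank ℝ (ι → ℂ) <
      volume (f ⁻¹' Metric.ball (0 : ι → ℂ) t) := by
    have hu0 : volume (Metric.ball (0 : ι → ℂ) 1) ≠ 0 :=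
      (Metric.measure_ball_pos volume _ one_pos).ne'
    have hu1 : volume (Metric.ball (0 : ι → ℂ) 1) ≠ ⊤ := measure_ball_lt_top.ne
    rw [Measure.addHaar_preimage_linearMap _ (by rw [hfdet]; exact hnA.ne'),
      Measure.addHaar_ball _ _ ht.le, hfdet, ← mul_assoc]
    refine (mul_le_mul_left (measure_mono hsub) _).trans_lt ?_
    rw [Measure.addHaar_ball _ _ hρ.le, mul_right_comm]
    refine (ENNReal.mul_lt_mul_iff_left hu0 hu1).2 ?_
    have h2 : (2 : ENNReal) = ENNReal.ofReal 2 := by simp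
    rw [h2, ← ENNReal.ofReal_pow (by norm_num), ← ENNReal.ofReal_mul (by positivity),
      ← ENNReal.ofReal_mul (by positivity), ENNReal.ofReal_lt_ofReal_iff (by positivity),
      abs_of_pos (by positivity), hfr, ← mul_pow, mul_comm (coverO ℓ), inv_mul_eq_div,
      lt_div_iff₀ hnA]
    exact hdet
  have hcount : Countable (Submodule.span ℤ (Set.range b)).toAddSubgroup :=
    inferInstanceAs (Countable (Submodule.span ℤ (Set.range b)))
  obtain ⟨x, hx0, hx⟩ := exists_ne_zero_mem_lattice_of_measure_mul_two_pow_lt_measure hfund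
    (s := f ⁻¹' Metric.ball (0 : ι → ℂ) t) (by
      intro z hz
      simpa using hz)
    ((convex_ball (0 : ι → ℂ) t).linear_preimage f) hlt
  refine ⟨x, ?_, fun h => hx0 (Subtype.ext h), ?_⟩
  · exact mem_intO_of_mem_span hb0 hb1 x.2
  · intro i
    rw [Set.mem_preimage, mem_ball_zero_iff, pi_norm_lt_iff ht] at hx
    exact hx i

end GeometryOfNumbers

section UnimodularCompletion

/-- Over a principal ideal domain, every nonzero vector is a multiple of the first column of
some invertible matrix. -/
lemma exists_unimodular_col {R : Type*} [CommRing R] [IsDomain R] [IsPrincipalIdealRing R]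
    {n : ℕ} (x : Fin (n + 1) → R) (hx : x ≠ 0) :
    ∃ U V : Matrix (Fin (n + 1)) (Fin (n + 1)) R, U * V = 1 ∧ V * U = 1 ∧
      ∃ a : R, ∀ i, x i = a * U i 0 := by
  set N := Submodule.span R {x} with hN
  obtain ⟨k, bM, bN, f, a, snf⟩ := N.smithNormalForm (Pi.basisFun R (Fin (n + 1)))
  have hk : k ≤ 1 := by
    have h1 := Module.finrank_eq_card_basis bN
    have h2 : Module.finrank R N ≤ 1 := by
      simpa using finrank_span_le_card (R := R) ({x} : Set (Fin (n + 1) → R))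
    rwa [h1, Fintype.card_fin] at h2
  have hxN : x ∈ N := Submodule.mem_span_singleton_self x
  have hk0 : k ≠ 0 := by
    rintro rfl
    have h0 := bN.sum_repr ⟨x, hxN⟩
    rw [Finset.univ_eq_empty, Finset.sum_empty] at h0
    exact hx (congrArg Subtype.val h0).symm
  obtain rfl : k = 1 := by omega
  set b := bM.reindex (Equiv.swap (f 0) 0) with hb
  have hb0 : b 0 = bM (f 0) := by simp [hb]
  refine ⟨(Pi.basisFun R _).toMatrix b, b.toMatrix (Pi.basisFun R _),
    Module.Basis.toMatrix_mul_toMatrix_flip _ _, Module.Basis.toMatrix_mul_toMatrix_flip _ _,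
    bN.repr ⟨x, hxN⟩ 0 * a 0, fun i => ?_⟩
  have h1 := bN.sum_repr ⟨x, hxN⟩
  rw [Fin.sum_univ_one] at h1
  have h2 : bN.repr ⟨x, hxN⟩ 0 • (a 0 • bM (f 0)) = x := by
    rw [← snf 0]; exact congrArg Subtype.val h1
  rw [Module.Basis.toMatrix_apply, hb0, Pi.basisFun_repr, mul_assoc]
  exact (congrFun h2 i).symm

lemma exists_unimodular_col_intO {ℓ n : ℕ} [IsPrincipalIdealRing (intO ℓ)]
    {x : Fin (n + 1) → ℂ} (hxO : ∀ i, x i ∈ intO ℓ) (hx : x ≠ 0) :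
    ∃ U V : Matrix (Fin (n + 1)) (Fin (n + 1)) ℂ, (∀ i j, U i j ∈ intO ℓ) ∧
      (∀ i j, V i j ∈ intO ℓ) ∧ U * V = 1 ∧ V * U = 1 ∧
      ∃ a ∈ intO ℓ, x = a • U.col 0 := by
  obtain ⟨U, V, hUV, hVU, a, ha⟩ := exists_unimodular_col (fun i => (⟨x i, hxO i⟩ : intO ℓ))
    (fun h => hx (funext fun i => congrArg Subtype.val (congrFun h i)))
  refine ⟨U.map (intO ℓ).subtype, V.map (intO ℓ).subtype, fun i j => (U i j).2,
    fun i j => (V i j).2, ?_, ?_, a, a.2, ?_⟩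
  · rw [← Matrix.map_mul, hUV, Matrix.map_one _ (map_zero _) (map_one _)]
  · rw [← Matrix.map_mul, hVU, Matrix.map_one _ (map_zero _) (map_one _)]
  · funext i
    exact congrArg Subtype.val (ha i)

lemma mulVec_mem_intO {ℓ : ℕ} {m n : Type*} [Fintype n] {A : Matrix m n ℂ}
    (hA : ∀ i j, A i j ∈ intO ℓ) {x : n → ℂ} (hx : ∀ i, x i ∈ intO ℓ) (i : m) :
    (A.mulVec x) i ∈ intO ℓ :=
  sum_mem fun j _ => mul_mem (hA i j) (hx j)

lemma vecMul_mem_intO {ℓ : ℕ} {m n : Type*} [Fintype m] {A : Matrix m n ℂ} {x : m → ℂ}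
    (hx : ∀ i, x i ∈ intO ℓ) (hA : ∀ i j, A i j ∈ intO ℓ) (j : n) :
    (x ᵥ* A) j ∈ intO ℓ :=
  sum_mem fun i _ => mul_mem (hx i) (hA i j)

lemma matrix_mul_mem_intO {ℓ : ℕ} {m n p : Type*} [Fintype n] {A : Matrix m n ℂ}
    {B : Matrix n p ℂ} (hA : ∀ i j, A i j ∈ intO ℓ) (hB : ∀ i j, B i j ∈ intO ℓ) (i : m)
    (j : p) : (A * B) i j ∈ intO ℓ :=
  sum_mem fun k _ => mul_mem (hA i k) (hB k j)

end UnimodularCompletion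

section UnitBlock

/-- The block matrix `[1 u; 0 A]`. -/
def unitBlock {n : ℕ} (u : Fin n → ℂ) (A : Matrix (Fin n) (Fin n) ℂ) :
    Matrix (Fin (n + 1)) (Fin (n + 1)) ℂ :=
  Matrix.of (Fin.cons (Fin.cons 1 u) fun i => Fin.cons 0 (A i))

variable {n : ℕ} (u v : Fin n → ℂ) (A B : Matrix (Fin n) (Fin n) ℂ)

@[simp] lemma unitBlock_zero_zero : unitBlock u A 0 0 = 1 := rfl

@[simp] lemma unitBlock_zero_succ (j : Fin n) : unitBlock u A 0 j.succ = u j := rfl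

@[simp] lemma unitBlock_succ_zero (i : Fin n) : unitBlock u A i.succ 0 = 0 := rfl

@[simp] lemma unitBlock_succ_succ (i j : Fin n) : unitBlock u A i.succ j.succ = A i j := rfl

lemma unitBlock_mul : unitBlock u A * unitBlock v B = unitBlock (v + u ᵥ* B) (A * B) := by
  ext i j
  rw [Matrix.mul_apply, Fin.sum_univ_succ]
  refine Fin.cases ?_ (fun i => ?_) i <;> refine Fin.cases ?_ (fun j => ?_) j <;>
    simp [Matrix.mul_apply, Matrix.vecMul, dotProduct]

lemma unitBlock_zero_one : unitBlock (0 : Fin n → ℂ) 1 = 1 := by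
  ext i j
  refine Fin.cases ?_ (fun i => ?_) i <;> refine Fin.cases ?_ (fun j => ?_) j <;>
    simp [Matrix.one_apply, Fin.succ_ne_zero, (Fin.succ_ne_zero _).symm]

lemma unitBlock_mulVec (y : Fin (n + 1) → ℂ) :
    unitBlock u A *ᵥ y = Fin.cons (y 0 + u ⬝ᵥ Fin.tail y) (A *ᵥ Fin.tail y) := by
  ext i
  refine Fin.cases ?_ (fun i => ?_) i <;>
    simp [Matrix.mulVec, dotProduct, Fin.sum_univ_succ, Fin.tail]

lemma vecMul_unitBlock (z₀ : ℂ) (z : Fin n → ℂ) :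
    (Fin.cons z₀ z : Fin (n + 1) → ℂ) ᵥ* unitBlock u A = Fin.cons z₀ (z₀ • u + z ᵥ* A) := by
  ext i
  refine Fin.cases ?_ (fun i => ?_) i <;>
    simp [Matrix.vecMul, dotProduct, Fin.sum_univ_succ]

lemma unitBlock_mul_eq_one {A B : Matrix (Fin n) (Fin n) ℂ} (h : A * B = 1) :
    unitBlock u A * unitBlock (-(u ᵥ* B)) B = 1 := by
  rw [unitBlock_mul, h, neg_add_cancel, unitBlock_zero_one]

variable {u A} in
lemma unitBlock_mem_intO {ℓ : ℕ} (hu : ∀ j, u j ∈ intO ℓ) (hA : ∀ i j, A i j ∈ intO ℓ)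
    (i j : Fin (n + 1)) : unitBlock u A i j ∈ intO ℓ := by
  refine Fin.cases ?_ (fun i => ?_) i <;> refine Fin.cases ?_ (fun j => ?_) j
  · exact one_mem _
  · exact hu j
  · exact zero_mem _
  · exact hA i j

/-- Upper triangular with ones on the diagonal. -/
structure IsUpperUnipotent {n : ℕ} (H : Matrix (Fin n) (Fin n) ℂ) : Prop where
  diag : ∀ i, H i i = 1
  lower : ∀ i j, j < i → H i j = 0

lemma IsUpperUnipotent.unitBlock {A : Matrix (Fin n) (Fin n) ℂ} (h : IsUpperUnipotent A) :
    IsUpperUnipotent (unitBlock u A) where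
  diag i := by refine Fin.cases ?_ (fun i => ?_) i <;> simp [h.diag]
  lower i j := by
    refine Fin.cases ?_ (fun i => ?_) i <;> refine Fin.cases ?_ (fun j => ?_) j <;> simp
    exact h.lower i j

lemma IsUpperUnipotent.exists_unitBlock {H : Matrix (Fin (n + 1)) (Fin (n + 1)) ℂ}
    (h : IsUpperUnipotent H) : ∃ u A, IsUpperUnipotent A ∧ H = _root_.unitBlock u A := by
  refine ⟨fun j => H 0 j.succ, H.submatrix Fin.succ Fin.succ, ⟨fun i => h.diag _, fun i j hij =>
    h.lower _ _ (Fin.succ_lt_succ_iff.2 hij)⟩, ?_⟩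
  ext i j
  refine Fin.cases ?_ (fun i => ?_) i <;> refine Fin.cases ?_ (fun j => ?_) j <;>
    simp [h.diag, h.lower]

/-- Size reduction of a row vector modulo an upper unipotent matrix. -/
lemma IsUpperUnipotent.exists_size_reduction {ℓ : ℕ} (hpos : 0 < ℓ) {n : ℕ}
    {V : Matrix (Fin n) (Fin n) ℂ} (hV : IsUpperUnipotent V) (u c : Fin n → ℂ) :
    ∃ x : Fin n → ℂ, (∀ i, x i ∈ intO ℓ) ∧ ∀ j, ‖((u + x) ᵥ* V) j + c j‖ ≤ coverO ℓ := by
  induction n with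
  | zero => exact ⟨0, fun i => i.elim0, fun i => i.elim0⟩
  | succ n ih =>
    obtain ⟨v, A, hA, rfl⟩ := hV.exists_unitBlock
    obtain ⟨w, hw, hwb⟩ := exists_mem_intO_norm_add_le hpos (u 0 + c 0)
    obtain ⟨x, hx, hxb⟩ := ih hA (Fin.tail u) ((u 0 + w) • v + Fin.tail c)
    refine ⟨Fin.cons w x, fun i => Fin.cases hw hx i, fun j => ?_⟩
    have hcons : u + (Fin.cons w x : Fin (n + 1) → ℂ) = Fin.cons (u 0 + w) (Fin.tail u + x) := by
      ext i
      refine Fin.cases ?_ (fun i => ?_) i <;> simp [Fin.tail]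
    rw [hcons, vecMul_unitBlock]
    refine Fin.cases ?_ (fun j => ?_) j
    · rw [Fin.cons_zero]; convert hwb using 2; ring
    · rw [Fin.cons_succ]
      convert hxb j using 2
      simp [Fin.tail]; ring

end UnitBlock

section Reduction

/-- The hermitian form `x ↦ ‖B x‖²`. -/
noncomputable def normForm {κ : Type} [Fintype κ] {n : ℕ} (B : Matrix κ (Fin n) ℂ)
    (x : Fin n → ℂ) : ℝ :=
  ∑ k, ‖(B *ᵥ x) k‖ ^ 2

lemma normForm_nonneg {κ : Type} [Fintype κ] {n : ℕ} (B : Matrix κ (Fin n) ℂ)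
    (x : Fin n → ℂ) : 0 ≤ normForm B x :=
  Finset.sum_nonneg fun _ _ => by positivity

lemma normForm_mul {κ : Type} [Fintype κ] {n : ℕ} (B : Matrix κ (Fin n) ℂ)
    (U : Matrix (Fin n) (Fin n) ℂ) (x : Fin n → ℂ) :
    normForm (B * U) x = normForm B (U *ᵥ x) := by
  simp [normForm, Matrix.mulVec_mulVec]

lemma normForm_smul {κ : Type} [Fintype κ] {n : ℕ} (B : Matrix κ (Fin n) ℂ)
    (a : ℂ) (x : Fin n → ℂ) : normForm B (a • x) = ‖a‖ ^ 2 * normForm B x := by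
  simp [normForm, Matrix.mulVec_smul, mul_pow, Finset.mul_sum]

lemma sum_norm_sq_add {κ : Type} [Fintype κ] (b w : κ → ℂ) (z : ℂ)
    (h : ∑ k, star (b k) * w k = 0) :
    ∑ k, ‖b k * z + w k‖ ^ 2 = (∑ k, ‖b k‖ ^ 2) * ‖z‖ ^ 2 + ∑ k, ‖w k‖ ^ 2 := by
  have h2 : ∑ k, ((b k * z) * star (w k)).re = 0 := by
    rw [← Complex.re_sum]
    have : ∑ k, (b k * z) * star (w k) = z * star (∑ k, star (b k) * w k) := by
      rw [star_sum, Finset.mul_sum]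
      refine Finset.sum_congr rfl fun k _ => ?_
      rw [star_mul', star_star]; ring
    rw [this, h]; simp
  have h3 : ∀ k, ‖b k * z + w k‖ ^ 2 =
      ‖b k‖ ^ 2 * ‖z‖ ^ 2 + ‖w k‖ ^ 2 + 2 * ((b k * z) * star (w k)).re := by
    intro k
    simp only [← Complex.normSq_eq_norm_sq]
    rw [Complex.normSq_add, Complex.normSq_mul]; rfl
  simp only [h3, Finset.sum_add_distrib, ← Finset.mul_sum, ← Finset.sum_mul, h2]
  ring

/-- Splitting off the first variable of a hermitian form by completing the square. -/
lemma exists_normForm_split {κ : Type} [Fintype κ] {n : ℕ} (B : Matrix κ (Fin (n + 1)) ℂ)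
    (h0 : ∑ k, ‖B k 0‖ ^ 2 ≠ 0) :
    ∃ (u : Fin n → ℂ) (B' : Matrix κ (Fin n) ℂ), ∀ y : Fin (n + 1) → ℂ,
      normForm B y = (∑ k, ‖B k 0‖ ^ 2) * ‖y 0 + u ⬝ᵥ Fin.tail y‖ ^ 2 +
        normForm B' (Fin.tail y) := by
  set d : ℝ := ∑ k, ‖B k 0‖ ^ 2 with hd
  set u : Fin n → ℂ := fun j => (∑ k, star (B k 0) * B k j.succ) / d with hu
  refine ⟨u, Matrix.of fun k j => B k j.succ - B k 0 * u j, fun y => ?_⟩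
  set B' : Matrix κ (Fin n) ℂ := Matrix.of fun k j => B k j.succ - B k 0 * u j with hB'
  have hdC : (d : ℂ) = ∑ k, star (B k 0) * B k 0 := by
    rw [hd]; push_cast
    refine Finset.sum_congr rfl fun k _ => ?_
    rw [mul_comm, Complex.star_def, Complex.mul_conj, Complex.normSq_eq_norm_sq]; push_cast; rfl
  have hcol : ∀ j, ∑ k, star (B k 0) * B' k j = 0 := by
    intro j
    have : ∑ k, star (B k 0) * B' k j =
        ∑ k, star (B k 0) * B k j.succ - (∑ k, star (B k 0) * B k 0) * u j := by
      rw [Finset.sum_mul, ← Finset.sum_sub_distrib]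
      refine Finset.sum_congr rfl fun k _ => ?_
      simp only [hB', Matrix.of_apply]; ring
    rw [this, ← hdC, hu]
    have : (d : ℂ) ≠ 0 := by exact_mod_cast h0
    field_simp
    ring
  have horth : ∑ k, star (B k 0) * (B' *ᵥ Fin.tail y) k = 0 := by
    have : ∑ k, star (B k 0) * (B' *ᵥ Fin.tail y) k =
        ∑ j, (∑ k, star (B k 0) * B' k j) * Fin.tail y j := by
      simp only [Matrix.mulVec, dotProduct, Finset.mul_sum, Finset.sum_mul]
      rw [Finset.sum_comm]
      exact Finset.sum_congr rfl fun _ _ => Finset.sum_congr rfl fun _ _ => by ring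
    rw [this]; simp only [hcol, zero_mul, Finset.sum_const_zero]
  rw [normForm, normForm, hd, ← sum_norm_sq_add _ _ _ horth]
  refine Finset.sum_congr rfl fun k _ => ?_
  congr 2
  simp only [Matrix.mulVec, dotProduct, Fin.sum_univ_succ, hB', Matrix.of_apply, sub_mul,
    Finset.sum_sub_distrib, mul_add, Finset.mul_sum, Fin.tail]
  simp only [mul_assoc]
  ring

/-- A basis of `𝓞^n` (the columns of `U`) which is Hermite–Korkine–Zolotarev reduced up to a
factor `2` for the hermitian form `Q` and whose dual basis is size reduced. -/
structure IsReduction (ℓ : ℕ) {n : ℕ} (Q : (Fin n → ℂ) → ℝ)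
    (U U' H V : Matrix (Fin n) (Fin n) ℂ) (d : Fin n → ℝ) : Prop where
  U_mem : ∀ i j, U i j ∈ intO ℓ
  U'_mem : ∀ i j, U' i j ∈ intO ℓ
  U_mul : U * U' = 1
  U'_mul : U' * U = 1
  H_unip : IsUpperUnipotent H
  V_unip : IsUpperUnipotent V
  H_mul : H * V = 1
  V_mul : V * H = 1
  V_le : ∀ i j, ‖V i j‖ ≤ coverO ℓ
  d_pos : ∀ i, 0 < d i
  form : ∀ x, Q (U *ᵥ x) = ∑ i, d i * ‖(H *ᵥ x) i‖ ^ 2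
  short : ∀ (l : Fin n) (x : Fin n → ℂ), (∀ i, x i ∈ intO ℓ) → (∀ i < l, x i = 0) → x ≠ 0 →
    d l ≤ 2 * ∑ i ∈ Finset.Ici l, d i * ‖(H *ᵥ x) i‖ ^ 2

lemma exists_pos_le_normForm {ℓ : ℕ} (hpos : 0 < ℓ) {κ : Type} [Fintype κ] {n : ℕ}
    (B : Matrix κ (Fin n) ℂ) (hB : Function.Injective B.mulVec) :
    ∃ c > 0, ∀ x : Fin n → ℂ, (∀ i, x i ∈ intO ℓ) → x ≠ 0 → c ≤ normForm B x := by
  obtain ⟨K, hK, hKB⟩ := LinearMap.exists_antilipschitzWith B.mulVecLin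
    (LinearMap.ker_eq_bot.2 hB)
  have hK' : (0 : ℝ) < K := hK
  refine ⟨((K : ℝ)⁻¹) ^ 2, by positivity, fun x hx h0 => ?_⟩
  obtain ⟨i, hi⟩ := Function.ne_iff.1 h0
  have h1 : 1 ≤ ‖x‖ := by
    have := one_le_norm_sq_of_mem_intO hpos (hx i) hi
    have h2 : 1 ≤ ‖x i‖ := by nlinarith [norm_nonneg (x i)]
    exact h2.trans (norm_le_pi_norm x i)
  have h2 : ‖x‖ ≤ K * ‖B *ᵥ x‖ := by
    have := hKB.le_mul_dist x 0
    simpa [dist_eq_norm] using this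
  have h3 : (K : ℝ)⁻¹ ≤ ‖B *ᵥ x‖ := by
    rw [inv_le_iff_one_le_mul₀' hK']; exact h1.trans h2
  have h4 : ‖B *ᵥ x‖ ≤ Real.sqrt (normForm B x) := by
    rw [pi_norm_le_iff_of_nonneg (Real.sqrt_nonneg _)]
    intro k
    refine Real.le_sqrt_of_sq_le ?_
    exact Finset.single_le_sum (f := fun k => ‖(B *ᵥ x) k‖ ^ 2) (fun _ _ => by positivity)
      (Finset.mem_univ k)
  calc ((K : ℝ)⁻¹) ^ 2 ≤ Real.sqrt (normForm B x) ^ 2 := by gcongr; exact h3.trans h4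
    _ = _ := Real.sq_sqrt (normForm_nonneg B x)

/-- Up to a factor `2`, a shortest vector of the lattice can be made the first basis vector. -/
lemma exists_short_first_col {ℓ : ℕ} (hpos : 0 < ℓ) [IsPrincipalIdealRing (intO ℓ)]
    {κ : Type} [Fintype κ] {n : ℕ} (B : Matrix κ (Fin (n + 1)) ℂ)
    (hB : Function.Injective B.mulVec) :
    ∃ U V : Matrix (Fin (n + 1)) (Fin (n + 1)) ℂ, (∀ i j, U i j ∈ intO ℓ) ∧
      (∀ i j, V i j ∈ intO ℓ) ∧ U * V = 1 ∧ V * U = 1 ∧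
      0 < ∑ k, ‖(B * U) k 0‖ ^ 2 ∧
      ∀ y : Fin (n + 1) → ℂ, (∀ i, y i ∈ intO ℓ) → y ≠ 0 →
        ∑ k, ‖(B * U) k 0‖ ^ 2 ≤ 2 * normForm B y := by
  obtain ⟨c, hc, hcB⟩ := exists_pos_le_normForm hpos B hB
  set S : Set ℝ := {q | ∃ y : Fin (n + 1) → ℂ, (∀ i, y i ∈ intO ℓ) ∧ y ≠ 0 ∧ normForm B y = q}
  have hbdd : BddBelow S := ⟨c, by rintro q ⟨y, hy, hy0, rfl⟩; exact hcB y hy hy0⟩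
  have hne : S.Nonempty := ⟨_, fun _ => 1, fun _ => one_mem _,
    fun h => one_ne_zero (congrFun h 0), rfl⟩
  have hinf : 0 < sInf S := hc.trans_le (le_csInf hne fun q hq => by
    obtain ⟨y, hy, hy0, rfl⟩ := hq; exact hcB y hy hy0)
  obtain ⟨q, ⟨x, hx, hx0, rfl⟩, hlt⟩ := exists_lt_of_csInf_lt hne
    (show sInf S < 2 * sInf S by linarith)
  obtain ⟨U, V, hU, hV, hUV, hVU, a, ha, hxa⟩ := exists_unimodular_col_intO hx hx0
  have hcol : ∑ k, ‖(B * U) k 0‖ ^ 2 = normForm B (U.col 0) := by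
    simp [normForm, Matrix.mul_apply, Matrix.mulVec, dotProduct, Matrix.col]
  have hcol0 : U.col 0 ≠ 0 := by
    intro h; rw [h, smul_zero] at hxa; exact hx0 hxa
  have ha0 : a ≠ 0 := by
    rintro rfl; rw [zero_smul] at hxa; exact hx0 hxa
  refine ⟨U, V, hU, hV, hUV, hVU, ?_, fun y hy hy0 => ?_⟩
  · rw [hcol]; exact hc.trans_le (hcB _ (fun i => hU i 0) hcol0)
  · have h1 : normForm B (U.col 0) ≤ normForm B x := by
      rw [hxa, normForm_smul]
      exact le_mul_of_one_le_left (normForm_nonneg _ _) (one_le_norm_sq_of_mem_intO hpos ha ha0)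
    have h2 : sInf S ≤ normForm B y := csInf_le hbdd ⟨y, hy, hy0, rfl⟩
    rw [hcol]; linarith

theorem exists_isReduction {ℓ : ℕ} (hpos : 0 < ℓ) [IsPrincipalIdealRing (intO ℓ)]
    {κ : Type} [Fintype κ] {n : ℕ} (B : Matrix κ (Fin n) ℂ)
    (hB : Function.Injective B.mulVec) :
    ∃ U U' H V d, IsReduction ℓ (normForm B) U U' H V d := by
  induction n with
  | zero =>
    refine ⟨1, 1, 1, 1, 1, ?_⟩
    constructor <;> first | exact fun i => i.elim0 | skip
    any_goals simp
    · exact ⟨fun i => i.elim0, fun i => i.elim0⟩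
    · exact ⟨fun i => i.elim0, fun i => i.elim0⟩
    · simp [normForm]
  | succ n ih =>
    obtain ⟨U₀, V₀, hU₀, hV₀, hUV₀, hVU₀, hd₀, hmin⟩ := exists_short_first_col hpos B hB
    obtain ⟨u, B', hsplit⟩ := exists_normForm_split (B * U₀) hd₀.ne'
    set d₀ := ∑ k, ‖(B * U₀) k 0‖ ^ 2
    have hinj0 : ∀ z, normForm B z = 0 → z = 0 := by
      intro z hz
      refine hB (a₂ := 0) ?_
      funext k
      have := (Finset.sum_eq_zero_iff_of_nonneg (fun k _ => by positivity)).1 hz k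
        (Finset.mem_univ k)
      simpa using this
    have hB' : Function.Injective B'.mulVec := by
      rw [← Matrix.coe_mulVecLin, injective_iff_map_eq_zero]
      intro z hz
      have h1 := hsplit (Fin.cons (-(u ⬝ᵥ z)) z)
      have h2 : normForm B' z = 0 := by
        rw [Matrix.mulVecLin_apply] at hz
        simp [normForm, hz]
      rw [Fin.tail_cons, Fin.cons_zero, h2, neg_add_cancel, normForm_mul] at h1
      have h3 := hinj0 _ (by simpa using h1)
      have h4 : V₀ *ᵥ (U₀ *ᵥ (Fin.cons (-(u ⬝ᵥ z)) z : Fin (n + 1) → ℂ)) = 0 := by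
        rw [h3, Matrix.mulVec_zero]
      rw [Matrix.mulVec_mulVec, hVU₀, Matrix.one_mulVec] at h4
      funext i
      exact congrFun h4 i.succ
    obtain ⟨U₁, U₁', H₁, V₁, d₁, h⟩ := ih B' hB'
    obtain ⟨x, hx, hxb⟩ := h.V_unip.exists_size_reduction hpos (u ᵥ* U₁) 0
    set w := u ᵥ* U₁ + x with hw
    have hform : ∀ y, normForm B ((U₀ * unitBlock x U₁) *ᵥ y) =
        ∑ i, (Fin.cons d₀ d₁ : Fin (n + 1) → ℝ) i * ‖(unitBlock w H₁ *ᵥ y) i‖ ^ 2 := by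
      intro y
      rw [← Matrix.mulVec_mulVec, ← normForm_mul, hsplit, Fin.sum_univ_succ, unitBlock_mulVec,
        unitBlock_mulVec]
      simp only [Fin.tail_cons, Fin.cons_zero, Fin.cons_succ, h.form]
      congr 4
      rw [hw, add_dotProduct, Matrix.dotProduct_mulVec]
      ring
    have hVU : unitBlock w H₁ * unitBlock (-(w ᵥ* V₁)) V₁ = 1 := unitBlock_mul_eq_one _ h.H_mul
    refine ⟨U₀ * unitBlock x U₁, unitBlock (-(x ᵥ* U₁')) U₁' * V₀, unitBlock w H₁,
      unitBlock (-(w ᵥ* V₁)) V₁, Fin.cons d₀ d₁, ?_⟩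
    have hUU : U₀ * unitBlock x U₁ * (unitBlock (-(x ᵥ* U₁')) U₁' * V₀) = 1 := by
      rw [Matrix.mul_assoc, ← Matrix.mul_assoc (unitBlock x U₁), unitBlock_mul_eq_one _ h.U_mul,
        Matrix.one_mul, hUV₀]
    have hU : ∀ i j, (U₀ * unitBlock x U₁) i j ∈ intO ℓ :=
      matrix_mul_mem_intO hU₀ (unitBlock_mem_intO hx h.U_mem)
    constructor
    · exact hU
    · exact matrix_mul_mem_intO (unitBlock_mem_intO (fun j => neg_mem (vecMul_mem_intO hx
        h.U'_mem j)) h.U'_mem) hV₀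
    · exact hUU
    · exact mul_eq_one_comm.1 hUU
    · exact h.H_unip.unitBlock _
    · exact h.V_unip.unitBlock _
    · exact hVU
    · exact mul_eq_one_comm.1 hVU
    · intro i j
      have hc := one_le_coverO ℓ
      refine Fin.cases ?_ (fun i => ?_) i <;> refine Fin.cases ?_ (fun j => ?_) j
      · simpa using hc
      · simpa using hxb j
      · simp; linarith
      · exact h.V_le i j
    · exact fun i => Fin.cases hd₀ h.d_pos i
    · exact hform
    · intro l y hy hyl hy0
      induction l using Fin.cases with
      | zero =>
        have hI : Finset.Ici (0 : Fin (n + 1)) = Finset.univ := by ext i; simp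
        rw [hI, ← hform]
        refine hmin _ (mulVec_mem_intO hU hy) fun h0 => hy0 ?_
        have h1 := congrArg (fun z => (unitBlock (-(x ᵥ* U₁')) U₁' * V₀) *ᵥ z) h0
        simpa only [Matrix.mulVec_mulVec, mul_eq_one_comm.1 hUU, Matrix.one_mulVec,
          Matrix.mulVec_zero] using h1
      | succ l =>
        have h1 := h.short l (Fin.tail y) (fun i => hy i.succ)
          (fun i hi => hyl i.succ (Fin.succ_lt_succ_iff.2 hi)) (by
            intro h0
            apply hy0
            funext i
            refine Fin.cases (hyl 0 (Fin.succ_pos l)) (fun i => congrFun h0 i) i)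
        have hI : Finset.Ici l.succ = (Finset.Ici l).map (Fin.succEmb n) := by simp
        rw [hI, Finset.sum_map]
        simpa [unitBlock_mulVec] using h1

end Reduction

section ReductionRatio

lemma le_of_le_average {b : ℕ → ℝ} {G : ℝ} {N : ℕ}
    (h : ∀ k ≤ N, ((k : ℝ) + 1) * b k ≤ (k + 1) * G + ∑ i ∈ Finset.range (k + 1), b i) :
    ∀ k ≤ N, b k ≤ b 0 + G * (1 + harmonic k) := by
  have hsum : ∀ k ≤ N, ∑ i ∈ Finset.range (k + 1), b i ≤ (k + 1) * (b 0 + G * harmonic k) := by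
    intro k
    induction k with
    | zero => intro _; simp
    | succ k ih =>
      intro hk
      have h1 := ih (by omega)
      have h2 := h (k + 1) hk
      rw [Finset.sum_range_succ] at h2 ⊢
      rw [harmonic_succ]
      push_cast at h2 ⊢
      have hk1 : (0 : ℝ) < (k : ℝ) + 1 := by positivity
      have h3 : b (k + 1) ≤ b 0 + G * harmonic k + G * ((k + 2) * ((k : ℝ) + 1)⁻¹) := by
        rw [← sub_nonneg]
        have : 0 ≤ ((k : ℝ) + 1) *
            (b 0 + G * harmonic k + G * ((k + 2) * ((k : ℝ) + 1)⁻¹) - b (k + 1)) := by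
          have : ((k : ℝ) + 1) *
            (b 0 + G * harmonic k + G * ((k + 2) * ((k : ℝ) + 1)⁻¹) - b (k + 1)) =
            (k + 1) * (b 0 + G * harmonic k) + G * (k + 2) - (k + 1) * b (k + 1) := by
            field_simp
          rw [this]; linarith
        exact nonneg_of_mul_nonneg_right this hk1
      calc _ ≤ (k + 1) * (b 0 + G * harmonic k) +
            (b 0 + G * harmonic k + G * ((k + 2) * ((k : ℝ) + 1)⁻¹)) := add_le_add h1 h3
        _ = _ := by ring
  intro k hk
  have h1 := hsum k hk
  have h2 := h k hk
  have hk1 : (0 : ℝ) < (k : ℝ) + 1 := by positivity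
  refine le_of_mul_le_mul_left ?_ hk1
  linarith

/-- The bound for the ratios `d l / d j`, `l ≤ j`, in a reduced basis of rank `n`. -/
noncomputable def ratioBound (ρ : ℝ) (n : ℕ) : ℝ :=
  Real.exp (Real.log (8 * n * ρ ^ 2) * (2 + Real.log n))

variable {ℓ n : ℕ} {Q : (Fin n → ℂ) → ℝ} {U U' H V : Matrix (Fin n) (Fin n) ℂ} {d : Fin n → ℝ}

lemma IsReduction.pow_le_prod (h : IsReduction ℓ Q U U' H V d) (hpos : 0 < ℓ) {l j : Fin n}
    (hlj : l ≤ j) :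
    d l ^ (Finset.Icc l j).card ≤
      (8 * n * coverO ℓ ^ 2) ^ (Finset.Icc l j).card * ∏ i ∈ Finset.Icc l j, d i := by
  set I := Finset.Icc l j with hI
  set m := I.card with hm
  have hne : I.Nonempty := ⟨l, by simp [hI, hlj]⟩
  have hm0 : 0 < m := hne.card_pos
  have hmR : (0 : ℝ) < m := by exact_mod_cast hm0
  have hmn : (m : ℝ) ≤ n := by
    have := I.card_le_univ
    rw [Fintype.card_fin] at this
    exact_mod_cast this
  have hdl := h.d_pos l
  have hρ := one_le_coverO ℓ
  have : Nonempty I := hne.to_subtype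
  set A : Matrix I I ℂ := Matrix.of fun i k => (Real.sqrt (d i) : ℂ) * H i k with hA
  have hdet : ‖A.det‖ ^ 2 = ∏ i ∈ I, d i := by
    have hT : A.BlockTriangular id := by
      intro i k hik
      have h0 : H i k = 0 := h.H_unip.lower _ _ hik
      simp [hA, h0]
    rw [Matrix.det_of_isUpperTriangular hT, norm_prod, ← Finset.prod_pow,
      ← Finset.prod_coe_sort I]
    refine Finset.prod_congr rfl fun i _ => ?_
    simp only [hA, Matrix.of_apply, h.H_unip.diag, mul_one, Complex.norm_real,
      Real.norm_eq_abs, sq_abs]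
    exact Real.sq_sqrt (h.d_pos _).le
  have hprod : 0 < ∏ i ∈ I, d i := Finset.prod_pos fun i _ => h.d_pos i
  set t : ℝ := Real.sqrt (d l / (2 * m)) with ht
  have ht2 : t ^ 2 = d l / (2 * m) := Real.sq_sqrt (by positivity)
  have ht0 : 0 < t := Real.sqrt_pos.2 (by positivity)
  have key : t ^ (2 * m) ≤ (2 * coverO ℓ) ^ (2 * m) * ∏ i ∈ I, d i := by
    by_contra! hlt
    obtain ⟨x, hx, hx0, hxt⟩ := exists_intO_mulVec_norm_lt hpos A
      (by intro h0; rw [h0] at hdet; simp at hdet; exact hprod.ne hdet) t ht0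
      (by rwa [hdet, Fintype.card_coe])
    set y : Fin n → ℂ := fun i => if hi : i ∈ I then x ⟨i, hi⟩ else 0 with hy
    have hyI : ∀ i : I, y i = x i := fun i => by simp [hy]
    have hyn : ∀ i, i ∉ I → y i = 0 := fun i hi => by simp [hy, hi]
    have hshort := h.short l y
      (fun i => by
        by_cases hi : i ∈ I
        · exact hyI ⟨i, hi⟩ ▸ hx ⟨i, hi⟩
        · rw [hyn i hi]; exact zero_mem _)
      (fun i hi => hyn i (by simp [hI, hi]))
      (by
        obtain ⟨i, hi⟩ := Function.ne_iff.1 hx0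
        intro h0
        apply hi
        rw [← hyI, h0]; rfl)
    have hsub : ∑ i ∈ Finset.Ici l, d i * ‖(H *ᵥ y) i‖ ^ 2 =
        ∑ i ∈ I, d i * ‖(H *ᵥ y) i‖ ^ 2 := by
      symm
      refine Finset.sum_subset (fun i hi => by simp [hI] at hi ⊢; exact hi.1) fun i hi hiI => ?_
      have hji : j < i := by
        simp [hI] at hi hiI; exact hiI hi
      have : (H *ᵥ y) i = 0 := by
        rw [Matrix.mulVec, dotProduct]
        refine Finset.sum_eq_zero fun k _ => ?_
        by_cases hk : k < i
        · rw [h.H_unip.lower _ _ hk, zero_mul]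
        · rw [hyn k (by
            simp only [hI, Finset.mem_Icc, not_and, not_le]
            intro _; exact hji.trans_le (not_lt.1 hk)), mul_zero]
      rw [this]; simp
    have hterm : ∀ i : I, d i * ‖(H *ᵥ y) i‖ ^ 2 = ‖(A *ᵥ x) i‖ ^ 2 := by
      intro i
      have : (A *ᵥ x) i = Real.sqrt (d i) * (H *ᵥ y) i := by
        simp only [Matrix.mulVec, dotProduct, hA, Matrix.of_apply, Finset.mul_sum]
        rw [← Finset.sum_subset (Finset.subset_univ I) (fun k _ hk => by rw [hyn k hk]; ring),
          ← Finset.sum_coe_sort I]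
        refine Finset.sum_congr rfl fun k _ => ?_
        rw [hyI]; ring
      rw [this, norm_mul, mul_pow, Complex.norm_real, Real.norm_eq_abs, sq_abs,
        Real.sq_sqrt (h.d_pos _).le]
    rw [hsub, ← Finset.sum_coe_sort I] at hshort
    have hlt2 : ∑ i : I, d i * ‖(H *ᵥ y) i‖ ^ 2 < ∑ _i : I, t ^ 2 := by
      refine Finset.sum_lt_sum_of_nonempty Finset.univ_nonempty fun i _ => ?_
      rw [hterm]
      have := hxt i
      gcongr
    rw [Finset.sum_const, Finset.card_univ, Fintype.card_coe, nsmul_eq_mul, ht2] at hlt2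
    have : (m : ℝ) * (d l / (2 * m)) = d l / 2 := by field_simp
    rw [← hm, this] at hlt2
    linarith
  rw [pow_mul, pow_mul, ht2] at key
  have hd : d l ^ m = (2 * m) ^ m * (d l / (2 * m)) ^ m := by
    rw [← mul_pow]; congr 1; field_simp
  calc d l ^ m ≤ (2 * m) ^ m * (((2 * coverO ℓ) ^ 2) ^ m * ∏ i ∈ I, d i) := by
        rw [hd]; gcongr
    _ = (8 * m * coverO ℓ ^ 2) ^ m * ∏ i ∈ I, d i := by
        rw [← mul_assoc, ← mul_pow]; congr 2; ring
    _ ≤ _ := by gcongr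

lemma IsReduction.le_ratioBound_mul (h : IsReduction ℓ Q U U' H V d) (hpos : 0 < ℓ)
    {l j : Fin n} (hlj : l ≤ j) : d l ≤ ratioBound (coverO ℓ) n * d j := by
  have hn : 0 < n := l.pos
  have hn1 : (1 : ℝ) ≤ n := by exact_mod_cast hn
  have hρ := one_le_coverO ℓ
  set G := Real.log (8 * n * coverO ℓ ^ 2) with hG
  have hG0 : 0 ≤ G := Real.log_nonneg (by nlinarith [one_le_pow₀ (n := 2) hρ])
  set b : ℕ → ℝ := fun k => Real.log (d ⟨j - k, by omega⟩) with hb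
  have havg : ∀ k ≤ (j : ℕ),
      ((k : ℝ) + 1) * b k ≤ (k + 1) * G + ∑ i ∈ Finset.range (k + 1), b i := by
    intro k hk
    set l' : Fin n := ⟨j - k, by omega⟩ with hl'
    have hl'j : l' ≤ j := by rw [Fin.le_def]; simp [hl']
    have hcard : (Finset.Icc l' j).card = k + 1 := by
      rw [Fin.card_Icc]; simp only [hl']; omega
    have h1 := h.pow_le_prod hpos hl'j
    have hprod : 0 < ∏ i ∈ Finset.Icc l' j, d i := Finset.prod_pos fun i _ => h.d_pos i
    have h2 := Real.log_le_log (pow_pos (h.d_pos _) _) h1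
    rw [Real.log_mul (by positivity) hprod.ne', Real.log_pow, Real.log_pow, hcard,
      Real.log_prod (fun i _ => (h.d_pos i).ne')] at h2
    have h3 : ∑ i ∈ Finset.Icc l' j, Real.log (d i) = ∑ i ∈ Finset.range (k + 1), b i := by
      refine Finset.sum_nbij' (fun i : Fin n => (j : ℕ) - i)
        (fun i : ℕ => (⟨j - i, by omega⟩ : Fin n)) ?_ ?_ ?_ ?_ ?_
      · intro i hi
        simp only [Finset.mem_Icc, Fin.le_def, hl'] at hi
        simp only [Finset.mem_range]; omega
      · intro i hi
        simp only [Finset.mem_range] at hi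
        simp only [Finset.mem_Icc, Fin.le_def, hl']; omega
      · intro i hi
        simp only [Finset.mem_Icc, Fin.le_def, hl'] at hi
        ext; simp only; omega
      · intro i hi
        simp only [Finset.mem_range] at hi
        simp only; omega
      · intro i hi
        simp only [Finset.mem_Icc, Fin.le_def, hl'] at hi
        have : (⟨j - (j - i : ℕ), by omega⟩ : Fin n) = i := by ext; simp only; omega
        simp only [hb, this]
    rw [h3] at h2
    push_cast at h2
    exact h2
  have hmain := le_of_le_average havg (j - l) (Nat.sub_le _ _)
  have hbl : b (j - l) = Real.log (d l) := by
    have : (⟨j - (j - l : ℕ), by omega⟩ : Fin n) = l := by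
      ext; simp only; rw [Fin.le_def] at hlj; omega
    simp only [hb, this]
  have hb0 : b 0 = Real.log (d j) := by simp [hb]
  have hharm : (harmonic (j - l : ℕ) : ℝ) ≤ 1 + Real.log n := by
    refine (harmonic_le_one_add_log _).trans ?_
    rcases Nat.eq_zero_or_pos ((j : ℕ) - l) with h0 | h0
    · rw [h0]; simp [Real.log_nonneg hn1]
    · have : (((j : ℕ) - l : ℕ) : ℝ) ≤ n := by exact_mod_cast (by omega : (j : ℕ) - l ≤ n)
      have h0' : (0 : ℝ) < (((j : ℕ) - l : ℕ) : ℝ) := by exact_mod_cast h0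
      gcongr
  rw [hbl, hb0] at hmain
  have h4 : Real.log (d l) ≤ G * (2 + Real.log n) + Real.log (d j) := by
    have := mul_le_mul_of_nonneg_left hharm hG0
    linarith
  rw [← Real.exp_log (h.d_pos l), ← Real.exp_log (h.d_pos j), ratioBound, ← Real.exp_add]
  exact Real.exp_le_exp.2 h4

end ReductionRatio

section Peel

lemma sum_norm_sq_mulVec_le {κ : Type} [Fintype κ] {n : ℕ} (A : Matrix κ (Fin n) ℂ)
    {c : ℝ} (hA : ∀ i j, ‖A i j‖ ^ 2 ≤ c) (x : Fin n → ℂ) :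
    ∑ k, ‖(A *ᵥ x) k‖ ^ 2 ≤ Fintype.card κ * n * c * ∑ j, ‖x j‖ ^ 2 := by
  have hk : ∀ k, ‖(A *ᵥ x) k‖ ^ 2 ≤ n * c * ∑ j, ‖x j‖ ^ 2 := by
    intro k
    calc ‖(A *ᵥ x) k‖ ^ 2 ≤ (∑ j, ‖A k j‖ * ‖x j‖) ^ 2 := by
          gcongr
          rw [Matrix.mulVec, dotProduct]
          refine (norm_sum_le _ _).trans_eq ?_
          simp only [norm_mul]
      _ ≤ (∑ j, ‖A k j‖ ^ 2) * ∑ j, ‖x j‖ ^ 2 := Finset.sum_mul_sq_le_sq_mul_sq _ _ _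
      _ ≤ (∑ _j : Fin n, c) * ∑ j, ‖x j‖ ^ 2 := by
          gcongr with j; exact hA k j
      _ = _ := by simp
  calc _ ≤ ∑ _k : κ, n * c * ∑ j, ‖x j‖ ^ 2 := Finset.sum_le_sum fun k _ => hk k
    _ = _ := by simp; ring

/-- A form with a Lagrange expansion whose coefficients are at least `T` and whose successive
remainders dominate `d / q` times the standard form, `d` being the preceding coefficient. -/
def IsBalanced (q T : ℝ) : (n : ℕ) → ((Fin n → ℂ) → ℝ) → Prop
  | 0, _ => True
  | n + 1, R => ∃ (d : ℝ) (u : Fin n → ℂ) (S : (Fin n → ℂ) → ℝ), T ≤ d ∧ S 0 = 0 ∧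
      (∀ y, R y = d * ‖y 0 + u ⬝ᵥ Fin.tail y‖ ^ 2 + S (Fin.tail y)) ∧
      (∀ x, d / q * ∑ i, ‖x i‖ ^ 2 ≤ S x) ∧ IsBalanced q T n S

lemma isBalanced_of_unipotent {ρ q T : ℝ} {N : ℕ} (hN : 0 < N) (hρ : 1 ≤ ρ) (hq : 0 < q)
    (hT : 0 ≤ T) {n : ℕ} (hn : n ≤ N) {H V : Matrix (Fin n) (Fin n) ℂ} {d : Fin n → ℝ}
    (hH : IsUpperUnipotent H) (hV : IsUpperUnipotent V) (hVH : V * H = 1)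
    (hVρ : ∀ i j, ‖V i j‖ ≤ ρ) (hTd : ∀ i, T ≤ d i) (hd : ∀ l j, l ≤ j → d l ≤ q * d j) :
    IsBalanced (N ^ 2 * ρ ^ 2 * q) T n fun x => ∑ i, d i * ‖(H *ᵥ x) i‖ ^ 2 := by
  induction n with
  | zero => trivial
  | succ n ih =>
    obtain ⟨u, A, hA, rfl⟩ := hH.exists_unitBlock
    obtain ⟨v, B, hB, rfl⟩ := hV.exists_unitBlock
    have hBA : B * A = 1 := by
      rw [unitBlock_mul] at hVH
      ext i j
      have := congrFun (congrFun hVH i.succ) j.succ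
      simpa [Matrix.one_apply] using this
    have hN1 : (0 : ℝ) < N := by exact_mod_cast hN
    have hnN : (n : ℝ) ≤ N := by exact_mod_cast (by omega : n ≤ N)
    refine ⟨d 0, u, fun x => ∑ i, d i.succ * ‖(A *ᵥ x) i‖ ^ 2, hTd 0, by simp, fun y => ?_,
      fun x => ?_, ih (by omega) hA hB hBA (fun i j => by simpa using hVρ i.succ j.succ)
        (fun i => hTd _) fun l j hlj => hd _ _ (Fin.succ_le_succ_iff.2 hlj)⟩
    · dsimp only
      rw [Fin.sum_univ_succ, unitBlock_mulVec]; simp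
    · have hx : B *ᵥ (A *ᵥ x) = x := by rw [Matrix.mulVec_mulVec, hBA, Matrix.one_mulVec]
      have h1 := sum_norm_sq_mulVec_le B (c := ρ ^ 2)
        (fun i j => by
          have : ‖B i j‖ ≤ ρ := by simpa using hVρ i.succ j.succ
          gcongr) (A *ᵥ x)
      rw [hx, Fintype.card_fin] at h1
      set Y := ∑ i, ‖(A *ᵥ x) i‖ ^ 2 with hY
      have hY0 : 0 ≤ Y := Finset.sum_nonneg fun _ _ => by positivity
      have h2 : ∑ i, ‖x i‖ ^ 2 ≤ N ^ 2 * ρ ^ 2 * Y := by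
        refine h1.trans ?_
        rw [pow_two (N : ℝ)]
        gcongr
      have hd0 : 0 ≤ d 0 := hT.trans (hTd 0)
      calc d 0 / (N ^ 2 * ρ ^ 2 * q) * ∑ i, ‖x i‖ ^ 2
          ≤ d 0 / (N ^ 2 * ρ ^ 2 * q) * (N ^ 2 * ρ ^ 2 * Y) := by gcongr
        _ = d 0 / q * Y := by field_simp
        _ = ∑ i, d 0 / q * ‖(A *ᵥ x) i‖ ^ 2 := by rw [hY, Finset.mul_sum]
        _ ≤ _ := by
          refine Finset.sum_le_sum fun i _ => ?_
          gcongr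
          rw [div_le_iff₀ hq, mul_comm]
          exact hd _ _ (Fin.zero_le _)

lemma Nat.exists_sq_add_six (a : ℕ) (ha : 3 ≤ a) : ∃ (s : ℕ) (c : Fin 4 → ℕ), 0 < s ∧
    s ^ 4 ≤ a ∧ a ≤ (2 * s) ^ 4 ∧ 1 + s ^ 2 + ∑ i, c i ^ 2 = a := by
  set r := Nat.sqrt a with hr
  set s := Nat.sqrt r with hs
  have hr1 : r * r ≤ a := Nat.sqrt_le a
  have hr2 : a < (r + 1) * (r + 1) := Nat.lt_succ_sqrt a
  have hs1 : s * s ≤ r := Nat.sqrt_le r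
  have hs2 : r < (s + 1) * (s + 1) := Nat.lt_succ_sqrt r
  have hr0 : 0 < r := Nat.sqrt_pos.2 (by omega)
  have hs0 : 0 < s := Nat.sqrt_pos.2 hr0
  have hle : 1 + s ^ 2 ≤ a := by
    rcases Nat.lt_or_ge r 2 with h | h
    · have : r = 1 := by omega
      nlinarith
    · nlinarith
  obtain ⟨c₁, c₂, c₃, c₄, hc⟩ := Nat.sum_four_squares (a - (1 + s ^ 2))
  refine ⟨s, ![c₁, c₂, c₃, c₄], hs0, ?_, ?_, ?_⟩
  · calc s ^ 4 = (s * s) * (s * s) := by ring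
      _ ≤ r * r := Nat.mul_le_mul hs1 hs1
      _ ≤ a := hr1
  · have h1 : r + 1 ≤ (s + 1) * (s + 1) := hs2
    calc a ≤ (r + 1) * (r + 1) := hr2.le
      _ ≤ ((s + 1) * (s + 1)) * ((s + 1) * (s + 1)) := Nat.mul_le_mul h1 h1
      _ = (s + 1) ^ 4 := by ring
      _ ≤ _ := Nat.pow_le_pow_left (by omega) 4
  · simp only [Fin.sum_univ_four]
    simp
    omega

/-- Dividing `m` by a sum of squares `∑ c k ^ 2` with small errors. -/
lemma exists_balanced_lift {ℓ : ℕ} (hpos : 0 < ℓ) {a s : ℕ} {c : Fin 4 → ℕ} (hs : 0 < s)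
    (hsa : s ^ 4 ≤ a) (has : a ≤ (2 * s) ^ 4) (hc : 1 + s ^ 2 + ∑ i, c i ^ 2 = a)
    {m : ℂ} (hm : m ∈ intO ℓ) :
    ∃ w : Fin 6 → ℂ, (∀ k, w k ∈ intO ℓ) ∧
      ∑ k, ((Fin.cons 1 (Fin.cons s c) : Fin 6 → ℕ) k : ℂ) * w k = m ∧
      ∀ k, ‖w k - (Fin.cons 1 (Fin.cons s c) : Fin 6 → ℕ) k * m / a‖ ^ 2 ≤
        25 * coverO ℓ ^ 2 * Real.sqrt a := by
  have hρ := one_le_coverO ℓ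
  set ρ := coverO ℓ with hρdef
  set b : ℝ := Real.sqrt (Real.sqrt a) with hb
  have hb2 : b ^ 2 = Real.sqrt a := Real.sq_sqrt (Real.sqrt_nonneg _)
  have hb4 : b ^ 4 = a := by
    rw [show b ^ 4 = (b ^ 2) ^ 2 by ring, hb2, Real.sq_sqrt (Nat.cast_nonneg a)]
  have hb0 : 0 ≤ b := Real.sqrt_nonneg _
  have hsb : (s : ℝ) ≤ b := by
    refine le_of_pow_le_pow_left₀ (n := 4) (by norm_num) hb0 ?_
    rw [hb4]; exact_mod_cast hsa
  have hbs : b ≤ 2 * s := by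
    refine le_of_pow_le_pow_left₀ (n := 4) (by norm_num) (by positivity) ?_
    rw [hb4]; exact_mod_cast has
  have hs1 : (1 : ℝ) ≤ s := by exact_mod_cast hs
  have hb1 : 1 ≤ b := hs1.trans hsb
  have haC : (a : ℂ) ≠ 0 := by
    have : 0 < a := by omega
    exact_mod_cast this.ne'
  have hsC : (s : ℂ) ≠ 0 := by exact_mod_cast hs.ne'
  have hround : ∀ z : ℂ, ∃ w ∈ intO ℓ, ‖w - z‖ ≤ ρ := by
    intro z
    obtain ⟨w, hw, h⟩ := exists_mem_intO_norm_add_le hpos (-z)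
    exact ⟨w, hw, by rwa [neg_add_eq_sub] at h⟩
  choose w hw hwF using fun i : Fin 4 => hround (c i * m / a)
  set t : ℂ := -∑ i, c i * (w i - c i * m / a) with ht
  obtain ⟨w₁, hw₁, hF₁⟩ := hround (s * m / a + t / s)
  have htb : ‖t‖ ≤ 2 * ρ * b ^ 2 := by
    have hcs : (∑ i, (c i : ℝ)) ≤ 2 * b ^ 2 := by
      refine le_of_pow_le_pow_left₀ (n := 2) (by norm_num) (by positivity) ?_
      have h1 : (∑ i, (c i : ℝ)) ^ 2 ≤ 4 * ∑ i, (c i : ℝ) ^ 2 := by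
        have := sq_sum_le_card_mul_sum_sq (s := Finset.univ) (f := fun i : Fin 4 => (c i : ℝ))
        simpa using this
      have h2 : (∑ i, (c i : ℝ) ^ 2) ≤ a := by
        exact_mod_cast (by omega : ∑ i, c i ^ 2 ≤ a)
      calc _ ≤ 4 * (a : ℝ) := h1.trans (by linarith)
        _ = _ := by rw [← hb4]; ring
    calc ‖t‖ ≤ ∑ i, ‖(c i : ℂ) * (w i - c i * m / a)‖ := by
          rw [ht, norm_neg]; exact norm_sum_le _ _
      _ ≤ ∑ i, (c i : ℝ) * ρ := by
          refine Finset.sum_le_sum fun i _ => ?_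
          rw [norm_mul, Complex.norm_natCast]
          gcongr
          exact hwF i
      _ = (∑ i, (c i : ℝ)) * ρ := by rw [Finset.sum_mul]
      _ ≤ (2 * b ^ 2) * ρ := by gcongr
      _ = _ := by ring
  have hts : ‖t / s‖ ≤ 4 * ρ * b := by
    rw [norm_div, Complex.norm_natCast, div_le_iff₀ (by positivity)]
    refine htb.trans ?_
    have := mul_le_mul_of_nonneg_left hbs (by positivity : 0 ≤ 2 * ρ * b)
    calc _ = 2 * ρ * b * b := by ring
      _ ≤ _ := this
      _ = _ := by ring
  have hcC : (1 : ℂ) + s ^ 2 + ∑ i, (c i : ℂ) ^ 2 = a := by exact_mod_cast hc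
  have hconv : ∀ z : ℂ, ‖z‖ ≤ 5 * ρ * b → ‖z‖ ^ 2 ≤ 25 * ρ ^ 2 * Real.sqrt a := by
    intro z hz
    calc ‖z‖ ^ 2 ≤ (5 * ρ * b) ^ 2 := by gcongr
      _ = _ := by rw [← hb2]; ring
  have hρb : ρ ≤ ρ * b := le_mul_of_one_le_right (by linarith) hb1
  set w₀ : ℂ := m - ∑ i, c i * w i - s * w₁ with hw₀
  refine ⟨Fin.cons w₀ (Fin.cons w₁ w), ?_, ?_, ?_⟩
  · have h0 : w₀ ∈ intO ℓ := sub_mem (sub_mem hm (sum_mem fun i _ =>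
      mul_mem (natCast_mem _ _) (hw i))) (mul_mem (natCast_mem _ _) hw₁)
    intro k
    refine Fin.cases ?_ (fun k => Fin.cases ?_ (fun k => ?_) k) k
    · exact h0
    · exact hw₁
    · exact hw k
  · rw [Fin.sum_univ_succ, Fin.sum_univ_succ]
    simp only [Fin.cons_zero, Fin.cons_succ, hw₀]
    push_cast
    ring
  · have hsplit : ∑ i, (c i : ℂ) * (w i - c i * m / a) =
        ∑ i, (c i : ℂ) * w i - (∑ i, (c i : ℂ) ^ 2) * (m / a) := by
      rw [Finset.sum_mul, ← Finset.sum_sub_distrib]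
      refine Finset.sum_congr rfl fun i _ => ?_
      ring
    have h0 : w₀ - 1 * m / a = -s * (w₁ - (s * m / a + t / s)) := by
      have : (s : ℂ) * (t / s) = t := mul_div_cancel₀ _ hsC
      have hma : m = (1 + s ^ 2 + ∑ i, (c i : ℂ) ^ 2) * (m / a) := by
        rw [hcC]; field_simp
      rw [mul_sub, mul_add, neg_mul (s : ℂ) (t / s), this, ht, hsplit, hw₀]
      nth_rewrite 1 [hma]
      ring
    intro k
    refine hconv _ ?_
    refine Fin.cases ?_ (fun k => Fin.cases ?_ (fun k => ?_) k) k
    · simp only [Fin.cons_zero, Nat.cast_one]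
      rw [h0, norm_mul, norm_neg, Complex.norm_natCast]
      calc (s : ℝ) * _ ≤ b * ρ := by gcongr
        _ ≤ _ := by nlinarith
    · simp only [Fin.cons_zero, Fin.cons_succ]
      calc ‖w₁ - s * m / a‖ = ‖(w₁ - (s * m / a + t / s)) + t / s‖ := by congr 1; ring
        _ ≤ ρ + 4 * ρ * b := (norm_add_le _ _).trans (add_le_add hF₁ hts)
        _ ≤ _ := by linarith
    · simp only [Fin.cons_succ]
      exact (hwF k).trans (by nlinarith)

end Peel

section SumOfNorms

/-- The value at `x` of the hermitian form with Gram matrix `M`. -/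
noncomputable def hermForm {n : ℕ} (M : Matrix (Fin n) (Fin n) ℂ) (x : Fin n → ℂ) : ℝ :=
  (star x ⬝ᵥ M *ᵥ x).re

lemma hermForm_add {n : ℕ} (M P : Matrix (Fin n) (Fin n) ℂ) (x : Fin n → ℂ) :
    hermForm (M + P) x = hermForm M x + hermForm P x := by
  simp [hermForm, Matrix.add_mulVec, dotProduct_add]

lemma hermForm_conjTranspose_mul_self {κ : Type} [Fintype κ] {n : ℕ} (B : Matrix κ (Fin n) ℂ)
    (x : Fin n → ℂ) : hermForm (Bᴴ * B) x = normForm B x := by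
  rw [hermForm, ← Matrix.mulVec_mulVec, Matrix.dotProduct_mulVec, Matrix.vecMul_conjTranspose,
    star_star, normForm, dotProduct, Complex.re_sum]
  refine Finset.sum_congr rfl fun k _ => ?_
  rw [Pi.star_apply, mul_comm, Complex.star_def, Complex.mul_conj, Complex.normSq_eq_norm_sq,
    Complex.ofReal_re]

/-- The block matrix `[0 0; 0 P]`. -/
def zeroBlock {n : ℕ} (P : Matrix (Fin n) (Fin n) ℂ) : Matrix (Fin (n + 1)) (Fin (n + 1)) ℂ :=
  Matrix.of (Fin.cons 0 fun i => Fin.cons 0 (P i))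

lemma hermForm_zeroBlock {n : ℕ} (P : Matrix (Fin n) (Fin n) ℂ) (y : Fin (n + 1) → ℂ) :
    hermForm (zeroBlock P) y = hermForm P (Fin.tail y) := by
  simp [hermForm, zeroBlock, dotProduct, Matrix.mulVec, Fin.sum_univ_succ, Fin.tail]

lemma repByNorms_conjTranspose_mul_self {ℓ n r : ℕ} {κ : Type} [Fintype κ]
    (B : Matrix κ (Fin n) ℂ) (hB : ∀ i j, B i j ∈ intO ℓ) (hr : Fintype.card κ ≤ r) :
    RepByNorms ℓ n r (Bᴴ * B) := by
  obtain ⟨e⟩ : Nonempty (κ ↪ Fin r) := Function.Embedding.nonempty_of_card_le (by simpa using hr)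
  refine ⟨Matrix.of fun i j => Function.extend e (fun k => B k j) 0 i, fun i j => ?_, ?_⟩
  · rw [Matrix.of_apply]
    by_cases h : ∃ k, e k = i
    · obtain ⟨k, rfl⟩ := h
      rw [e.injective.extend_apply]
      exact hB k j
    · rw [Function.extend_apply' _ _ _ h]
      exact zero_mem _
  · ext a b
    simp only [Matrix.mul_apply, Matrix.conjTranspose_apply, Matrix.of_apply]
    refine Fintype.sum_of_injective e e.injective _ _ (fun i hi => ?_) fun k => ?_
    · rw [Function.extend_apply' _ _ _ hi]; simp
    · rw [e.injective.extend_apply, e.injective.extend_apply]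

lemma RepByNorms.mono {ℓ n r s : ℕ} {M : Matrix (Fin n) (Fin n) ℂ} (h : RepByNorms ℓ n r M)
    (hrs : r ≤ s) : RepByNorms ℓ n s M := by
  obtain ⟨B, hB, rfl⟩ := h
  exact repByNorms_conjTranspose_mul_self B hB (by simpa using hrs)

lemma RepByNorms.conj {ℓ n r : ℕ} {M : Matrix (Fin n) (Fin n) ℂ} (h : RepByNorms ℓ n r M)
    {U : Matrix (Fin n) (Fin n) ℂ} (hU : ∀ i j, U i j ∈ intO ℓ) :
    RepByNorms ℓ n r (Uᴴ * M * U) := by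
  obtain ⟨B, hB, rfl⟩ := h
  refine ⟨B * U, matrix_mul_mem_intO hB hU, ?_⟩
  rw [Matrix.conjTranspose_mul]; simp only [Matrix.mul_assoc]

lemma RepByNorms.add_zeroBlock {ℓ n r : ℕ} {P : Matrix (Fin n) (Fin n) ℂ}
    (h : RepByNorms ℓ n r P) {κ : Type} [Fintype κ] (B : Matrix κ (Fin (n + 1)) ℂ)
    (hB : ∀ i j, B i j ∈ intO ℓ) :
    RepByNorms ℓ (n + 1) (Fintype.card κ + r) (Bᴴ * B + zeroBlock P) := by
  obtain ⟨A, hA, rfl⟩ := h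
  have := repByNorms_conjTranspose_mul_self (ℓ := ℓ) (r := Fintype.card κ + r)
    (Matrix.fromRows B (Matrix.of fun k => Fin.cons 0 (A k)))
    (fun i j => by
      rcases i with i | i
      · exact hB i j
      · refine Fin.cases ?_ (fun j => ?_) j
        · exact zero_mem _
        · exact hA i j) (by simp)
  rw [Matrix.conjTranspose_fromRows_eq_fromCols_conjTranspose,
    Matrix.fromCols_mul_fromRows] at this
  convert this using 2
  ext i j
  refine Fin.cases ?_ (fun i => ?_) i <;> refine Fin.cases ?_ (fun j => ?_) j <;>
    simp [zeroBlock, Matrix.mul_apply]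

/-- Splitting off six norms from a hermitian form with large first diagonal entry. -/
lemma exists_split_six {ℓ : ℕ} (hpos : 0 < ℓ) {n a : ℕ} (ha : 3 ≤ a)
    {M : Matrix (Fin (n + 1)) (Fin (n + 1)) ℂ} (hM : ∀ i j, M i j ∈ intO ℓ)
    (hMh : Mᴴ = M) (haM : M 0 0 = a) :
    ∃ (B : Matrix (Fin 6) (Fin (n + 1)) ℂ) (P : Matrix (Fin n) (Fin n) ℂ),
      (∀ i j, B i j ∈ intO ℓ) ∧ (∀ i j, P i j ∈ intO ℓ) ∧ Pᴴ = P ∧ M = Bᴴ * B + zeroBlock P ∧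
      ∀ x : Fin n → ℂ, ∃ x₀ : ℂ, normForm B (Fin.cons x₀ x) ≤
        150 * n * coverO ℓ ^ 2 * Real.sqrt a * ∑ i, ‖x i‖ ^ 2 := by
  obtain ⟨s, c, hs, hsa, has, hc⟩ := Nat.exists_sq_add_six a ha
  choose w hw hwm hwF using fun j : Fin n =>
    exists_balanced_lift hpos hs hsa has hc (hM 0 j.succ)
  set γ : Fin 6 → ℕ := Fin.cons 1 (Fin.cons s c) with hγ
  have hγa : ∑ k, (γ k : ℂ) * γ k = a := by
    rw [← hc, hγ, Fin.sum_univ_succ, Fin.sum_univ_succ]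
    push_cast
    simp [pow_two, add_assoc]
  set W : Matrix (Fin 6) (Fin n) ℂ := Matrix.of fun k j => w j k with hW
  set B : Matrix (Fin 6) (Fin (n + 1)) ℂ := Matrix.of fun k => Fin.cons (γ k : ℂ) (W k) with hB
  have hWm : ∀ k j, W k j ∈ intO ℓ := fun k j => hw j k
  refine ⟨B, M.submatrix Fin.succ Fin.succ - Wᴴ * W, ?_, ?_, ?_, ?_, ?_⟩
  · intro k j
    refine Fin.cases ?_ (fun j => ?_) j
    · exact natCast_mem _ _
    · exact hWm k j
  · intro i j
    exact sub_mem (hM _ _)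
      (matrix_mul_mem_intO (A := Wᴴ) (fun _ _ => star_mem_intO (hWm _ _)) hWm i j)
  · rw [Matrix.conjTranspose_sub, Matrix.conjTranspose_mul, Matrix.conjTranspose_conjTranspose,
      Matrix.conjTranspose_submatrix, hMh]
  · ext i j
    rw [Matrix.add_apply, Matrix.mul_apply]
    refine Fin.cases ?_ (fun i => ?_) i <;> refine Fin.cases ?_ (fun j => ?_) j
    · simp [hB, zeroBlock, haM, hγa]
    · simp [hB, hW, zeroBlock, hwm]
    · have : M i.succ 0 = star (M 0 i.succ) := by
        conv_lhs => rw [← hMh]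
        rfl
      rw [this, ← hwm i, star_sum]
      simp [hB, hW, zeroBlock, mul_comm]
    · simp [hB, zeroBlock, Matrix.mul_apply]
  · intro x
    refine ⟨-∑ j, M 0 j.succ * x j / a, ?_⟩
    set F : Matrix (Fin 6) (Fin n) ℂ := Matrix.of fun k j => w j k - γ k * M 0 j.succ / a
    have hF := sum_norm_sq_mulVec_le F (fun k j => hwF j k) x
    have hBF : ∀ k, (B *ᵥ (Fin.cons (-∑ j, M 0 j.succ * x j / a) x : Fin (n + 1) → ℂ)) k =
        (F *ᵥ x) k := by
      intro k
      simp only [Matrix.mulVec, dotProduct, Fin.sum_univ_succ, Fin.cons_zero, Fin.cons_succ, hB, F,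
        Matrix.of_apply, hW, sub_mul, Finset.sum_sub_distrib]
      rw [mul_neg, Finset.mul_sum, neg_add_eq_sub]
      congr 1
      refine Finset.sum_congr rfl fun j _ => ?_
      ring
    rw [normForm]
    simp only [hBF]
    refine hF.trans_eq ?_
    rw [Fintype.card_fin]; push_cast; ring

lemma exists_natCast_eq_of_re_nonneg {ℓ : ℕ} (hpos : 0 < ℓ) {z : ℂ} (hz : z ∈ intO ℓ)
    (him : z.im = 0) (hre : 0 ≤ z.re) : ∃ a : ℕ, z = a := by
  obtain ⟨k, rfl⟩ := exists_int_of_mem_intO_of_im_eq_zero hpos hz him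
  have hk : 0 ≤ k := by
    rw [Complex.intCast_re] at hre; exact_mod_cast hre
  exact ⟨k.toNat, by exact_mod_cast congrArg (Int.cast : ℤ → ℂ) (Int.toNat_of_nonneg hk).symm⟩

/-- A hermitian form which is close to a balanced form with large coefficients is a sum of few
norms. -/
theorem repByNorms_of_isBalanced {ℓ N : ℕ} (hpos : 0 < ℓ) (hN : 0 < N) {q T : ℝ} (hq : 1 ≤ q)
    (hT : (300 * coverO ℓ ^ 2 * N ^ 2 * q) ^ 2 ≤ T) {n : ℕ} (hn : n ≤ N)
    {M : Matrix (Fin n) (Fin n) ℂ} (hM : ∀ i j, M i j ∈ intO ℓ) (hMh : Mᴴ = M)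
    {R : (Fin n → ℂ) → ℝ} (hR : IsBalanced q T n R)
    (hlow : ∀ x, (N + n) / (2 * N) * R x ≤ hermForm M x) (hup : ∀ x, hermForm M x ≤ R x) :
    RepByNorms ℓ n (6 * n) M := by
  induction n with
  | zero => exact ⟨0, fun i => i.elim0, by ext i; exact i.elim0⟩
  | succ n ih =>
    obtain ⟨d, u, S, hTd, hS0, hRS, hSlow, hSbal⟩ := hR
    have hN1 : (1 : ℝ) ≤ N := by exact_mod_cast hN
    have hnN : (n : ℝ) ≤ N := by exact_mod_cast (by omega : n ≤ N)
    have hρ := one_le_coverO ℓ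
    set ρ := coverO ℓ with hρdef
    have hbig : (300 : ℝ) ≤ 300 * ρ ^ 2 * N ^ 2 * q := by
      have h1 : 1 ≤ ρ ^ 2 := one_le_pow₀ hρ
      have h2 : (1 : ℝ) ≤ (N : ℝ) ^ 2 := one_le_pow₀ hN1
      have := one_le_mul_of_one_le_of_one_le (one_le_mul_of_one_le_of_one_le h1 h2) hq
      nlinarith
    have hd : 90000 ≤ d := by nlinarith
    have hd0 : 0 < d := by linarith
    have hsq : 300 * ρ ^ 2 * N ^ 2 * q ≤ Real.sqrt d :=
      Real.le_sqrt_of_sq_le (hT.trans hTd)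
    have hhalf : 1 / 2 ≤ ((N : ℝ) + (n + 1 : ℕ)) / (2 * N) := by
      rw [div_le_div_iff₀ (by norm_num) (by positivity)]
      push_cast; linarith [(Nat.cast_nonneg n : (0 : ℝ) ≤ n)]
    have hM00 : hermForm M (Fin.cons 1 0) = (M 0 0).re := by
      simp [hermForm, dotProduct, Matrix.mulVec, Fin.sum_univ_succ]
    have hR00 : R (Fin.cons 1 0) = d := by
      rw [hRS]; simp [hS0]
    have hlow0 := hlow (Fin.cons 1 0)
    have hup0 := hup (Fin.cons 1 0)
    rw [hM00, hR00] at hlow0 hup0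
    have hd2 : d / 2 ≤ (M 0 0).re := by
      refine le_trans ?_ hlow0
      have := mul_le_mul_of_nonneg_right hhalf hd0.le
      linarith
    have him : (M 0 0).im = 0 := by
      have : star (M 0 0) = M 0 0 := by
        conv_rhs => rw [← hMh]
        rfl
      exact Complex.conj_eq_iff_im.1 this
    obtain ⟨a, haM⟩ := exists_natCast_eq_of_re_nonneg hpos (hM 0 0) him (by linarith)
    rw [haM, Complex.natCast_re] at hd2 hup0
    have ha3 : 3 ≤ a := by
      have : (3 : ℝ) ≤ a := by linarith
      exact_mod_cast this
    obtain ⟨B, P, hB, hP, hPh, hMBP, hBx⟩ := exists_split_six hpos ha3 hM hMh haM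
    have hMx : ∀ y, hermForm M y = normForm B y + hermForm P (Fin.tail y) := by
      intro y
      rw [hMBP, hermForm_add, hermForm_conjTranspose_mul_self, hermForm_zeroBlock]
    have hPrep : RepByNorms ℓ n (6 * n) P := by
      refine ih (by omega) hP hPh hSbal (fun x => ?_) fun x => ?_
      · obtain ⟨x₀, hx₀⟩ := hBx x
        have h1 := hlow (Fin.cons x₀ x)
        rw [hMx, hRS] at h1
        simp only [Fin.tail_cons, Fin.cons_zero] at h1
        have hx0 : 0 ≤ ∑ i, ‖x i‖ ^ 2 := Finset.sum_nonneg fun _ _ => by positivity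
        have hSx := hSlow x
        have hSx0 : 0 ≤ S x := le_trans (by positivity) hSx
        have h2 : 150 * n * ρ ^ 2 * Real.sqrt a * ∑ i, ‖x i‖ ^ 2 ≤ 1 / (2 * N) * S x := by
          have hq0 : 0 < q := by linarith
          have hsa : Real.sqrt a ≤ Real.sqrt d := Real.sqrt_le_sqrt hup0
          have hdd : Real.sqrt d * Real.sqrt d = d := Real.mul_self_sqrt hd0.le
          have h3 : 150 * n * ρ ^ 2 * Real.sqrt a ≤ 1 / (2 * N) * (d / q) := by
            rw [div_mul_div_comm, one_mul, le_div_iff₀ (by positivity)]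
            calc 150 * n * ρ ^ 2 * Real.sqrt a * (2 * N * q)
                ≤ 150 * N * ρ ^ 2 * Real.sqrt d * (2 * N * q) := by gcongr
              _ = 300 * ρ ^ 2 * N ^ 2 * q * Real.sqrt d := by ring
              _ ≤ Real.sqrt d * Real.sqrt d := by gcongr
              _ = d := hdd
          calc _ ≤ 1 / (2 * N) * (d / q) * ∑ i, ‖x i‖ ^ 2 := by gcongr
            _ = 1 / (2 * N) * (d / q * ∑ i, ‖x i‖ ^ 2) := by ring
            _ ≤ _ := by gcongr
        have h4 : ((N : ℝ) + (n + 1 : ℕ)) / (2 * N) * S x ≤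
            ((N : ℝ) + (n + 1 : ℕ)) / (2 * N) * (d * ‖x₀ + u ⬝ᵥ x‖ ^ 2 + S x) := by
          gcongr
          have : 0 ≤ d * ‖x₀ + u ⬝ᵥ x‖ ^ 2 := by positivity
          linarith
        have h5 : ((N : ℝ) + n) / (2 * N) * S x =
            ((N : ℝ) + (n + 1 : ℕ)) / (2 * N) * S x - 1 / (2 * N) * S x := by
          push_cast; ring
        rw [h5]
        linarith
      · have h1 := hup (Fin.cons (-(u ⬝ᵥ x)) x)
        rw [hMx, hRS] at h1
        simp only [Fin.tail_cons, Fin.cons_zero, neg_add_cancel] at h1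
        have := normForm_nonneg B (Fin.cons (-(u ⬝ᵥ x)) x)
        simp at h1
        linarith
    have := hPrep.add_zeroBlock B hB
    rw [← hMBP, Fintype.card_fin] at this
    exact this.mono (by omega)

end SumOfNorms

section Threshold

lemma one_le_ratioBound {ρ : ℝ} (hρ : 1 ≤ ρ) {n : ℕ} (hn : 0 < n) : 1 ≤ ratioBound ρ n := by
  have hn1 : (1 : ℝ) ≤ n := by exact_mod_cast hn
  have h1 : 1 ≤ ρ ^ 2 := one_le_pow₀ hρ
  have h2 : 0 ≤ Real.log (8 * n * ρ ^ 2) := Real.log_nonneg (by nlinarith)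
  have h3 := Real.log_nonneg hn1
  exact Real.one_le_exp (by positivity)

lemma ratioBound_mono {ρ : ℝ} (hρ : 1 ≤ ρ) {n N : ℕ} (hn : 0 < n) (hnN : n ≤ N) :
    ratioBound ρ n ≤ ratioBound ρ N := by
  have hn1 : (1 : ℝ) ≤ n := by exact_mod_cast hn
  have hN1 : (n : ℝ) ≤ N := by exact_mod_cast hnN
  have h1 : 1 ≤ ρ ^ 2 := one_le_pow₀ hρ
  have h2 : 0 ≤ Real.log (8 * N * ρ ^ 2) := Real.log_nonneg (by nlinarith)
  have h3 := Real.log_nonneg hn1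
  unfold ratioBound
  gcongr

/-- A form of rank at most `N` whose minimum over `𝓞` exceeds this bound can be diagonalised
by splitting off norms. -/
noncomputable def minThreshold (ρ : ℝ) (N : ℕ) : ℝ :=
  ratioBound ρ N * (300 * ρ ^ 2 * N ^ 2 * (N ^ 2 * ρ ^ 2 * ratioBound ρ N)) ^ 2

lemma one_le_sq_mul_ratioBound {ρ : ℝ} (hρ : 1 ≤ ρ) {N : ℕ} (hN : 0 < N) :
    1 ≤ N ^ 2 * ρ ^ 2 * ratioBound ρ N := by
  have hN1 : (1 : ℝ) ≤ N := by exact_mod_cast hN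
  exact one_le_mul_of_one_le_of_one_le (one_le_mul_of_one_le_of_one_le (one_le_pow₀ hN1)
    (one_le_pow₀ hρ)) (one_le_ratioBound hρ hN)

theorem repByNorms_of_minThreshold_le {ℓ N : ℕ} (hpos : 0 < ℓ) [IsPrincipalIdealRing (intO ℓ)]
    (hN : 0 < N) {κ : Type} [Fintype κ] {n : ℕ} (hn : n ≤ N) (B : Matrix κ (Fin n) ℂ)
    (hBO : ∀ i j, B i j ∈ intO ℓ) (hB : Function.Injective B.mulVec)
    (hmin : ∀ x : Fin n → ℂ, (∀ i, x i ∈ intO ℓ) → x ≠ 0 →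
      minThreshold (coverO ℓ) N ≤ normForm B x) :
    RepByNorms ℓ n (6 * n) (Bᴴ * B) := by
  have hρ := one_le_coverO ℓ
  have hN1 : (0 : ℝ) < N := by exact_mod_cast hN
  have hnN : (n : ℝ) ≤ N := by exact_mod_cast hn
  have hq1 := one_le_ratioBound hρ hN
  obtain ⟨U, U', H, V, d, h⟩ := exists_isReduction hpos B hB
  have hratio : ∀ l j, l ≤ j → d l ≤ ratioBound (coverO ℓ) N * d j := fun l j hlj =>
    (h.le_ratioBound_mul hpos hlj).trans
      (mul_le_mul_of_nonneg_right (ratioBound_mono hρ l.pos hn) (h.d_pos j).le)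
  set T := (300 * coverO ℓ ^ 2 * N ^ 2 * (N ^ 2 * coverO ℓ ^ 2 * ratioBound (coverO ℓ) N)) ^ 2
    with hT
  have hTd : ∀ i, T ≤ d i := by
    intro i
    let z : Fin n := ⟨0, i.pos⟩
    have hz : ∀ k, k ≠ z → z < k := fun k hk => by
      rw [Fin.lt_def]
      exact Nat.pos_of_ne_zero fun h0 => hk (Fin.ext h0)
    have hform := h.form (Pi.single z 1)
    have hsum : ∑ k, d k * ‖(H *ᵥ Pi.single z 1) k‖ ^ 2 = d z := by
      rw [Finset.sum_eq_single z]
      · simp [h.H_unip.diag]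
      · intro k _ hk
        simp [h.H_unip.lower _ _ (hz k hk)]
      · simp
    have hle := hmin (U *ᵥ Pi.single z 1) (fun i => by simpa using h.U_mem i z) (fun h0 => by
      have : U' *ᵥ (U *ᵥ Pi.single z 1) = 0 := by rw [h0, Matrix.mulVec_zero]
      rw [Matrix.mulVec_mulVec, h.U'_mul, Matrix.one_mulVec] at this
      simpa using congrFun this z)
    rw [hform, hsum] at hle
    have := hle.trans (hratio z i (by rw [Fin.le_def]; exact Nat.zero_le _))
    exact le_of_mul_le_mul_left this (by linarith)
  have hbal := isBalanced_of_unipotent hN hρ (by linarith) (by positivity) hn h.H_unip h.V_unip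
    h.V_mul h.V_le hTd hratio
  have hform : ∀ x, hermForm ((B * U)ᴴ * (B * U)) x = ∑ i, d i * ‖(H *ᵥ x) i‖ ^ 2 := fun x => by
    rw [hermForm_conjTranspose_mul_self, normForm_mul, h.form]
  have hBU := matrix_mul_mem_intO hBO h.U_mem
  have hrep := repByNorms_of_isBalanced hpos hN (one_le_sq_mul_ratioBound hρ hN) le_rfl hn
    (matrix_mul_mem_intO (A := (B * U)ᴴ) (fun _ _ => star_mem_intO (hBU _ _)) hBU)
    (by rw [Matrix.conjTranspose_mul, Matrix.conjTranspose_conjTranspose]) hbal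
    (fun x => by
      rw [hform]
      refine mul_le_of_le_one_left (Finset.sum_nonneg fun i _ =>
        mul_nonneg (h.d_pos i).le (by positivity)) ?_
      rw [div_le_one (by positivity)]
      linarith)
    (fun x => (hform x).le)
  have := hrep.conj h.U'_mem
  rwa [← Matrix.mul_assoc, Matrix.mul_assoc, Matrix.mul_assoc B, h.U_mul, Matrix.mul_one,
    Matrix.conjTranspose_mul, ← Matrix.mul_assoc, ← Matrix.conjTranspose_mul, h.U_mul,
    Matrix.conjTranspose_one, Matrix.one_mul] at this

lemma exists_intO_mulVec_eq_zero {ℓ : ℕ} {κ : Type} [Fintype κ] {n : ℕ} (B : Matrix κ (Fin n) ℂ)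
    (hBO : ∀ i j, B i j ∈ intO ℓ) (hB : ¬Function.Injective B.mulVec) :
    ∃ x : Fin n → ℂ, (∀ i, x i ∈ intO ℓ) ∧ x ≠ 0 ∧ B *ᵥ x = 0 := by
  have hG := matrix_mul_mem_intO (A := Bᴴ) (fun _ _ => star_mem_intO (hBO _ _)) hBO
  set G : Matrix (Fin n) (Fin n) (intO ℓ) := Matrix.of fun i j => ⟨(Bᴴ * B) i j, hG i j⟩
  have hGmap : G.map (intO ℓ).subtype = Bᴴ * B := rfl
  have hdet : G.det = 0 := by
    have hker : ∃ v, v ≠ 0 ∧ (Bᴴ * B) *ᵥ v = 0 := by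
      simp only [Function.Injective, not_forall] at hB
      obtain ⟨x, y, hxy, hne⟩ := hB
      refine ⟨x - y, sub_ne_zero.2 hne, ?_⟩
      rw [← Matrix.mulVec_mulVec, Matrix.mulVec_sub, hxy, sub_self, Matrix.mulVec_zero]
    have h0 := Matrix.exists_mulVec_eq_zero_iff.1 hker
    rw [← hGmap, ← RingHom.mapMatrix_apply, ← RingHom.map_det] at h0
    exact Subtype.ext h0
  obtain ⟨v, hv, hGv⟩ := Matrix.exists_mulVec_eq_zero_iff.2 hdet
  refine ⟨fun i => v i, fun i => (v i).2, fun h0 => hv ?_, ?_⟩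
  · ext i; exact congrFun h0 i
  · have h1 : (Bᴴ * B) *ᵥ (fun i => (v i : ℂ)) = 0 := by
      ext i
      have := congrArg (intO ℓ).subtype (congrFun hGv i)
      rw [RingHom.map_mulVec, hGmap] at this
      simpa [Function.comp_def] using this
    rw [← Matrix.mulVec_mulVec] at h1
    have h2 : star (B *ᵥ fun i => (v i : ℂ)) ⬝ᵥ (B *ᵥ fun i => (v i : ℂ)) = 0 := by
      rw [Matrix.star_mulVec, ← Matrix.dotProduct_mulVec, h1, dotProduct_zero]
    exact dotProduct_star_self_eq_zero.1 h2

lemma conjTranspose_mul_self_eq_add_zeroBlock {κ : Type} [Fintype κ] {n : ℕ}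
    (C : Matrix κ (Fin (n + 1)) ℂ) [DecidablePred fun k => C k 0 ≠ 0] :
    Cᴴ * C = (C.submatrix (Subtype.val : {k // C k 0 ≠ 0} → κ) id)ᴴ *
        C.submatrix (Subtype.val : {k // C k 0 ≠ 0} → κ) id +
      zeroBlock ((C.submatrix (Subtype.val : {k // ¬C k 0 ≠ 0} → κ) Fin.succ)ᴴ *
        C.submatrix (Subtype.val : {k // ¬C k 0 ≠ 0} → κ) Fin.succ) := by
  ext i j
  rw [Matrix.add_apply, Matrix.mul_apply,
    ← Fintype.sum_subtype_add_sum_subtype (fun k => C k 0 ≠ 0), Matrix.mul_apply]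
  congr 1
  have h0 : ∀ k : {k // ¬C k 0 ≠ 0}, C k 0 = 0 := fun k => not_not.1 k.2
  refine Fin.cases ?_ (fun i => ?_) i <;> refine Fin.cases ?_ (fun j => ?_) j <;>
    simp [zeroBlock, Matrix.mul_apply, h0]

/-- Every sum of norms of rank `n ≤ N` is a sum of at most `n * (6 * N + ⌊T⌋)` norms, where `T`
is the bound `minThreshold`. -/
theorem repByNorms_of_le {ℓ N : ℕ} (hpos : 0 < ℓ) [IsPrincipalIdealRing (intO ℓ)]
    (hN : 0 < N) {κ : Type} [Fintype κ] {n : ℕ} (hn : n ≤ N) (B : Matrix κ (Fin n) ℂ)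
    (hBO : ∀ i j, B i j ∈ intO ℓ) :
    RepByNorms ℓ n (n * (6 * N + ⌊minThreshold (coverO ℓ) N⌋₊)) (Bᴴ * B) := by
  classical
  induction n generalizing κ with
  | zero => exact ⟨0, fun i j => j.elim0, by ext i; exact i.elim0⟩
  | succ n ih =>
    set T := minThreshold (coverO ℓ) N with hT
    have hρ := one_le_coverO ℓ
    have hN1 : (0 : ℝ) < N := by exact_mod_cast hN
    have hq1 := one_le_ratioBound hρ hN
    have hT0 : 0 < T := by rw [hT, minThreshold]; positivity
    by_cases hmin : ∀ x : Fin (n + 1) → ℂ, (∀ i, x i ∈ intO ℓ) → x ≠ 0 → T ≤ normForm B x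
    · have hB : Function.Injective B.mulVec := by
        by_contra hB
        obtain ⟨x, hx, hx0, hBx⟩ := exists_intO_mulVec_eq_zero B hBO hB
        have := hmin x hx hx0
        rw [normForm, hBx] at this
        simp at this
        linarith
      refine (repByNorms_of_minThreshold_le hpos hN hn B hBO hB hmin).mono ?_
      nlinarith
    · push Not at hmin
      obtain ⟨x, hx, hx0, hlt⟩ := hmin
      obtain ⟨U, V, hU, hV, hUV, -, a, ha, hxa⟩ := exists_unimodular_col_intO hx hx0
      have ha0 : a ≠ 0 := by
        rintro rfl
        exact hx0 (by rw [hxa, zero_smul])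
      have ha1 := one_le_norm_sq_of_mem_intO hpos ha ha0
      set C := B * U with hC
      have hCO : ∀ i j, C i j ∈ intO ℓ := matrix_mul_mem_intO hBO hU
      have hcol : ∑ k, ‖C k 0‖ ^ 2 < T := by
        have h1 : ∑ k, ‖C k 0‖ ^ 2 = normForm B (U.col 0) := rfl
        rw [h1]
        refine lt_of_le_of_lt ?_ hlt
        rw [hxa, normForm_smul]
        exact le_mul_of_one_le_left (normForm_nonneg _ _) ha1
      have hcard : Fintype.card {k // C k 0 ≠ 0} ≤ ⌊T⌋₊ := by
        refine Nat.le_floor (le_trans ?_ hcol.le)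
        rw [← Fintype.sum_subtype_add_sum_subtype (fun k => C k 0 ≠ 0)]
        have h1 : (Fintype.card {k // C k 0 ≠ 0} : ℝ) ≤
            ∑ k : {k // C k 0 ≠ 0}, ‖C k 0‖ ^ 2 := by
          have : ∑ _k : {k // C k 0 ≠ 0}, (1 : ℝ) ≤ ∑ k : {k // C k 0 ≠ 0}, ‖C k 0‖ ^ 2 :=
            Finset.sum_le_sum fun k _ => one_le_norm_sq_of_mem_intO hpos (hCO _ _) k.2
          simpa using this
        have h2 : 0 ≤ ∑ k : {k // ¬C k 0 ≠ 0}, ‖C k 0‖ ^ 2 :=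
          Finset.sum_nonneg fun _ _ => by positivity
        linarith
      have hih := ih (by omega)
        (C.submatrix (Subtype.val : {k // ¬C k 0 ≠ 0} → κ) Fin.succ) fun i j => hCO _ _
      have hrep := hih.add_zeroBlock
        (C.submatrix (Subtype.val : {k // C k 0 ≠ 0} → κ) id) fun i j => hCO _ _
      rw [← conjTranspose_mul_self_eq_add_zeroBlock] at hrep
      have hconj := (hrep.mono (s := (n + 1) * (6 * N + ⌊T⌋₊)) (by nlinarith)).conj hV
      have hCV : C * V = B := by rw [hC, Matrix.mul_assoc, hUV, Matrix.mul_one]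
      rwa [← Matrix.mul_assoc, Matrix.mul_assoc, hCV, ← Matrix.conjTranspose_mul, hCV] at hconj

lemma exists_minThreshold_le {ρ ε : ℝ} (hρ : 1 ≤ ρ) (hε : 0 < ε) :
    ∃ C > 0, ∀ N : ℕ, 1 ≤ N →
      N * (6 * N + minThreshold ρ N) ≤ C * Real.exp (ε * Real.sqrt N) := by
  set A := Real.log (8 * ρ ^ 2) with hA
  have hρ2 : 1 ≤ ρ ^ 2 := one_le_pow₀ hρ
  have hA0 : 0 ≤ A := Real.log_nonneg (by linarith)
  set c := 72 + 30 * (A + 8) with hc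
  refine ⟨180000 * ρ ^ 8 * Real.exp (c ^ 2 / (4 * ε)), by positivity, fun N hN => ?_⟩
  have hN1 : (1 : ℝ) ≤ N := by exact_mod_cast hN
  have hN0 : (0 : ℝ) < N := by linarith
  set q := ratioBound ρ N with hq
  have hq1 : 1 ≤ q := one_le_ratioBound hρ hN
  set L := Real.log N with hL
  have hL0 : 0 ≤ L := Real.log_nonneg hN1
  have hqe : q = Real.exp ((A + L) * (2 + L)) := by
    rw [hq, ratioBound, show 8 * (N : ℝ) * ρ ^ 2 = 8 * ρ ^ 2 * N by ring,
      Real.log_mul (by positivity) hN0.ne']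
  have hT : minThreshold ρ N = 90000 * ρ ^ 8 * (N : ℝ) ^ 8 * q ^ 3 := by
    rw [minThreshold]; ring
  have hNe : (N : ℝ) = Real.exp L := (Real.exp_log hN0).symm
  have h6 : 6 * (N : ℝ) ≤ minThreshold ρ N := by
    rw [hT]
    have h1 : 1 ≤ ρ ^ 8 := one_le_pow₀ hρ
    have h2 : (N : ℝ) ≤ (N : ℝ) ^ 8 := le_self_pow₀ hN1 (by norm_num)
    have h3 : 1 ≤ q ^ 3 := one_le_pow₀ hq1
    calc 6 * (N : ℝ) ≤ 90000 * 1 * N * 1 := by linarith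
      _ ≤ _ := by gcongr
  have h1 : N * (6 * N + minThreshold ρ N) ≤
      180000 * ρ ^ 8 * Real.exp (9 * L + 3 * ((A + L) * (2 + L))) := by
    calc N * (6 * N + minThreshold ρ N) ≤ N * (2 * minThreshold ρ N) := by gcongr; linarith
      _ = 180000 * ρ ^ 8 * ((N : ℝ) ^ 9 * q ^ 3) := by rw [hT]; ring
      _ = _ := by
        rw [Real.exp_add, hqe, ← Real.exp_nat_mul]
        congr 2
        nth_rewrite 1 [hNe]
        rw [← Real.exp_nat_mul]; norm_num
  set y := Real.sqrt (Real.sqrt N) with hy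
  set z := Real.sqrt y with hz
  have hs1 : 1 ≤ Real.sqrt N := Real.one_le_sqrt.2 hN1
  have hy1 : 1 ≤ y := Real.one_le_sqrt.2 hs1
  have hz1 : 1 ≤ z := Real.one_le_sqrt.2 hy1
  have hy2 : y ^ 2 = Real.sqrt N := Real.sq_sqrt (by linarith)
  have hz2 : z ^ 2 = y := Real.sq_sqrt (by linarith)
  have hz8 : z ^ 8 = N := by
    rw [show z ^ 8 = ((z ^ 2) ^ 2) ^ 2 by ring, hz2, hy2, Real.sq_sqrt hN0.le]
  have hLz : L ≤ 8 * z := by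
    rw [hL, ← hz8, Real.log_pow]
    have := Real.log_le_self (by linarith : 0 ≤ z)
    push_cast; linarith
  have h2 : 9 * L + 3 * ((A + L) * (2 + L)) ≤ c * y := by
    have hAL : A + L ≤ (A + 8) * z := by nlinarith
    have h2L : 2 + L ≤ 10 * z := by linarith
    have h9 : 9 * L ≤ 72 * z ^ 2 := by nlinarith
    have : (A + L) * (2 + L) ≤ ((A + 8) * z) * (10 * z) := by gcongr
    rw [← hz2, hc]
    nlinarith
  have h3 : c * y ≤ c ^ 2 / (4 * ε) + ε * Real.sqrt N := by
    rw [← hy2, ← sub_nonneg]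
    have : c ^ 2 / (4 * ε) + ε * y ^ 2 - c * y = (c - 2 * ε * y) ^ 2 / (4 * ε) := by
      field_simp; ring
    rw [this]; positivity
  calc _ ≤ _ := h1
    _ ≤ 180000 * ρ ^ 8 * Real.exp (c ^ 2 / (4 * ε) + ε * Real.sqrt N) :=
      mul_le_mul_of_nonneg_left (Real.exp_le_exp.2 (h2.trans h3)) (by positivity)
    _ = _ := by rw [Real.exp_add]; ring

end Threshold

/-- Suppose `𝓞` is a principal ideal domain.  For every `ε > 0` there is a constant `C > 0`
such that for every `n ≥ 1`, every `n`-variable positive definite integral hermitian form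
over `𝓞` that is represented by some `I_r` (`r` a positive integer) is represented by `I_g`
for some positive integer `g ≤ C·e^{(k_E+ε)√n}`, where `k_E = (4+4√2)√β_E`. -/
theorem gO_growth_sqrt_n (ℓ : ℕ) (hsf : Squarefree ℓ) (hpos : 0 < ℓ)
    (hPID : IsPrincipalIdealRing (intO ℓ)) :
    ∀ ε : ℝ, 0 < ε → ∃ C : ℝ, 0 < C ∧ ∀ n : ℕ, 1 ≤ n →
      ∀ M : Matrix (Fin n) (Fin n) ℂ, (∀ i j, M i j ∈ intO ℓ) → M.PosDef →
        (∃ r : ℕ, 0 < r ∧ RepByNorms ℓ n r M) →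
        ∃ g : ℕ, 0 < g ∧
          (g : ℝ) ≤ C * Real.exp
            (((4 + 4 * Real.sqrt 2) * Real.sqrt (betaE ℓ) + ε) * Real.sqrt n) ∧
          RepByNorms ℓ n g M := by
  intro ε hε
  obtain ⟨C, hC, hCN⟩ := exists_minThreshold_le (one_le_coverO ℓ) hε
  refine ⟨C, hC, fun n hn M _ _ hrep => ?_⟩
  obtain ⟨r, -, B, hB, rfl⟩ := hrep
  have hT : 0 ≤ minThreshold (coverO ℓ) n :=
    mul_nonneg (Real.exp_pos _).le (sq_nonneg _)
  refine ⟨n * (6 * n + ⌊minThreshold (coverO ℓ) n⌋₊), Nat.mul_pos hn (by omega), ?_,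
    repByNorms_of_le hpos hn le_rfl B hB⟩
  push_cast
  calc (n : ℝ) * (6 * n + ⌊minThreshold (coverO ℓ) n⌋₊)
      ≤ n * (6 * n + minThreshold (coverO ℓ) n) := by gcongr; exact Nat.floor_le hT
    _ ≤ C * Real.exp (ε * Real.sqrt n) := hCN n hn
    _ ≤ _ := by
      gcongr
      exact le_add_of_nonneg_left (by positivity)
end
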